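/- arXiv:1301.5149 — 7 statements merged into one kernel-verified Lean document; each statement's English description precedes it below -/
import Mathlib

section
/- For every graph G, the following three statements are equivalent: (1) G is perfect; (2) for every nonempty induced subgraph H of G and every vertex v of H, H contains a stable set that contains v and intersects all maximum cliques of H; (3) for every nonempty induced subgraph H of G, H contains a stable set that intersects all maximum cliques of H. -/
open SimpleGraph

/-- A graph is perfect if every induced subgraph has chromatic number equal to
its clique number. -/
def IsPerfect {V : Type} (G : SimpleGraph V) : Prop :=
  ∀ s : Set V, (G.induce s).chromaticNumber = ((G.induce s).cliqueNum : ℕ∞)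

/-- A stable (independent) set: pairwise non-adjacent vertices. -/
def IsStableSet {W : Type} (H : SimpleGraph W) (S : Set W) : Prop :=
  S.Pairwise fun a b => ¬ H.Adj a b

/-- A proper colouring with exactly as many colours as a clique has vertices uses every colour
on that clique. -/
theorem SimpleGraph.Coloring.exists_mem_eq_of_isNClique {W : Type} {H : SimpleGraph W} {n : ℕ}
    (C : H.Coloring (Fin n)) {K : Finset W} (hK : H.IsNClique n K) (c : Fin n) :
    ∃ u ∈ K, C u = c := by
  have hinj : Set.InjOn C K := fun a ha b hb hab => by
    by_contra hne
    exact C.valid (hK.isClique ha hb hne) hab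
  have himage : K.image C = Finset.univ := by
    rw [← Finset.card_eq_iff_eq_univ, Finset.card_image_of_injOn hinj, hK.card_eq,
      Fintype.card_fin]
  have hc : c ∈ K.image C := himage ▸ Finset.mem_univ c
  simpa using hc

/-- Colourings extend by one colour over a stable set. -/
theorem SimpleGraph.Colorable.succ_of_diff {V : Type} {G : SimpleGraph V} {s T : Set V} {n : ℕ}
    (hT : IsStableSet G T) (h : (G.induce (s \ T)).Colorable n) :
    (G.induce s).Colorable (n + 1) := by
  classical
  obtain ⟨C⟩ := h
  refine ⟨Coloring.mk (fun x => if hx : x.1 ∈ T then Fin.last n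
    else (C ⟨x.1, x.2, hx⟩).castSucc) fun {x y} hxy => ?_⟩
  have hadj : G.Adj x.1 y.1 := hxy
  by_cases hx : x.1 ∈ T <;> by_cases hy : y.1 ∈ T
  · exact absurd hadj (hT hx hy hadj.ne)
  · simp [hx, hy, (Fin.castSucc_lt_last _).ne']
  · simp [hx, hy]
  · have hC : (G.induce (s \ T)).Adj ⟨x.1, x.2, hx⟩ ⟨y.1, y.2, hy⟩ := hadj
    simpa [hx, hy] using C.valid hC

/-- If every nonempty induced subgraph has a stable set meeting all of its maximum cliques, then
every induced subgraph without cliques of size `n + 1` is `n`-colourable. -/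
theorem SimpleGraph.CliqueFree.colorable_of_forall_exists_isStableSet {V : Type} [Finite V]
    {G : SimpleGraph V}
    (hG : ∀ s : Set V, s.Nonempty → ∃ S : Set s, IsStableSet (G.induce s) S ∧
      ∀ K : Finset s, (G.induce s).IsNClique (G.induce s).cliqueNum K → ∃ u ∈ K, u ∈ S)
    {n : ℕ} {s : Set V} (hs : (G.induce s).CliqueFree (n + 1)) : (G.induce s).Colorable n := by
  induction n generalizing s with
  | zero =>
    have : IsEmpty s := ⟨fun v => hs {v} (by simp [isNClique_iff])⟩
    exact colorable_zero_iff.2 this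
  | succ n ih =>
    rcases s.eq_empty_or_nonempty with rfl | hne
    · exact .of_isEmpty _
    obtain ⟨S, hS, hmeet⟩ := hG s hne
    have hT : IsStableSet G (Subtype.val '' S) := by
      rintro _ ⟨a, ha, rfl⟩ _ ⟨b, hb, rfl⟩ hab
      exact hS ha hb fun h => hab (congrArg _ h)
    refine Colorable.succ_of_diff hT (ih fun K hK => ?_)
    let f := Set.embeddingOfSubset (s \ Subtype.val '' S) s Set.sdiff_subset
    have hK' : (G.induce s).IsNClique (n + 1) (K.map f) := by
      rw [isNClique_induce_iff] at hK ⊢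
      rw [Finset.map_map]
      exact hK
    have hnum : (G.induce s).cliqueNum = n + 1 := by
      refine le_antisymm ?_ ?_
      · obtain ⟨L, hL⟩ := (G.induce s).exists_isNClique_cliqueNum
        by_contra hlt
        exact hs.mono (by omega) L hL
      · simpa [hK'.card_eq] using hK'.isClique.card_le_cliqueNum
    obtain ⟨u, hu, huS⟩ := hmeet _ (hnum ▸ hK')
    obtain ⟨w, -, rfl⟩ := Finset.mem_map.1 hu
    exact w.2.2 ⟨_, huS, rfl⟩

/-- Folklore: the three characterizations of perfection are equivalent. -/
theorem perfect_characterizations {V : Type} [Fintype V] (G : SimpleGraph V) :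
    List.TFAE
      [IsPerfect G,
       ∀ s : Set V, s.Nonempty → ∀ v : s, ∃ S : Set s,
          v ∈ S ∧ IsStableSet (G.induce s) S ∧
          ∀ K : Finset s, (G.induce s).IsNClique (G.induce s).cliqueNum K →
            ∃ u ∈ K, u ∈ S,
       ∀ s : Set V, s.Nonempty → ∃ S : Set s,
          IsStableSet (G.induce s) S ∧
          ∀ K : Finset s, (G.induce s).IsNClique (G.induce s).cliqueNum K →
            ∃ u ∈ K, u ∈ S] := by
  tfae_have 1 → 2 := by
    intro hG s _ v
    obtain ⟨C⟩ := chromaticNumber_le_iff_colorable.1 (hG s).le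
    refine ⟨{u | C u = C v}, rfl, fun a ha b hb _ hab => C.valid hab (ha.trans hb.symm), ?_⟩
    exact fun K hK => C.exists_mem_eq_of_isNClique hK (C v)
  tfae_have 2 → 3 := by
    intro h s hs
    obtain ⟨S, -, hS⟩ := h s hs ⟨_, hs.some_mem⟩
    exact ⟨S, hS⟩
  tfae_have 3 → 1 := by
    intro h s
    refine le_antisymm ?_ ?_
    · refine (CliqueFree.colorable_of_forall_exists_isStableSet h fun K hK => ?_).chromaticNumber_le
      have := hK.isClique.card_le_cliqueNum
      rw [hK.card_eq] at this
      omega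
    · exact cliqueNum_le_chromaticNumber
  tfae_finish
end

section
/- If G is a perfect graph and G′ is obtained from G by replicating a vertex v, then G′ is perfect (Lovász's replication lemma). -/
open SimpleGraph

/-- The graph obtained from `G` by replicating the vertex `v`: a new vertex
(`none`) is added, adjacent to `v` and to all neighbours of `v`. -/
def replicate {V : Type} (G : SimpleGraph V) (v : V) : SimpleGraph (Option V) :=
  SimpleGraph.fromRel fun a b =>
    match a, b with
    | some a', some b' => G.Adj a' b'
    | some a', none => a' = v ∨ G.Adj a' v
    | none, some b' => b' = v ∨ G.Adj b' v
    | none, none => False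

/-- In a finite graph, perfection says that every induced subgraph without a clique on `n + 1`
vertices is `n`-colorable. -/
theorem isPerfect_iff_colorable {V : Type} [Finite V] {G : SimpleGraph V} :
    IsPerfect G ↔ ∀ (s : Set V) (n : ℕ),
      (G.induce s).CliqueFree (n + 1) → (G.induce s).Colorable n := by
  refine ⟨fun hG s n h ↦ ?_, fun h s ↦ le_antisymm ?_ cliqueNum_le_chromaticNumber⟩
  · rw [← chromaticNumber_le_iff_colorable, hG s, Nat.cast_le]
    by_contra! hlt
    obtain ⟨t, ht⟩ := (G.induce s).exists_isNClique_cliqueNum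
    exact ht.not_cliqueFree (h.mono hlt)
  · rw [chromaticNumber_le_iff_colorable]
    refine h s _ fun t ht ↦ ?_
    have := ht.isClique.card_le_cliqueNum
    grind [ht.card_eq]

/-- A graph without a clique on `n + 1` vertices that embeds into a finite perfect graph is
`n`-colorable. -/
theorem IsPerfect.colorable_of_embedding {V W : Type} [Finite V] {G : SimpleGraph V}
    {H : SimpleGraph W} (hG : IsPerfect G) (f : H ↪g G) {n : ℕ} (hH : H.CliqueFree (n + 1)) :
    H.Colorable n := by
  have e : H ≃g G.induce (Set.range f) := f.isoInduceRange
  exact (isPerfect_iff_colorable.1 hG _ n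
    (hH.comap ⟨e.symm.toEmbedding.toCopy⟩)).of_hom e.toHom

section replicate

variable {V : Type} {G : SimpleGraph V} {v x y : V}

@[simp] theorem replicate_adj_some_some :
    (replicate G v).Adj (some x) (some y) ↔ G.Adj x y := by
  simp only [replicate, fromRel_adj, ne_eq, Option.some.injEq, G.adj_comm y x, or_self]
  exact ⟨And.right, fun h ↦ ⟨h.ne, h⟩⟩

@[simp] theorem replicate_adj_some_none :
    (replicate G v).Adj (some x) none ↔ x = v ∨ G.Adj x v := by
  simp [replicate]

@[simp] theorem replicate_adj_none_some :
    (replicate G v).Adj none (some x) ↔ x = v ∨ G.Adj x v := by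
  simp [replicate]

/-- An induced subgraph of `replicate G v` that misses `v` or its replica embeds into `G`. -/
def replicateInduceEmbedding (S : Set (Option V)) (h : none ∈ S → some v ∉ S) :
    (replicate G v).induce S ↪g G where
  toFun x := x.1.getD v
  inj' := by
    rintro ⟨_ | x, hx⟩ ⟨_ | y, hy⟩ hxy <;> simp at hxy ⊢ <;> grind
  map_rel_iff' := by
    rintro ⟨_ | x, hx⟩ ⟨_ | y, hy⟩
    · change G.Adj v v ↔ (replicate G v).Adj none none
      simp
    · change G.Adj v y ↔ (replicate G v).Adj none (some y)
      have : y ≠ v := by grind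
      simp [this, G.adj_comm v y]
    · change G.Adj x v ↔ (replicate G v).Adj (some x) none
      have : x ≠ v := by grind
      simp [this]
    · exact (replicate_adj_some_some (v := v)).symm

/-- The graph induced by `G` on the old vertices in `S` embeds into the one induced by
`replicate G v` on `S`. -/
def inducePreimageEmbedding (S : Set (Option V)) :
    G.induce (some ⁻¹' S) ↪g (replicate G v).induce S where
  toFun x := ⟨some x.1, x.2⟩
  inj' := by
    rintro ⟨x, hx⟩ ⟨y, hy⟩ hxy
    simpa using hxy
  map_rel_iff' := replicate_adj_some_some (v := v)

/-- If `S` contains `v` and its replica and induces no clique on `n + 1` vertices, then deleting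
from an `n`-colored `G` the color class of `v`, but not `v` itself, leaves no clique on `n`
vertices. -/
theorem cliqueFreeOn_of_replicate {S : Set (Option V)} {n : ℕ}
    (hS : (replicate G v).CliqueFreeOn S (n + 1)) (hnone : none ∈ S) (hv : some v ∈ S)
    (c : (G.induce (some ⁻¹' S)).Coloring (Fin n)) :
    G.CliqueFreeOn {x | ∃ h : some x ∈ S, c ⟨x, h⟩ = c ⟨v, hv⟩ → x = v} n := by
  classical
  intro K hK hKn
  have hKS (x : K) : some x.1 ∈ S := (hK x.2).1
  have hinj : Function.Injective fun x : K ↦ c ⟨x, hKS x⟩ := by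
    intro x y hxy
    by_contra hne
    exact c.valid (v := ⟨x, hKS x⟩) (w := ⟨y, hKS y⟩)
      (hKn.isClique x.2 y.2 fun h ↦ hne (Subtype.ext h)) hxy
  have hsurj := ((Fintype.bijective_iff_injective_and_card _).2
    ⟨hinj, by simp [hKn.card_eq]⟩).2
  obtain ⟨x, hx⟩ := hsurj (c ⟨v, hv⟩)
  have hvK : v ∈ K := (hK x.2).2 hx ▸ x.2
  have hmap : (replicate G v).IsNClique n (K.map .some) := by
    refine ⟨?_, by simp [hKn.card_eq]⟩
    simp only [Finset.coe_map, Function.Embedding.some_apply]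
    rintro _ ⟨a, ha, rfl⟩ _ ⟨b, hb, rfl⟩ hab
    simpa using! hKn.isClique ha hb fun h ↦ hab (congrArg some h)
  refine hS ?_ (hmap.insert (a := none) ?_)
  · intro z hz
    simp only [Finset.coe_insert, Finset.coe_map, Set.mem_insert_iff] at hz
    obtain rfl | ⟨a, ha, rfl⟩ := hz
    exacts [hnone, hKS ⟨a, ha⟩]
  · simp only [Finset.mem_map, Function.Embedding.some_apply]
    rintro _ ⟨a, ha, rfl⟩
    rw [replicate_adj_none_some, or_iff_not_imp_left]
    exact hKn.isClique ha hvK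

/-- The color class of `v`, with `v` exchanged for its replica, is independent, so it extends a
coloring of the remaining vertices by one color. -/
theorem colorable_succ_of_replicate {S : Set (Option V)} {α : Type*} {m : ℕ} (hv : some v ∈ S)
    (c : (G.induce (some ⁻¹' S)).Coloring α)
    (h : (G.induce {x | ∃ h : some x ∈ S, c ⟨x, h⟩ = c ⟨v, hv⟩ → x = v}).Colorable m) :
    ((replicate G v).induce S).Colorable (m + 1) := by
  classical
  obtain ⟨d⟩ := h
  set R := {x | ∃ h : some x ∈ S, c ⟨x, h⟩ = c ⟨v, hv⟩ → x = v}
  have hR {x} (hx : some x ∈ S) (hxR : x ∉ R) : c ⟨x, hx⟩ = c ⟨v, hv⟩ ∧ x ≠ v := by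
    simpa [R, hx] using hxR
  let color (x : Option V) : Option (Fin m) :=
    x.bind fun y ↦ if h : y ∈ R then some (d ⟨y, h⟩) else none
  have hcolor : ∀ {x y : S}, ((replicate G v).induce S).Adj x y → color x ≠ color y := by
    rintro ⟨_ | x, hx⟩ ⟨_ | y, hy⟩ hxy <;>
      simp only [comap_adj, Function.Embedding.subtype_apply, replicate_adj_some_some,
        replicate_adj_some_none, replicate_adj_none_some, SimpleGraph.irrefl] at hxy
    · by_cases hyR : y ∈ R
      · simp [color, hyR]
      · obtain ⟨hc, hne⟩ := hR hy hyR
        exact absurd hc (c.valid (hxy.resolve_left hne))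
    · by_cases hxR : x ∈ R
      · simp [color, hxR]
      · obtain ⟨hc, hne⟩ := hR hx hxR
        exact absurd hc (c.valid (hxy.resolve_left hne))
    · by_cases hxR : x ∈ R <;> by_cases hyR : y ∈ R
      · simpa [color, hxR, hyR] using d.valid (v := ⟨x, hxR⟩) (w := ⟨y, hyR⟩) hxy
      · simp [color, hxR, hyR]
      · simp [color, hxR, hyR]
      · exact absurd ((hR hx hxR).1.trans (hR hy hyR).1.symm)
          (c.valid (v := ⟨x, hx⟩) (w := ⟨y, hy⟩) hxy)
  simpa using (Coloring.mk (fun x : S ↦ color x) hcolor).colorable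

end replicate

/-- Lovász's replication lemma: perfection is preserved by replication. -/
theorem replication_lemma {V : Type} [Fintype V] (G : SimpleGraph V) (v : V)
    (hG : IsPerfect G) : IsPerfect (replicate G v) := by
  refine isPerfect_iff_colorable.2 fun S n hS ↦ ?_
  by_cases h : none ∈ S → some v ∉ S
  · exact hG.colorable_of_embedding (replicateInduceEmbedding S h) hS
  push Not at h
  obtain ⟨hnone, hv⟩ := h
  obtain ⟨c⟩ := isPerfect_iff_colorable.1 hG (some ⁻¹' S) n
    (hS.comap ⟨(inducePreimageEmbedding (v := v) S).toCopy⟩)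
  obtain _ | m := n
  · exact (c ⟨v, hv⟩).elim0
  refine colorable_succ_of_replicate hv c (isPerfect_iff_colorable.1 hG _ m ?_)
  rw [cliqueFree_induce_iff] at hS ⊢
  exact cliqueFreeOn_of_replicate hS hnone hv c
end

section
/- If a graph is perfect, then its complement is perfect (Lovász's perfect graph theorem). -/
open SimpleGraph

/-- Witness form of equality of chromatic number and clique number for the subgraph induced on `S`:
a clique in `S` together with a proper colouring of `S` with as many colours. -/
def HasTightColoring {V : Type} (G : SimpleGraph V) (S : Finset V) : Prop :=
  ∃ K ⊆ S, G.IsClique (K : Set V) ∧ ∃ c : V → ℕ, (∀ v ∈ S, c v < K.card) ∧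
    ∀ u ∈ S, ∀ v ∈ S, G.Adj u v → c u ≠ c v

/-- The number of vertices in `S` is at most the product of the clique number and the
independence number of the subgraph induced on `S`. -/
def CardLeCliqueMulIndep {V : Type} (G : SimpleGraph V) (S : Finset V) : Prop :=
  ∀ w a : ℕ, (∀ K ⊆ S, G.IsClique (K : Set V) → K.card ≤ w) →
    (∀ A ⊆ S, G.IsIndepSet (A : Set V) → A.card ≤ a) → S.card ≤ w * a

theorem CardLeCliqueMulIndep.compl {V : Type} {G : SimpleGraph V} {S : Finset V}
    (h : CardLeCliqueMulIndep G S) : CardLeCliqueMulIndep Gᶜ S := by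
  intro w a hw ha
  rw [mul_comm]
  exact h a w (fun K hK hc => ha K hK (by simpa using hc))
    (fun A hA hi => hw A hA (by simpa using hi))

theorem HasTightColoring.cardLeCliqueMulIndep {V : Type} {G : SimpleGraph V} {S : Finset V}
    (h : HasTightColoring G S) : CardLeCliqueMulIndep G S := by
  classical
  obtain ⟨K, hKS, hK, c, hc, hproper⟩ := h
  intro w a hw ha
  have hcard : S.card ≤ a * (Finset.range K.card).card := by
    refine Finset.card_le_mul_card_image_of_maps_to (f := c)
      (fun v hv => Finset.mem_range.2 (hc v hv)) a ?_
    intro i _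
    refine ha _ (Finset.filter_subset _ _) ?_
    intro u hu v hv _ huv
    simp only [Finset.coe_filter, Set.mem_ofPred_eq] at hu hv
    exact hproper u hu.1 v hv.1 huv (hu.2.trans hv.2.symm)
  rw [Finset.card_range, mul_comm] at hcard
  exact hcard.trans (Nat.mul_le_mul_right _ (hw K hKS hK))

theorem exists_max_card_subset {V : Type} (S : Finset V) (P : Finset V → Prop) (h : P ∅) :
    ∃ K ⊆ S, P K ∧ ∀ L ⊆ S, P L → L.card ≤ K.card := by
  classical
  obtain ⟨K, hK, hmax⟩ := Finset.exists_max_image (S.powerset.filter P) Finset.card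
    ⟨∅, by simp [h]⟩
  simp only [Finset.mem_filter, Finset.mem_powerset] at hK hmax
  exact ⟨K, hK.1, hK.2, fun L hL hPL => hmax L ⟨hL, hPL⟩⟩

/-- If `A` and `K` are families of subsets of `S` with `|K i ∩ A j| = 1` for `i ≠ j` and
`K i ∩ A i = ∅`, then the family has at most `|S|` members. -/
theorem card_le_card_of_card_inter {V ι : Type} [DecidableEq V] [Fintype ι]
    (hι : Fintype.card ι ≠ 1) (S : Finset V) (A K : ι → Finset V) (hK : ∀ i, K i ⊆ S)
    (hdisj : ∀ i, Disjoint (K i) (A i))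
    (hone : ∀ i j, i ≠ j → (K i ∩ A j).card = 1) : Fintype.card ι ≤ S.card := by
  classical
  let f : ι → (S → ℚ) := fun j v => if (v : V) ∈ A j then 1 else 0
  have hf : LinearIndependent ℚ f := by
    rw [Fintype.linearIndependent_iff]
    intro g hg
    have hsum : ∀ i, ∑ j, g j * ((K i ∩ A j).card : ℚ) = 0 := by
      intro i
      have hcard : ∀ j, ((K i ∩ A j).card : ℚ) =
          ∑ v ∈ K i, if v ∈ A j then (1 : ℚ) else 0 := by
        intro j
        rw [Finset.sum_boole, Finset.filter_mem_eq_inter]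
      simp only [hcard, Finset.mul_sum]
      rw [Finset.sum_comm]
      refine Finset.sum_eq_zero fun v hv => ?_
      have := congrFun hg ⟨v, hK i hv⟩
      simpa [f, Finset.sum_apply] using this
    have hg' : ∀ i, g i = ∑ j, g j := by
      intro i
      have h := hsum i
      have : ∀ j, g j * ((K i ∩ A j).card : ℚ) = g j - if i = j then g j else 0 := by
        intro j
        by_cases hij : i = j
        · subst hij
          simp [Finset.disjoint_iff_inter_eq_empty.1 (hdisj i)]
        · simp [hone i j hij, hij]
      simp only [this, Finset.sum_sub_distrib, Finset.sum_ite_eq, Finset.mem_univ, if_true] at h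
      linarith
    have htotal : ∑ j, g j = (Fintype.card ι : ℚ) * ∑ j, g j := by
      conv_lhs => rw [Finset.sum_congr rfl fun i _ => hg' i]
      simp
    have hne : (Fintype.card ι : ℚ) ≠ 1 := by exact_mod_cast hι
    have hzero : ∑ j, g j = 0 := by
      have : ((Fintype.card ι : ℚ) - 1) * ∑ j, g j = 0 := by linarith
      exact (mul_eq_zero.1 this).resolve_left (sub_ne_zero.2 hne)
    intro i
    rw [hg' i, hzero]
  simpa using hf.fintype_card_le_finrank

theorem card_inter_le_one {V : Type} [DecidableEq V] {G : SimpleGraph V} {K A : Finset V}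
    (hK : G.IsClique (K : Set V)) (hA : G.IsIndepSet (A : Set V)) : (K ∩ A).card ≤ 1 := by
  rw [Finset.card_le_one]
  intro u hu v hv
  rw [Finset.mem_inter] at hu hv
  by_contra huv
  exact hA hu.2 hv.2 huv (hK hu.1 hv.1 huv)

/-- If removing an independent set `A` from `S` leaves a tight subgraph while `S` itself is not
tight, then some maximum clique of `S` avoids `A`. -/
theorem exists_maximum_clique_disjoint {V : Type} [DecidableEq V] {G : SimpleGraph V}
    {S K₀ A : Finset V} (hS : ¬ HasTightColoring G S) (hK₀S : K₀ ⊆ S)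
    (hK₀ : G.IsClique (K₀ : Set V))
    (hmax : ∀ L ⊆ S, G.IsClique (L : Set V) → L.card ≤ K₀.card)
    (hA : G.IsIndepSet (A : Set V)) (hT : HasTightColoring G (S \ A)) :
    ∃ K ⊆ S, G.IsClique (K : Set V) ∧ K.card = K₀.card ∧ Disjoint K A := by
  obtain ⟨K, hKS, hK, c, hc, hproper⟩ := hT
  have hKS' : K ⊆ S := hKS.trans Finset.sdiff_subset
  rcases (hmax K hKS' hK).eq_or_lt with heq | hlt
  · exact ⟨K, hKS', hK, heq, Finset.disjoint_of_subset_left hKS Finset.sdiff_disjoint⟩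
  refine absurd ⟨K₀, hK₀S, hK₀, fun v => if v ∈ A then K.card else c v, ?_, ?_⟩ hS
  · intro v hv
    by_cases hvA : v ∈ A
    · simpa [hvA] using hlt
    · simpa [hvA] using (hc v (by simp [hv, hvA])).trans hlt
  · intro u hu v hv huv
    by_cases huA : u ∈ A <;> by_cases hvA : v ∈ A
    · exact absurd huv (hA huA hvA huv.ne)
    · simpa [huA, hvA] using (hc v (by simp [hv, hvA])).ne'
    · simpa [huA, hvA] using (hc u (by simp [hu, huA])).ne
    · simpa [huA, hvA] using hproper u (by simp [hu, huA]) v (by simp [hv, hvA]) huv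

/-- A graph all of whose induced subgraphs satisfy `|S| ≤ ω α` is perfect (in witness form). -/
theorem hasTightColoring_of_forall_cardLeCliqueMulIndep {V : Type} {G : SimpleGraph V}
    (h : ∀ S, CardLeCliqueMulIndep G S) (S : Finset V) : HasTightColoring G S := by
  classical
  induction S using Finset.strongInduction with
  | H S ih =>
  by_contra hS
  obtain ⟨K₀, hK₀S, hK₀, hKmax⟩ :=
    exists_max_card_subset S (fun K => G.IsClique (K : Set V)) (by simp)
  obtain ⟨A₀, hA₀S, hA₀, hAmax⟩ :=
    exists_max_card_subset S (fun A => G.IsIndepSet (A : Set V)) (by simp)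
  have hcard := h S _ _ hKmax hAmax
  have hclique : ∀ A ⊆ S, G.IsIndepSet (A : Set V) →
      ∃ K ⊆ S, G.IsClique (K : Set V) ∧ K.card = K₀.card ∧ Disjoint K A := by
    intro A hAS hA
    rcases A.eq_empty_or_nonempty with rfl | hne
    · exact ⟨K₀, hK₀S, hK₀, rfl, Finset.disjoint_empty_right _⟩
    · exact exists_maximum_clique_disjoint hS hK₀S hK₀ hKmax hA
        (ih _ (Finset.sdiff_ssubset hAS hne))
  have hcol : ∀ x : A₀, ∃ c : V → ℕ, (∀ u ∈ S.erase x, c u < K₀.card) ∧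
      ∀ u ∈ S.erase x, ∀ v ∈ S.erase x, G.Adj u v → c u ≠ c v := by
    intro x
    obtain ⟨K, hKS, hK, c, hc, hproper⟩ := ih _ (Finset.erase_ssubset (hA₀S x.2))
    exact ⟨c, fun u hu => (hc u hu).trans_le
      (hKmax K (hKS.trans (Finset.erase_subset _ _)) hK), hproper⟩
  choose c hc hproper using hcol
  let B : Option (A₀ × Fin K₀.card) → Finset V := fun o =>
    o.elim A₀ fun p => (S.erase p.1).filter fun u => c p.1 u = p.2
  have hBS : ∀ o, B o ⊆ S := by
    rintro (_ | p)
    · exact hA₀S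
    · exact (Finset.filter_subset _ _).trans (Finset.erase_subset _ _)
  have hB : ∀ o, G.IsIndepSet (B o : Set V) := by
    rintro (_ | p)
    · exact hA₀
    · intro u hu v hv _ huv
      simp only [B, Option.elim, Finset.mem_coe, Finset.mem_filter] at hu hv
      exact hproper p.1 u hu.1 v hv.1 huv (hu.2.trans hv.2.symm)
  have hinj : ∀ (x : A₀) (K : Finset V), K ⊆ S → G.IsClique (K : Set V) →
      ((K.erase x).image (c x)).card = (K.erase x).card := by
    intro x K hKS hK
    refine Finset.card_image_of_injOn ?_
    intro u hu v hv huv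
    by_contra hne
    exact hproper x u (Finset.erase_subset_erase _ hKS hu) v
      (Finset.erase_subset_erase _ hKS hv)
      (hK (Finset.mem_of_mem_erase hu) (Finset.mem_of_mem_erase hv) hne) huv
  have himage : ∀ (x : A₀) (K : Finset V) (i : Fin K₀.card), K ⊆ S →
      Disjoint K (B (some (x, i))) →
      (K.erase x).image (c x) ⊆ (Finset.range K₀.card).erase i := by
    intro x K i hKS hdisj n hn
    obtain ⟨u, hu, rfl⟩ := Finset.mem_image.1 hn
    have huS := Finset.erase_subset_erase _ hKS hu
    refine Finset.mem_erase.2 ⟨fun hi => ?_, Finset.mem_range.2 (hc x u huS)⟩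
    exact Finset.disjoint_left.1 hdisj (Finset.mem_of_mem_erase hu)
      (Finset.mem_filter.2 ⟨huS, hi⟩)
  have hmem : ∀ (x : A₀) (K : Finset V) (i : Fin K₀.card), K ⊆ S → G.IsClique (K : Set V) →
      K.card = K₀.card → Disjoint K (B (some (x, i))) → (x : V) ∈ K := by
    intro x K i hKS hK hKc hdisj
    by_contra hx
    have h1 := Finset.card_le_card (himage x K i hKS hdisj)
    rw [hinj x K hKS hK, Finset.erase_eq_of_notMem hx,
      Finset.card_erase_of_mem (Finset.mem_range.2 i.2), Finset.card_range, hKc] at h1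
    have := i.2
    omega
  have hunique : ∀ K ⊆ S, G.IsClique (K : Set V) → K.card = K₀.card →
      ∀ o o', Disjoint K (B o) → Disjoint K (B o') → o = o' := by
    intro K hKS hK hKc o o' ho ho'
    rcases o with _ | ⟨x, i⟩ <;> rcases o' with _ | ⟨y, j⟩
    · rfl
    · exact absurd y.2 (Finset.disjoint_left.1 ho (hmem y K j hKS hK hKc ho'))
    · exact absurd x.2 (Finset.disjoint_left.1 ho' (hmem x K i hKS hK hKc ho))
    · have hx := hmem x K i hKS hK hKc ho
      have hy := hmem y K j hKS hK hKc ho'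
      obtain rfl : x = y := by
        by_contra hxy
        have hxy' : (x : V) ≠ y := fun e => hxy (Subtype.ext e)
        exact hA₀ x.2 y.2 hxy' (hK hx hy hxy')
      by_contra hij
      have hij' : (j : ℕ) ≠ i := fun e => hij (by rw [Fin.ext e])
      have hsub : (K.erase x).image (c x) ⊆ ((Finset.range K₀.card).erase i).erase j := by
        intro n hn
        exact Finset.mem_erase.2
          ⟨(Finset.mem_erase.1 (himage x K j hKS ho' hn)).1, himage x K i hKS ho hn⟩
      have h1 := Finset.card_le_card hsub
      rw [hinj x K hKS hK, Finset.card_erase_of_mem hx, Finset.card_erase_of_mem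
        (Finset.mem_erase.2 ⟨hij', Finset.mem_range.2 j.2⟩),
        Finset.card_erase_of_mem (Finset.mem_range.2 i.2), Finset.card_range, hKc] at h1
      have := i.2
      have := j.2
      omega
  choose K hKS hK hKc hdisj using fun o => hclique (B o) (hBS o) (hB o)
  have hιcard : Fintype.card (Option (A₀ × Fin K₀.card)) = A₀.card * K₀.card + 1 := by simp
  have hne : S.Nonempty := by
    rw [Finset.nonempty_iff_ne_empty]
    rintro rfl
    exact hS ⟨∅, by simp, by simp, fun _ => 0, by simp, by simp⟩
  have hpos := hne.card_pos
  have hle := card_le_card_of_card_inter (by rw [hιcard, mul_comm]; omega) S B K hKS hdisj <| by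
    intro o o' hoo'
    have h1 := card_inter_le_one (hK o) (hB o')
    have h2 : (K o ∩ B o').card ≠ 0 := fun h0 =>
      hoo' (hunique (K o) (hKS o) (hK o) (hKc o) o o' (hdisj o)
        (Finset.disjoint_iff_inter_eq_empty.2 (Finset.card_eq_zero.1 h0)))
    omega
  rw [hιcard, mul_comm] at hle
  omega

theorem hasTightColoring_iff {V : Type} {G : SimpleGraph V} (S : Finset V) :
    HasTightColoring G S ↔
      (G.induce (S : Set V)).chromaticNumber = ((G.induce (S : Set V)).cliqueNum : ℕ∞) := by
  classical
  constructor
  · rintro ⟨K, hKS, hK, c, hc, hproper⟩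
    have hcol : (G.induce (S : Set V)).Colorable K.card :=
      ⟨Coloring.mk (fun v => ⟨c v, hc v v.2⟩) fun {u v} huv e =>
        hproper u u.2 v v.2 huv (Fin.ext_iff.1 e)⟩
    have hclique : (G.induce (S : Set V)).IsClique
        ((K.subtype (· ∈ (S : Set V)) : Finset (S : Set V)) : Set (S : Set V)) := by
      intro u hu v hv huv
      simp only [Finset.mem_coe, Finset.mem_subtype] at hu hv
      exact hK hu hv fun e => huv (Subtype.ext e)
    have hcard : (K.subtype (· ∈ (S : Set V))).card = K.card := by
      rw [Finset.card_subtype, Finset.filter_true_of_mem fun v hv => Finset.mem_coe.2 (hKS hv)]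
    have hle := hclique.card_le_cliqueNum
    rw [hcard] at hle
    refine le_antisymm (hcol.chromaticNumber_le.trans (by exact_mod_cast hle)) ?_
    exact cliqueNum_le_chromaticNumber
  · intro h
    obtain ⟨K, hK⟩ := (G.induce (S : Set V)).exists_isNClique_cliqueNum
    obtain ⟨c⟩ := chromaticNumber_le_iff_colorable.1 h.le
    have hcard : (K.map (Function.Embedding.subtype _)).card =
        (G.induce (S : Set V)).cliqueNum := by
      rw [Finset.card_map, hK.card_eq]
    refine ⟨K.map (Function.Embedding.subtype _), ?_, ?_,
      fun v => if hv : v ∈ (S : Set V) then c ⟨v, hv⟩ else 0, ?_, ?_⟩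
    · intro v hv
      obtain ⟨u, -, rfl⟩ := Finset.mem_map.1 hv
      exact u.2
    · intro u hu v hv huv
      obtain ⟨u, hu', rfl⟩ := Finset.mem_map.1 hu
      obtain ⟨v, hv', rfl⟩ := Finset.mem_map.1 hv
      exact hK.isClique hu' hv' fun e => huv (by rw [e])
    · intro v hv
      beta_reduce
      rw [hcard, dif_pos (Finset.mem_coe.2 hv)]
      exact (c ⟨v, hv⟩).2
    · intro u hu v hv huv
      beta_reduce
      rw [dif_pos (Finset.mem_coe.2 hu), dif_pos (Finset.mem_coe.2 hv)]
      intro e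
      exact c.valid (v := ⟨u, hu⟩) (w := ⟨v, hv⟩) huv (Fin.ext e)

theorem isPerfect_iff_forall_hasTightColoring {V : Type} [Fintype V] {G : SimpleGraph V} :
    IsPerfect G ↔ ∀ S, HasTightColoring G S := by
  classical
  refine ⟨fun h S => (hasTightColoring_iff S).2 (h S), fun h s => ?_⟩
  have := (hasTightColoring_iff s.toFinset).1 (h s.toFinset)
  rwa [Set.coe_toFinset] at this

/-- Lovász's perfect graph theorem: the complement of a perfect graph is perfect. -/
theorem perfect_graph_theorem {V : Type} [Fintype V] (G : SimpleGraph V)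
    (hG : IsPerfect G) : IsPerfect Gᶜ := by
  rw [isPerfect_iff_forall_hasTightColoring] at hG ⊢
  exact hasTightColoring_of_forall_cardLeCliqueMulIndep fun S =>
    (hG S).cardLeCliqueMulIndep.compl
end

section
/- A minimally imperfect graph has no star cutset (Chvátal's star cutset lemma). -/
open SimpleGraph

/-- A graph is minimally imperfect if it is not perfect but all its proper
induced subgraphs are perfect. -/
def MinimallyImperfect {V : Type} (G : SimpleGraph V) : Prop :=
  ¬ IsPerfect G ∧ ∀ s : Set V, s ≠ Set.univ → IsPerfect (G.induce s)

/-- `S` is a star cutset of `G`: some vertex of `S` is adjacent to all other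
vertices of `S`, and the vertices outside `S` split into two nonempty parts
with no edges between them. -/
def IsStarCutset {V : Type} (G : SimpleGraph V) (S : Set V) : Prop :=
  (∃ v ∈ S, ∀ u ∈ S, u ≠ v → G.Adj v u) ∧
  ∃ X Y : Set V, X.Nonempty ∧ Y.Nonempty ∧ Disjoint X Y ∧ X ∪ Y = Sᶜ ∧
    ∀ x ∈ X, ∀ y ∈ Y, ¬ G.Adj x y

namespace SimpleGraph

variable {V : Type*}

theorem chromaticNumber_eq_cliqueNum_iff [Finite V] (G : SimpleGraph V) :
    G.chromaticNumber = (G.cliqueNum : ℕ∞) ↔ ∀ n, G.CliqueFree (n + 1) → G.Colorable n := by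
  constructor
  · intro h n hn
    rw [← chromaticNumber_le_iff_colorable, h, Nat.cast_le]
    by_contra! hlt
    obtain ⟨t, ht⟩ := G.exists_isNClique_cliqueNum
    exact hn.mono hlt t ht
  · intro h
    refine le_antisymm ?_ ?_
    · rw [chromaticNumber_le_iff_colorable]
      refine h _ fun t ht => ?_
      have hle := ht.isClique.card_le_cliqueNum
      have hcard := ht.card_eq
      lia
    · obtain ⟨t, ht⟩ := G.exists_isNClique_cliqueNum
      simpa [ht.card_eq] using ht.isClique.card_le_chromaticNumber

/-- A colouring of an induced subgraph, extended to a function on all vertices. -/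
theorem Colorable.exists_forall_mem_ne {G : SimpleGraph V} {s : Set V} {n : ℕ} {v : V}
    (h : (G.induce s).Colorable n) (hv : v ∈ s) :
    ∃ f : V → Fin n, ∀ a ∈ s, ∀ b ∈ s, G.Adj a b → f a ≠ f b := by
  classical
  obtain ⟨c⟩ := h
  refine ⟨fun w => if hw : w ∈ s then c ⟨w, hw⟩ else c ⟨v, hv⟩, fun a ha b hb hab => ?_⟩
  simpa only [dif_pos ha, dif_pos hb] using
    c.valid (v := ⟨a, ha⟩) (w := ⟨b, hb⟩) hab

theorem IsClique.card_lt_of_avoids {G : SimpleGraph V} {s : Set V} {n : ℕ} {f : V → Fin n}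
    (hf : ∀ a ∈ s, ∀ b ∈ s, G.Adj a b → f a ≠ f b) {t : Finset V} (ht : G.IsClique t)
    (hts : ∀ w ∈ t, w ∈ s) (i : Fin n) (hi : ∀ w ∈ t, f w ≠ i) : t.card < n := by
  have hinj : Set.InjOn f t := fun a ha b hb hab => by
    by_contra hne
    exact hf a (hts a ha) b (hts b hb) (ht ha hb hne) hab
  rw [← Finset.card_image_of_injOn hinj]
  refine (Finset.card_lt_univ_of_notMem (x := i) ?_).trans_eq (Fintype.card_fin n)
  simpa using hi

/-- A graph splitting into a stable set and an `n`-colourable part is `n + 1`-colourable. -/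
theorem Colorable.succ_of_induce_compl {G : SimpleGraph V} {I : Set V} {n : ℕ}
    (hI : ∀ a ∈ I, ∀ b ∈ I, ¬ G.Adj a b) (h : (G.induce Iᶜ).Colorable n) :
    G.Colorable (n + 1) := by
  classical
  obtain ⟨c⟩ := h
  let C : G.Coloring (Option (Fin n)) :=
    Coloring.mk (fun w => if hw : w ∈ I then none else some (c ⟨w, hw⟩)) (by
      intro a b hab
      by_cases ha : a ∈ I <;> by_cases hb : b ∈ I
      · exact absurd hab (hI a ha b hb)
      · simp [ha, hb]
      · simp [ha, hb]
      · simpa [ha, hb] using c.valid (v := ⟨a, ha⟩) (w := ⟨b, hb⟩) hab)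
  simpa using C.colorable

end SimpleGraph

theorem IsPerfect.colorable {V : Type} [Finite V] {G : SimpleGraph V} (hG : IsPerfect G) {n : ℕ}
    (hn : G.CliqueFree (n + 1)) : G.Colorable n := by
  have h := (chromaticNumber_eq_cliqueNum_iff _).1 (hG Set.univ) n
    (hn.comap ⟨(Embedding.induce Set.univ).toCopy⟩)
  exact h.of_hom (induceUnivIso G).symm.toHom

theorem IsStarCutset.colorable {V : Type} [Finite V] {G : SimpleGraph V} {S : Set V}
    (hS : IsStarCutset G S) (hG : ∀ s : Set V, s ≠ Set.univ → IsPerfect (G.induce s)) {n : ℕ}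
    (hn : G.CliqueFree (n + 1)) : G.Colorable n := by
  obtain ⟨⟨v, hvS, hv⟩, X, Y, ⟨x, hx⟩, ⟨y, hy⟩, hXY, hunion, hadj⟩ := hS
  have hcover : ∀ w, w ∈ S ∨ w ∈ X ∨ w ∈ Y := fun w => by
    have := Set.ext_iff.1 hunion w
    simp only [Set.mem_union, Set.mem_compl_iff] at this
    tauto
  have hXS : ∀ w ∈ X, w ∉ S := fun w hw => hunion.subset (Or.inl hw)
  have hYS : ∀ w ∈ Y, w ∉ S := fun w hw => hunion.subset (Or.inr hw)
  have hdisj : ∀ w ∈ X, w ∉ Y := fun w hwX hwY => Set.disjoint_left.1 hXY hwX hwY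
  have hcol : ∀ s : Set V, s ≠ Set.univ → (G.induce s).Colorable n := fun s hs =>
    (hG s hs).colorable (hn.comap ⟨(Embedding.induce s).toCopy⟩)
  obtain ⟨f, hf⟩ := (hcol (S ∪ X) fun h => by
    rcases h.symm.subset (Set.mem_univ y) with h | h
    exacts [hYS y hy h, hdisj y h hy]).exists_forall_mem_ne (Or.inl hvS)
  obtain ⟨g, hg⟩ := (hcol (S ∪ Y) fun h => by
    rcases h.symm.subset (Set.mem_univ x) with h | h
    exacts [hXS x hx h, hdisj x hx h]).exists_forall_mem_ne (Or.inl hvS)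
  have hfv : ∀ w ∈ S, f w = f v → w = v := fun w hw h => by
    by_contra hne
    exact hf v (Or.inl hvS) w (Or.inl hw) (hv w hw hne) h.symm
  have hgv : ∀ w ∈ S, g w = g v → w = v := fun w hw h => by
    by_contra hne
    exact hg v (Or.inl hvS) w (Or.inl hw) (hv w hw hne) h.symm
  obtain ⟨m, rfl⟩ : ∃ m, n = m + 1 := Nat.exists_eq_succ_of_ne_zero (f v).pos.ne'
  let I : Set V := {w | w ∈ S ∪ X ∧ f w = f v} ∪ {w | w ∈ S ∪ Y ∧ g w = g v}
  have hvI : v ∈ I := Or.inl ⟨Or.inl hvS, rfl⟩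
  have hcross : ∀ a ∈ S ∪ X, f a = f v → ∀ b ∈ S ∪ Y, g b = g v → ¬ G.Adj a b := by
    intro a ha hfa b hb hgb hab
    rcases ha with haS | haX
    · obtain rfl := hfv a haS hfa
      exact hg a (Or.inl hvS) b hb hab hgb.symm
    · rcases hb with hbS | hbY
      · obtain rfl := hgv b hbS hgb
        exact hf a (Or.inr haX) b (Or.inl hvS) hab hfa
      · exact hadj a haX b hbY hab
  refine Colorable.succ_of_induce_compl (I := I) ?_ ?_
  · rintro a (⟨ha, hfa⟩ | ⟨ha, hga⟩) b (⟨hb, hfb⟩ | ⟨hb, hgb⟩) hab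
    · exact hf a ha b hb hab (hfa.trans hfb.symm)
    · exact hcross a ha hfa b hb hgb hab
    · exact hcross b hb hfb a ha hga hab.symm
    · exact hg a ha b hb hab (hga.trans hgb.symm)
  · refine (hG Iᶜ fun h => h.symm.subset (Set.mem_univ v) hvI).colorable fun t ht => ?_
    let t' := t.map (Function.Embedding.subtype _)
    have hclique : G.IsClique t' := fun a ha b hb hab => by
      obtain ⟨a, ha', rfl⟩ := Finset.mem_map.1 ha
      obtain ⟨b, hb', rfl⟩ := Finset.mem_map.1 hb
      exact ht.isClique ha' hb' (ne_of_apply_ne _ hab)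
    have hcard : t'.card = m + 1 := by simpa [t'] using ht.card_eq
    have hI : ∀ w ∈ t', w ∉ I := fun w hw => by
      obtain ⟨z, -, rfl⟩ := Finset.mem_map.1 hw
      exact z.2
    by_cases h : ∃ a ∈ t', a ∈ X
    · obtain ⟨a, ha, haX⟩ := h
      have hts : ∀ w ∈ t', w ∈ S ∪ X := fun w hw => by
        rcases hcover w with h | h | h
        · exact Or.inl h
        · exact Or.inr h
        · exact absurd (hclique ha hw fun e => hdisj a haX (e ▸ h)) (hadj a haX w h)
      exact (hclique.card_lt_of_avoids hf hts (f v)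
        fun w hw e => hI w hw (Or.inl ⟨hts w hw, e⟩)).ne hcard
    · push Not at h
      have hts : ∀ w ∈ t', w ∈ S ∪ Y := fun w hw => by
        rcases hcover w with hw' | hw' | hw'
        exacts [Or.inl hw', absurd hw' (h w hw), Or.inr hw']
      exact (hclique.card_lt_of_avoids hg hts (g v)
        fun w hw e => hI w hw (Or.inr ⟨hts w hw, e⟩)).ne hcard


/-- Chvátal's star cutset lemma: a minimally imperfect graph has no star cutset. -/
theorem star_cutset_lemma {V : Type} [Fintype V] (G : SimpleGraph V)
    (hG : MinimallyImperfect G) (S : Set V) : ¬ IsStarCutset G S := by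
  intro hS
  refine hG.1 fun s => (chromaticNumber_eq_cliqueNum_iff _).2 fun n hn => ?_
  by_cases hs : s = Set.univ
  · subst hs
    exact (hS.colorable hG.2 (hn.comap ⟨(induceUnivIso G).symm.toCopy⟩)).of_hom
      (induceUnivIso G).toHom
  · exact (hG.2 s hs).colorable hn
end

section
/- Let G be a perfect graph and let (A, B) be a balanced partition of V(G). If every Berge graph with at most |V(G)| + 1 vertices is perfect, then there exists a proper colouring of G using ω(G) colours in which the vertices of B receive at most ω(G[B]) distinct colours (i.e., an optimal colouring of G[B] extends to an optimal colouring of G). -/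
open SimpleGraph

/-- `G` contains a hole (induced cycle) on `n` vertices. -/
def HasHoleOfLength {V : Type} (G : SimpleGraph V) (n : ℕ) : Prop :=
  Nonempty (cycleGraph n ↪g G)

/-- A graph is Berge if neither it nor its complement contains an induced odd cycle
on at least 5 vertices (no odd hole, no odd antihole). -/
def IsBerge {V : Type} (G : SimpleGraph V) : Prop :=
  ∀ n : ℕ, 5 ≤ n → Odd n → ¬ HasHoleOfLength G n ∧ ¬ HasHoleOfLength Gᶜ n

/-- The pair of sets `(A, B)` is balanced in `G`: every chordless path of `G` of
length at least 3 (i.e. on at least 4 vertices) with both ends in `B` and all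
internal vertices in `A` has even length, and the same in the complement with
the roles of `A` and `B` exchanged. -/
def IsBalancedPair {V : Type} (G : SimpleGraph V) (A B : Set V) : Prop :=
  (∀ (n : ℕ) (hn : 4 ≤ n) (f : pathGraph n ↪g G),
      (f ⟨0, by omega⟩ : V) ∈ B → (f ⟨n - 1, by omega⟩ : V) ∈ B →
      (∀ i : Fin n, i.val ≠ 0 → i.val ≠ n - 1 → (f i : V) ∈ A) → Even (n - 1)) ∧
  (∀ (n : ℕ) (hn : 4 ≤ n) (f : pathGraph n ↪g Gᶜ),
      (f ⟨0, by omega⟩ : V) ∈ A → (f ⟨n - 1, by omega⟩ : V) ∈ A →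
      (∀ i : Fin n, i.val ≠ 0 → i.val ≠ n - 1 → (f i : V) ∈ B) → Even (n - 1))

theorem cycleGraph_adj_iff_val {n : ℕ} (hn : 2 ≤ n) {u v : Fin n} :
    (cycleGraph n).Adj u v ↔ u.val + 1 = v.val ∨ v.val + 1 = u.val ∨
      (u.val = 0 ∧ v.val + 1 = n) ∨ (v.val = 0 ∧ u.val + 1 = n) := by
  have key : ∀ a b : Fin n, (a - b).val = 1 ↔
      b.val + 1 = a.val ∨ (a.val = 0 ∧ b.val + 1 = n) := by
    intro a b
    have ha := a.isLt
    have hb := b.isLt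
    rcases le_or_gt b a with h | h
    · rw [Fin.sub_val_of_le h]
      have : b.val ≤ a.val := h
      omega
    · have h' : a.val < b.val := h
      rw [Fin.val_sub, Nat.mod_eq_of_lt (by omega)]
      omega
  rw [cycleGraph_adj', key, key]
  tauto

theorem card_le_two_of_isClique_cycleGraph {n : ℕ} (hn : 4 ≤ n) {t : Finset (Fin n)}
    (ht : (cycleGraph n).IsClique t) : t.card ≤ 2 := by
  by_contra! h
  obtain ⟨a, ha, b, hb, c, hc, hab, hac, hbc⟩ := Finset.two_lt_card.1 h
  have h1 := (cycleGraph_adj_iff_val (by omega)).1 (ht ha hb hab)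
  have h2 := (cycleGraph_adj_iff_val (by omega)).1 (ht ha hc hac)
  have h3 := (cycleGraph_adj_iff_val (by omega)).1 (ht hb hc hbc)
  rw [Ne, Fin.ext_iff] at hab hac hbc
  omega

theorem two_mul_card_le_of_isClique_compl_cycleGraph {n : ℕ} (hn : 2 ≤ n) {t : Finset (Fin n)}
    (ht : (cycleGraph n)ᶜ.IsClique t) : 2 * t.card ≤ n := by
  obtain ⟨m, rfl⟩ := Nat.exists_eq_add_of_le' hn
  have hdisj : Disjoint t (t.image (· + 1)) := by
    rw [Finset.disjoint_left]
    intro a ha ha'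
    obtain ⟨b, hb, rfl⟩ := Finset.mem_image.1 ha'
    have hne : b + 1 ≠ b := by simp
    exact ((compl_adj _ _ _).1 (ht ha hb hne)).2 (cycleGraph_adj.2 (Or.inl (by simp)))
  have h := Finset.card_le_univ (t ∪ t.image (· + 1))
  rw [Finset.card_union_of_disjoint hdisj,
    Finset.card_image_of_injective _ (add_left_injective 1), Fintype.card_fin] at h
  omega

/-- In a perfect graph, the number of vertices of an induced subgraph is at most the product of
bounds for its cliques and for its stable sets. -/
theorem IsPerfect.card_le_mul {V : Type} {G : SimpleGraph V} (hG : IsPerfect G) {n a b : ℕ}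
    {H : SimpleGraph (Fin n)} (f : H ↪g G)
    (ha : ∀ t : Finset (Fin n), H.IsClique t → t.card ≤ a)
    (hb : ∀ t : Finset (Fin n), Hᶜ.IsClique t → t.card ≤ b) : n ≤ b * a := by
  classical
  have hω : (G.induce (Set.range f)).cliqueNum ≤ a := by
    obtain ⟨t, ht⟩ := (G.induce (Set.range f)).exists_isNClique_cliqueNum
    choose u hu using fun x : Set.range f => x.2
    have hinj : Function.Injective u := fun x y h => Subtype.ext (by rw [← hu x, ← hu y, h])
    rw [← ht.card_eq, ← Finset.card_image_of_injective t hinj]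
    apply ha
    intro x hx y hy hxy
    simp only [Finset.coe_image, Set.mem_image, Finset.mem_coe] at hx hy
    obtain ⟨x, hx, rfl⟩ := hx
    obtain ⟨y, hy, rfl⟩ := hy
    rw [← f.map_adj_iff, hu, hu]
    exact ht.isClique hx hy (ne_of_apply_ne u hxy)
  have hcol : (G.induce (Set.range f)).Colorable a := by
    rw [← chromaticNumber_le_iff_colorable, hG]
    exact_mod_cast hω
  obtain ⟨c⟩ := hcol
  have := Finset.card_le_mul_card_image_of_maps_to
    (f := fun i : Fin n => c ⟨f i, i, rfl⟩) (s := Finset.univ) (t := Finset.univ)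
    (fun _ _ => Finset.mem_univ _) b (fun k _ => hb _ ?_)
  · simpa using this
  · intro x hx y hy hxy
    simp only [Finset.coe_filter, Finset.mem_univ, true_and, Set.mem_ofPred_eq] at hx hy
    refine (compl_adj _ _ _).2 ⟨hxy, fun hadj => ?_⟩
    exact c.valid (v := ⟨f x, x, rfl⟩) (w := ⟨f y, y, rfl⟩) (by simpa using hadj) (hx.trans hy.symm)

theorem IsPerfect.isBerge {V : Type} {G : SimpleGraph V} (hG : IsPerfect G) : IsBerge G := by
  intro n hn hodd
  obtain ⟨k, rfl⟩ := hodd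
  have hclique : ∀ t : Finset (Fin (2 * k + 1)), (cycleGraph (2 * k + 1)).IsClique t →
      t.card ≤ 2 := fun t => card_le_two_of_isClique_cycleGraph (by omega)
  have hstable : ∀ t : Finset (Fin (2 * k + 1)), (cycleGraph (2 * k + 1))ᶜ.IsClique t →
      t.card ≤ k := fun t ht => by
    have := two_mul_card_le_of_isClique_compl_cycleGraph (by omega) ht
    omega
  constructor
  · rintro ⟨f⟩
    have := hG.card_le_mul f hclique hstable
    omega
  · rintro ⟨f⟩
    have f' : (cycleGraph (2 * k + 1))ᶜ ↪g G :=
      ⟨f.toEmbedding, fun {x y} => by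
        have h := f.map_adj_iff (v := x) (w := y)
        rcases eq_or_ne x y with rfl | hxy
        · simp
        · have hne := f.injective.ne hxy
          rw [compl_adj] at h ⊢
          simp only [ne_eq, hxy, hne, not_false_eq_true, true_and] at h ⊢
          exact not_iff_comm.1 h |>.symm⟩
    have := hG.card_le_mul f' hstable (by simpa using hclique)
    omega

/-- The graph obtained from `G` by adding a vertex whose neighbourhood is `B`. -/
def addVertex {V : Type} (G : SimpleGraph V) (B : Set V) : SimpleGraph (Option V) where
  Adj
    | none, none => False
    | none, some v => v ∈ B
    | some v, none => v ∈ B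
    | some u, some v => G.Adj u v
  symm := ⟨by
    rintro (_ | u) (_ | v) h
    · exact h
    · exact h
    · exact h
    · exact G.adj_symm h⟩
  loopless := ⟨by
    rintro (_ | u) h
    · exact h
    · exact G.irrefl h⟩

@[simp] theorem addVertex_adj_none_some {V : Type} {G : SimpleGraph V} {B : Set V} {v : V} :
    (addVertex G B).Adj none (some v) ↔ v ∈ B := Iff.rfl

@[simp] theorem addVertex_adj_some_none {V : Type} {G : SimpleGraph V} {B : Set V} {v : V} :
    (addVertex G B).Adj (some v) none ↔ v ∈ B := Iff.rfl

@[simp] theorem addVertex_adj_some_some {V : Type} {G : SimpleGraph V} {B : Set V} {u v : V} :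
    (addVertex G B).Adj (some u) (some v) ↔ G.Adj u v := Iff.rfl

theorem compl_addVertex {V : Type} (G : SimpleGraph V) (B : Set V) :
    (addVertex G B)ᶜ = addVertex Gᶜ Bᶜ := by
  ext (_ | u) (_ | v) <;> simp [compl_adj]

/-- A hole of `addVertex G B` is a hole of `G`, or becomes, once the new vertex is removed, a
chordless path of `G` with both ends in `B` and all internal vertices outside `B`. -/
theorem HasHoleOfLength.of_addVertex {V : Type} {G : SimpleGraph V} {B : Set V} {m : ℕ}
    (h : HasHoleOfLength (addVertex G B) (m + 2)) :
    HasHoleOfLength G (m + 2) ∨ ∃ p : pathGraph (m + 1) ↪g G,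
      p 0 ∈ B ∧ p (Fin.last m) ∈ B ∧
        ∀ i : Fin (m + 1), i.val ≠ 0 → i.val ≠ m → p i ∉ B := by
  obtain ⟨f⟩ := h
  by_cases hnone : ∃ i, f i = none
  · right
    obtain ⟨i, hi⟩ := hnone
    have hsome : ∀ j : Fin (m + 1), ∃ v, some v = f (i + j.succ) := by
      intro j
      have hne : f (i + j.succ) ≠ none := by
        rw [← hi]
        intro h
        have := f.injective h
        simp at this
      obtain ⟨v, hv⟩ := Option.ne_none_iff_exists.1 hne
      exact ⟨v, hv⟩
    choose p hp using hsome
    have hadj : ∀ j k, G.Adj (p j) (p k) ↔ (pathGraph (m + 1)).Adj j k := by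
      intro j k
      rw [← addVertex_adj_some_some (G := G) (B := B), hp, hp, f.map_adj_iff, cycleGraph_adj,
        add_sub_add_left_eq_sub, add_sub_add_left_eq_sub, ← cycleGraph_adj,
        cycleGraph_adj_iff_val (by omega), pathGraph_adj]
      simp only [Fin.val_succ]
      omega
    have hend : ∀ j, p j ∈ B ↔ j.val = 0 ∨ j.val = m := by
      intro j
      rw [← addVertex_adj_none_some (G := G) (B := B), hp, ← hi, f.map_adj_iff, cycleGraph_adj,
        show i - (i + j.succ) = 0 - j.succ by abel, show i + j.succ - i = j.succ - 0 by abel,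
        ← cycleGraph_adj, cycleGraph_adj_iff_val (by omega)]
      simp only [Fin.val_succ, Fin.val_zero, true_and]
      omega
    have hinj : Function.Injective p := by
      intro j k h
      have h' : f (i + j.succ) = f (i + k.succ) := by rw [← hp, ← hp, h]
      exact Fin.succ_injective _ (add_left_cancel (f.injective h'))
    refine ⟨⟨⟨p, hinj⟩, hadj _ _⟩, (hend _).2 (by simp), (hend _).2 (by simp), ?_⟩
    intro j h0 hm hj
    rcases (hend j).1 hj with h | h
    · exact h0 h
    · exact hm h
  · left
    push Not at hnone
    choose q hq using fun i => Option.ne_none_iff_exists.1 (hnone i)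
    refine ⟨⟨⟨q, fun i j h => f.injective (by rw [← hq, ← hq, h])⟩, fun {i j} => ?_⟩⟩
    change G.Adj (q i) (q j) ↔ _
    rw [← addVertex_adj_some_some (G := G) (B := B), hq, hq, f.map_adj_iff]

theorem not_hasHoleOfLength_addVertex {V : Type} {G : SimpleGraph V} {B : Set V} {n : ℕ}
    (hn : 5 ≤ n) (hodd : Odd n) (hG : ¬ HasHoleOfLength G n)
    (hpath : ∀ (n : ℕ) (hn : 4 ≤ n) (f : pathGraph n ↪g G),
      (f ⟨0, by omega⟩ : V) ∈ B → (f ⟨n - 1, by omega⟩ : V) ∈ B →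
      (∀ i : Fin n, i.val ≠ 0 → i.val ≠ n - 1 → f i ∉ B) → Even (n - 1)) :
    ¬ HasHoleOfLength (addVertex G B) n := by
  obtain ⟨m, rfl⟩ := Nat.exists_eq_add_of_le' (show 2 ≤ n by omega)
  intro h
  rcases h.of_addVertex with h | ⟨p, h0, hm, hp⟩
  · exact hG h
  · have := hpath (m + 1) (by omega) p h0 hm hp
    grind

theorem IsBerge.addVertex {V : Type} {G : SimpleGraph V} (hG : IsBerge G) {A B : Set V}
    (hdisj : Disjoint A B) (hcover : A ∪ B = Set.univ) (hbal : IsBalancedPair G A B) :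
    IsBerge (addVertex G B) := by
  obtain rfl : A = Bᶜ := (IsCompl.of_eq hdisj.eq_bot hcover).eq_compl
  intro n hn hodd
  refine ⟨not_hasHoleOfLength_addVertex hn hodd (hG n hn hodd).1 hbal.1, ?_⟩
  rw [compl_addVertex]
  refine not_hasHoleOfLength_addVertex hn hodd (hG n hn hodd).2 fun k hk f h0 h1 hi => ?_
  exact hbal.2 k hk f h0 h1 fun i hi0 hi1 => not_not.1 (hi i hi0 hi1)

theorem IsPerfect.exists_coloring_on {V : Type} {G : SimpleGraph V} (hG : IsPerfect G)
    {s : Set V} {m : ℕ} (hs : ∀ t : Finset V, ↑t ⊆ s → G.IsClique t → t.card ≤ m) :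
    ∃ c : V → ℕ, (∀ u ∈ s, c u < m) ∧ ∀ u ∈ s, ∀ v ∈ s, G.Adj u v → c u ≠ c v := by
  classical
  have hω : (G.induce s).cliqueNum ≤ m := by
    obtain ⟨t, ht⟩ := (G.induce s).exists_isNClique_cliqueNum
    rw [isNClique_induce_iff] at ht
    rw [← ht.card_eq]
    refine hs _ ?_ ht.isClique
    intro x hx
    simp only [Finset.coe_map, Set.mem_image] at hx
    obtain ⟨y, -, rfl⟩ := hx
    exact y.2
  have hcol : (G.induce s).Colorable m := by
    rw [← chromaticNumber_le_iff_colorable, hG]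
    exact_mod_cast hω
  obtain ⟨c⟩ := hcol
  refine ⟨fun v => if h : v ∈ s then c ⟨v, h⟩ else 0, fun u hu => ?_, fun u hu v hv h => ?_⟩
  · simp [hu]
  · have := c.valid (v := ⟨u, hu⟩) (w := ⟨v, hv⟩) h
    simpa [hu, hv, Fin.ext_iff] using this

/-- If adding a vertex with neighbourhood `B` keeps the graph perfect, then any induced subgraph
with cliques of size at most `m`, whose cliques inside `B` have size at most `b ≤ m`, has an
`m`-colouring using only the first `b` colours on `B`. -/
theorem exists_coloring_on_of_isPerfect_addVertex {V : Type} {G : SimpleGraph V} {B : Set V}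
    (hG : IsPerfect G) (hGB : IsPerfect (addVertex G B)) {b m : ℕ} (hbm : b ≤ m) :
    ∀ s : Set V, (∀ t : Finset V, ↑t ⊆ s → G.IsClique t → t.card ≤ m) →
      (∀ t : Finset V, ↑t ⊆ s ∩ B → G.IsClique t → t.card ≤ b) →
      ∃ c : V → ℕ, (∀ u ∈ s, c u < m) ∧ (∀ u ∈ s, ∀ v ∈ s, G.Adj u v → c u ≠ c v) ∧
        ∀ u ∈ s ∩ B, c u < b := by
  classical
  induction m, hbm using Nat.le_induction with
  | base =>
    intro s hs _
    obtain ⟨c, hc, hc'⟩ := hG.exists_coloring_on hs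
    exact ⟨c, hc, hc', fun u hu => hc u hu.1⟩
  | succ m hbm ih =>
    intro s hs hsB
    obtain ⟨c, hc, hc'⟩ := hGB.exists_coloring_on (s := insert none (some '' s)) (m := m + 1) (by
      intro t hts ht
      have hclique : G.IsClique (t.eraseNone : Finset V) := fun x hx y hy hxy => by
        simp only [Finset.mem_coe, Finset.mem_eraseNone] at hx hy
        exact ht hx hy (by simpa using hxy)
      have hsub : ∀ x ∈ t.eraseNone, x ∈ s := fun x hx => by
        have := hts (Finset.mem_eraseNone.1 hx)
        simpa using this
      by_cases hnone : none ∈ t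
      · have hB := hsB t.eraseNone (fun x hx => ⟨hsub x hx,
          addVertex_adj_none_some.1 (ht hnone (Finset.mem_eraseNone.1 hx) (by simp))⟩) hclique
        have := Finset.card_eraseNone_of_mem hnone
        omega
      · rw [← Finset.card_eraseNone_of_not_mem hnone]
        exact hs _ hsub hclique)
    have hnone : (none : Option V) ∈ insert none (some '' s) := Set.mem_insert _ _
    have hsome : ∀ u ∈ s, some u ∈ insert none (some '' s) := fun u hu =>
      Set.mem_insert_of_mem _ (Set.mem_image_of_mem _ hu)
    -- The colour class of the new vertex avoids `B` and meets every clique of size `m + 1`.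
    let r : Set V := {v ∈ s | c (some v) ≠ c none}
    have hrs : r ⊆ s := Set.sep_subset _ _
    have hBr : ∀ u ∈ s, u ∈ B → u ∈ r := fun u hu huB =>
      ⟨hu, hc' _ (hsome u hu) _ hnone (addVertex_adj_some_none.2 huB)⟩
    obtain ⟨d, hd, hd', hdB⟩ := ih r (by
      intro t htr ht
      have hcard : (t.image fun v => c (some v)).card = t.card := by
        refine Finset.card_image_of_injOn fun x hx y hy hxy => ?_
        by_contra hne
        exact hc' _ (hsome x (hrs (htr hx))) _ (hsome y (hrs (htr hy))) (ht hx hy hne) hxy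
      have hsub : (t.image fun v => c (some v)) ⊆ (Finset.range (m + 1)).erase (c none) := by
        intro k hk
        obtain ⟨x, hx, rfl⟩ := Finset.mem_image.1 hk
        exact Finset.mem_erase.2 ⟨(htr hx).2, Finset.mem_range.2 (hc _ (hsome x (hrs (htr hx))))⟩
      have := Finset.card_le_card hsub
      rw [hcard, Finset.card_erase_of_mem (Finset.mem_range.2 (hc _ hnone)),
        Finset.card_range] at this
      exact this)
      fun t ht => hsB t (ht.trans (Set.inter_subset_inter_left _ hrs))
    refine ⟨fun v => if v ∈ r then d v else m, fun u hu => ?_, fun u hu v hv huv => ?_,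
      fun u hu => ?_⟩
    · dsimp only
      split_ifs with h
      · exact (hd u h).trans (Nat.lt_succ_self m)
      · exact Nat.lt_succ_self m
    · dsimp only
      split_ifs with h1 h2 h2
      · exact hd' u h1 v h2 huv
      · exact (hd u h1).ne
      · exact (hd v h2).ne'
      · have hcu : c (some u) = c none := by_contra fun h => h1 ⟨hu, h⟩
        have hcv : c (some v) = c none := by_contra fun h => h2 ⟨hv, h⟩
        exact absurd (hcu.trans hcv.symm) (hc' _ (hsome u hu) _ (hsome v hv) huv)
    · have hur := hBr u hu.1 hu.2
      simpa [hur] using hdB u ⟨hur, hu.2⟩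

/-- If `(A, B)` is a balanced partition of a perfect graph `G`, and every Berge
graph on at most `|V(G)| + 1` vertices is perfect, then `G` has a proper colouring
with `ω(G)` colours in which the vertices of `B` receive at most `ω(G[B])`
distinct colours. -/
theorem balanced_partition_colouring_extension {V : Type} [Fintype V]
    (G : SimpleGraph V) (hGperf : IsPerfect G)
    (A B : Set V) (hdisj : Disjoint A B) (hcover : A ∪ B = Set.univ)
    (hbal : IsBalancedPair G A B)
    (hsmall : ∀ (W : Type) [Fintype W] (H : SimpleGraph W),
        Fintype.card W ≤ Fintype.card V + 1 → IsBerge H → IsPerfect H) :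
    ∃ c : G.Coloring (Fin G.cliqueNum),
      ((fun v => c v) '' B).ncard ≤ (G.induce B).cliqueNum := by
  have hGB : IsPerfect (addVertex G B) :=
    hsmall (Option V) _ (by rw [Fintype.card_option])
      (hGperf.isBerge.addVertex hdisj hcover hbal)
  obtain ⟨c, hc, hc', hcB⟩ := exists_coloring_on_of_isPerfect_addVertex hGperf hGB
    (G.cliqueNum_induce_le B) Set.univ
    (fun t _ ht => IsClique.card_le_cliqueNum (tc := ht))
    (fun t htB ht => by
      have htB' : ∀ x ∈ t, x ∈ B := fun x hx => (htB hx).2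
      classical
      rw [← Finset.subtype_map_of_mem htB'] at ht
      have := IsClique.card_le_cliqueNum (tc := ((isNClique_induce_iff (G := G) B
        (t.subtype (· ∈ B)) _).2 ⟨ht, rfl⟩).isClique)
      rwa [← Finset.card_map (.subtype _), Finset.subtype_map_of_mem htB'] at this)
  refine ⟨Coloring.mk (fun v => ⟨c v, hc v trivial⟩) fun {u v} huv h =>
    hc' u trivial v trivial huv (congrArg Fin.val h), ?_⟩
  rw [← Set.ncard_image_of_injective _ Fin.val_injective, Set.image_image]
  refine (Set.ncard_le_ncard (t := Set.Iio (G.induce B).cliqueNum) ?_ (Set.finite_Iio _)).trans ?_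
  · rintro _ ⟨v, hv, rfl⟩
    exact hcB v ⟨trivial, hv⟩
  · rw [← Finset.coe_Iio, Set.ncard_coe_finset, Nat.card_Iio]
end

section
/- Let T be an anticonnected set of vertices in a Berge graph G, and let P be a chordless path of G, vertex-disjoint from T, whose two ends are T-complete. Then one of the following holds: (1) P has even length and contains an even number of T-edges; (2) P has odd length and contains an odd number of T-edges; (3) P has odd length at least 3 and T contains a leap for P; (4) P has length 3 and its two internal vertices are the two ends of an antipath of odd length all of whose internal vertices lie in T (the Roussel–Rubio lemma). -/
open SimpleGraph

/-- `T` is anticonnected: the subgraph of the complement induced on `T` is connected. -/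
def Anticonnected {V : Type} (G : SimpleGraph V) (T : Set V) : Prop :=
  (Gᶜ.induce T).Connected

/-- `v` is `T`-complete: `v ∉ T` and `v` is adjacent to every vertex of `T`. -/
def IsTComplete {V : Type} (G : SimpleGraph V) (T : Set V) (v : V) : Prop :=
  v ∉ T ∧ ∀ t ∈ T, G.Adj v t

/-- The restriction of `p` to the integer interval `[a, b]` is an induced path of `H`. -/
def IsInducedPath {V : Type} (H : SimpleGraph V) (p : ℤ → V) (a b : ℤ) : Prop :=
  ∀ i j, a ≤ i → i < j → j ≤ b → p i ≠ p j ∧ (H.Adj (p i) (p j) ↔ j = i + 1)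

/-- `H` has no induced odd cycle on at least five vertices. -/
def NoOddHole {V : Type} (H : SimpleGraph V) : Prop :=
  ∀ n : ℕ, 5 ≤ n → Odd n → ¬ HasHoleOfLength H n

namespace IsInducedPath

variable {V : Type} {H : SimpleGraph V} {p : ℤ → V} {a b : ℤ}

lemma mono (h : IsInducedPath H p a b) {a' b' : ℤ} (ha : a ≤ a') (hb : b' ≤ b) :
    IsInducedPath H p a' b' :=
  fun i j hi hij hj => h i j (ha.trans hi) hij (hj.trans hb)

lemma ne (h : IsInducedPath H p a b) {i j : ℤ} (hi : a ≤ i) (hi' : i ≤ b) (hj : a ≤ j)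
    (hj' : j ≤ b) (hij : i ≠ j) : p i ≠ p j := by
  rcases lt_or_gt_of_ne hij with hlt | hlt
  · exact (h i j hi hlt hj').1
  · exact (h j i hj hlt hi').1.symm

lemma adj_iff (h : IsInducedPath H p a b) {i j : ℤ} (hi : a ≤ i) (hi' : i ≤ b) (hj : a ≤ j)
    (hj' : j ≤ b) : H.Adj (p i) (p j) ↔ j = i + 1 ∨ i = j + 1 := by
  rcases lt_trichotomy i j with hlt | rfl | hlt
  · rw [(h i j hi hlt hj').2]; omega
  · simp
  · rw [H.adj_comm, (h j i hj hlt hi').2]; omega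

lemma cons (h : IsInducedPath H p a b) {x : V}
    (hx : ∀ i, a ≤ i → i ≤ b → x ≠ p i ∧ (H.Adj x (p i) ↔ i = a)) :
    IsInducedPath H (Function.update p (a - 1) x) (a - 1) b := by
  intro i j hi hij hj
  rw [Function.update_of_ne (by omega : j ≠ a - 1)]
  rcases eq_or_lt_of_le hi with rfl | hi
  · rw [Function.update_self]
    have := hx j (by omega) hj
    exact ⟨this.1, this.2.trans (by omega)⟩
  · rw [Function.update_of_ne (by omega : i ≠ a - 1)]
    exact h i j (by omega) hij hj

lemma snoc (h : IsInducedPath H p a b) {y : V}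
    (hy : ∀ i, a ≤ i → i ≤ b → y ≠ p i ∧ (H.Adj y (p i) ↔ i = b)) :
    IsInducedPath H (Function.update p (b + 1) y) a (b + 1) := by
  intro i j hi hij hj
  rw [Function.update_of_ne (by omega : i ≠ b + 1)]
  rcases eq_or_lt_of_le hj with rfl | hj
  · rw [Function.update_self]
    have := hy i hi (by omega)
    exact ⟨this.1.symm, by rw [H.adj_comm, this.2]; omega⟩
  · rw [Function.update_of_ne (by omega : j ≠ b + 1)]
    exact h i j hi hij (by omega)

lemma hasHole (h : IsInducedPath H p a b) {z : V}
    (hz : ∀ i, a ≤ i → i ≤ b → z ≠ p i ∧ (H.Adj z (p i) ↔ i = a ∨ i = b))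
    {n : ℕ} (hn : 3 ≤ n) (hnab : (n : ℤ) = b - a + 2) : HasHoleOfLength H n := by
  let f : Fin n → V := fun i => if i.val + 1 = n then z else p (a + i.val)
  have key : ∀ i j : Fin n, i.val < j.val →
      f i ≠ f j ∧ (H.Adj (f i) (f j) ↔ (j.val = i.val + 1 ∨ (i.val = 0 ∧ j.val + 1 = n))) := by
    intro i j hij
    have hj := j.isLt
    have hfi : f i = p (a + i.val) := if_neg (by omega)
    by_cases hjn : j.val + 1 = n
    · have hfj : f j = z := if_pos hjn
      have := hz (a + i.val) (by omega) (by omega)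
      rw [hfi, hfj, H.adj_comm, this.2]
      exact ⟨this.1.symm, by omega⟩
    · have hfj : f j = p (a + j.val) := if_neg hjn
      have := h (a + i.val) (a + j.val) (by omega) (by omega) (by omega)
      rw [hfi, hfj, this.2]
      exact ⟨this.1, by omega⟩
  have hinj : Function.Injective f := by
    intro i j hij
    by_contra hne
    rcases lt_or_gt_of_ne (fun e => hne (Fin.ext e) : i.val ≠ j.val) with hlt | hlt
    · exact (key i j hlt).1 hij
    · exact (key j i hlt).1 hij.symm
  have hcyc : ∀ i j : Fin n, i.val < j.val →
      ((cycleGraph n).Adj i j ↔ (j.val = i.val + 1 ∨ (i.val = 0 ∧ j.val + 1 = n))) := by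
    intro i j hij
    have hj := j.isLt
    rw [cycleGraph_adj', Fin.coe_sub_iff_lt.2 hij, Fin.coe_sub_iff_le.2 hij.le]
    omega
  refine ⟨⟨⟨f, hinj⟩, ?_⟩⟩
  intro i j
  change H.Adj (f i) (f j) ↔ _
  rcases lt_trichotomy i.val j.val with hlt | heq | hlt
  · rw [(key i j hlt).2, hcyc i j hlt]
  · rw [Fin.ext heq]; simp
  · rw [H.adj_comm, (key j i hlt).2, (cycleGraph n).adj_comm, hcyc j i hlt]

/-- An induced path of odd length at least three cannot be closed up by one vertex. -/
lemma not_closed (h : IsInducedPath H p a b) (hH : NoOddHole H) (hab : a + 3 ≤ b)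
    (hodd : Odd (b - a)) {z : V}
    (hz : ∀ i, a ≤ i → i ≤ b → z ≠ p i ∧ (H.Adj z (p i) ↔ i = a ∨ i = b)) : False := by
  obtain ⟨k, hk⟩ := hodd
  exact hH (b - a + 2).toNat (by omega) ⟨(k + 1).toNat, by omega⟩
    (h.hasHole hz (by omega) (by omega))

/-- An induced path of odd length cannot be closed up by three vertices `x`, `z`, `y`. -/
lemma not_closed_three (h : IsInducedPath H p a b) (hH : NoOddHole H) (hab : a ≤ b)
    (hodd : Odd (b - a)) {x y z : V}
    (hx : ∀ i, a ≤ i → i ≤ b → x ≠ p i ∧ (H.Adj x (p i) ↔ i = a))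
    (hy : ∀ i, a ≤ i → i ≤ b → y ≠ p i ∧ (H.Adj y (p i) ↔ i = b))
    (hz : ∀ i, a ≤ i → i ≤ b → z ≠ p i ∧ ¬ H.Adj z (p i))
    (hxy : x ≠ y) (hxy' : ¬ H.Adj x y) (hzx : H.Adj z x) (hzy : H.Adj z y) : False := by
  have hab' : a + 1 ≤ b := by
    obtain ⟨k, hk⟩ := hodd
    omega
  have hyc : ∀ i, a - 1 ≤ i → i ≤ b → y ≠ Function.update p (a - 1) x i ∧
      (H.Adj y (Function.update p (a - 1) x i) ↔ i = b) := by
    intro i hi hib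
    rcases eq_or_lt_of_le hi with rfl | hi
    · rw [Function.update_self]
      exact ⟨hxy.symm, iff_of_false (fun e => hxy' e.symm) (by omega)⟩
    · rw [Function.update_of_ne (by omega)]
      exact hy i (by omega) hib
  refine ((h.cons hx).snoc hyc).not_closed hH (by omega) ?_ (z := z) ?_
  · obtain ⟨k, hk⟩ := hodd
    exact ⟨k + 1, by omega⟩
  · intro i hi hib
    rcases eq_or_lt_of_le hib with rfl | hib
    · rw [Function.update_self]
      exact ⟨hzy.ne, iff_of_true hzy (Or.inr rfl)⟩
    rw [Function.update_of_ne (by omega)]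
    rcases eq_or_lt_of_le hi with rfl | hi
    · rw [Function.update_self]
      exact ⟨hzx.ne, iff_of_true hzx (Or.inl rfl)⟩
    rw [Function.update_of_ne (by omega)]
    have := hz i (by omega) (by omega)
    exact ⟨this.1, iff_of_false this.2 (by omega)⟩

end IsInducedPath

section Connectivity

variable {V : Type} {H : SimpleGraph V}

lemma exists_isInducedPath_of_reachable {u v : V} (h : H.Reachable u v) :
    ∃ (m : ℕ) (q : ℤ → V), IsInducedPath H q 0 m ∧ q 0 = u ∧ q m = v := by
  obtain ⟨w, hw⟩ := h.exists_walk_length_eq_dist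
  refine ⟨w.length, fun i => w.getVert i.toNat, ?_, by simp, by simp⟩
  intro i j hi hij hj
  lift i to ℕ using hi
  lift j to ℕ using by omega
  simp only [Int.toNat_natCast]
  have hj' : j ≤ w.length := by omega
  have hij' : i < j := by omega
  constructor
  · intro e
    have := dist_le ((w.take i).append ((w.drop j).copy e.symm rfl))
    simp only [Walk.length_append, Walk.length_copy, Walk.take_length, Walk.drop_length] at this
    omega
  · constructor
    · intro e
      have := dist_le ((w.take i).append (Walk.cons e (w.drop j)))
      simp only [Walk.length_append, Walk.length_cons, Walk.take_length, Walk.drop_length] at this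
      omega
    · intro e
      have : j = i + 1 := by omega
      subst this
      exact w.adj_getVert_succ (by omega)

lemma exists_isInducedPath_of_induce_connected {T : Set V} (hT : (H.induce T).Connected)
    {u v : V} (hu : u ∈ T) (hv : v ∈ T) :
    ∃ (m : ℕ) (q : ℤ → V), IsInducedPath H q 0 m ∧ q 0 = u ∧ q m = v ∧ ∀ i, q i ∈ T := by
  obtain ⟨m, q, hq, h0, hm⟩ := exists_isInducedPath_of_reachable (hT ⟨u, hu⟩ ⟨v, hv⟩)
  refine ⟨m, fun i => (q i).1, ?_, by simp [h0], by simp [hm], fun i => (q i).2⟩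
  intro i j hi hij hj
  have := hq i j hi hij hj
  exact ⟨fun e => this.1 (Subtype.ext e), this.2⟩

/-- A set is connected if one can descend within it to a fixed vertex. -/
lemma induce_connected_of_descent {S : Set V} {c : V} (hc : c ∈ S) (d : V → ℕ)
    (h : ∀ w ∈ S, w ≠ c → ∃ w' ∈ S, H.Adj w w' ∧ d w' < d w) : (H.induce S).Connected := by
  have key : ∀ (n : ℕ) (w : V) (hw : w ∈ S), d w = n →
      (H.induce S).Reachable ⟨c, hc⟩ ⟨w, hw⟩ := by
    intro n
    induction n using Nat.strong_induction_on with
    | _ n ih =>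
      intro w hw hn
      by_cases hwc : w = c
      · subst hwc; exact Reachable.refl _
      · obtain ⟨w', hw', hadj, hlt⟩ := h w hw hwc
        refine (ih _ (hn ▸ hlt) w' hw' rfl).trans (Adj.reachable ?_)
        exact hadj.symm
  exact (connected_iff_exists_forall_reachable _).2 ⟨⟨c, hc⟩, fun w => key _ w.1 w.2 rfl⟩

/-- A connected induced subgraph is complete, or has two non-adjacent vertices whose individual
removal preserves connectedness, and which are joined by an induced path of even length or whose
joint removal preserves connectedness. -/
lemma complete_or_exists_removable_pair [Finite V] {T : Set V} (hT : (H.induce T).Connected) :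
    (∀ x ∈ T, ∀ y ∈ T, x ≠ y → H.Adj x y) ∨
    ∃ u ∈ T, ∃ v ∈ T, u ≠ v ∧ ¬ H.Adj u v ∧ (H.induce (T \ {u})).Connected ∧
      (H.induce (T \ {v})).Connected ∧
      ((∃ (m : ℕ) (q : ℤ → V), IsInducedPath H q 0 m ∧ q 0 = u ∧ q m = v ∧ (∀ i, q i ∈ T) ∧
        Even m) ∨ (H.induce ((T \ {u}) \ {v})).Connected) := by
  by_contra! hcon
  obtain ⟨⟨x, hx, y, hy, hxy, hnadj⟩, hcon⟩ := hcon
  obtain ⟨c, hc, hdis⟩ : ∃ c ∈ T, ¬ (H.induce (T \ {c})).Connected := by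
    by_contra! hall
    obtain ⟨m, q, hq, h0, hm, hqT⟩ := exists_isInducedPath_of_induce_connected hT hx hy
    have hm2 : 2 ≤ m := by
      by_contra! hlt
      interval_cases m
      · exact hxy (h0.symm.trans hm)
      · exact hnadj (h0 ▸ hm ▸ (hq 0 1 le_rfl (by simp) (by simp)).2.2 (by simp))
    have h02 := hq 0 2 le_rfl (by simp) (by exact_mod_cast hm2)
    refine (hcon _ (hqT 0) _ (hqT 2) h02.1 (by rw [h02.2]; omega) (hall _ (hqT 0))
      (hall _ (hqT 2))).1 2 q (hq.mono le_rfl (by exact_mod_cast hm2)) rfl rfl hqT even_two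
  have hne : (T \ {c}).Nonempty := by
    by_cases hxc : x = c
    · exact ⟨y, hy, fun e => hxy (hxc.trans (Set.mem_singleton_iff.1 e).symm)⟩
    · exact ⟨x, hx, hxc⟩
  obtain ⟨s, t, hst⟩ : ∃ s t : ↥(T \ {c}), ¬ (H.induce (T \ {c})).Reachable s t := by
    by_contra! hall
    exact hdis ((connected_iff _).2 ⟨hall, hne.to_subtype⟩)
  classical
  let d : V → ℕ := fun w => if hw : w ∈ T then (H.induce T).dist ⟨w, hw⟩ ⟨c, hc⟩ else 0
  have hstep : ∀ w ∈ T, w ≠ c → ∃ w' ∈ T, H.Adj w w' ∧ d w' < d w := by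
    intro w hw hwc
    obtain ⟨p, hp⟩ := (hT ⟨w, hw⟩ ⟨c, hc⟩).exists_walk_length_eq_dist
    cases p with
    | nil => exact absurd rfl hwc
    | @cons _ w' _ hadj p =>
      refine ⟨w'.1, w'.2, hadj, ?_⟩
      have hle := dist_le p
      simp only [Walk.length_cons] at hp
      simp only [d, dif_pos hw, dif_pos w'.2, Subtype.coe_eta]
      omega
  have hmax : ∀ s : ↥(T \ {c}), ∃ u : ↥(T \ {c}), (H.induce (T \ {c})).Reachable s u ∧
      ∀ w : ↥(T \ {c}), (H.induce (T \ {c})).Reachable s w → d w ≤ d u := by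
    intro s
    obtain ⟨u, hu, hu'⟩ := Set.exists_max_image
      {w : ↥(T \ {c}) | (H.induce (T \ {c})).Reachable s w} (fun w => d w.1) (Set.toFinite _)
      ⟨s, Reachable.refl _⟩
    exact ⟨u, hu, hu'⟩
  have hnot : ∀ s u : ↥(T \ {c}), (H.induce (T \ {c})).Reachable s u →
      (∀ w : ↥(T \ {c}), (H.induce (T \ {c})).Reachable s w → d w ≤ d u) →
      ∀ w ∈ T, w ≠ c → H.Adj w u → ¬ d u < d w := by
    intro s u hsu hu w hw hwc hadj hlt
    have : (H.induce (T \ {c})).Reachable s ⟨w, hw, hwc⟩ := hsu.trans (Adj.reachable hadj.symm)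
    exact absurd (hu _ this) (by simpa using hlt)
  obtain ⟨u, hsu, hu⟩ := hmax s
  obtain ⟨v, htv, hv⟩ := hmax t
  have huv : ¬ (H.induce (T \ {c})).Reachable u v := fun e => hst (hsu.trans (e.trans htv.symm))
  have hu' := hnot s u hsu hu
  have hv' := hnot t v htv hv
  have huc : c ≠ u := fun e => u.2.2 e.symm
  have hvc : c ≠ v := fun e => v.2.2 e.symm
  refine (hcon u u.2.1 v v.2.1 (fun e => huv ?_) (fun e => huv (Adj.reachable e)) ?_ ?_).2 ?_
  · rw [Subtype.ext e]
  · refine induce_connected_of_descent ⟨hc, huc⟩ d fun w hw hwc => ?_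
    obtain ⟨w', hw', hadj, hlt⟩ := hstep w hw.1 hwc
    exact ⟨w', ⟨hw', fun e => hu' w hw.1 hwc (e ▸ hadj) (e ▸ hlt)⟩, hadj, hlt⟩
  · refine induce_connected_of_descent ⟨hc, hvc⟩ d fun w hw hwc => ?_
    obtain ⟨w', hw', hadj, hlt⟩ := hstep w hw.1 hwc
    exact ⟨w', ⟨hw', fun e => hv' w hw.1 hwc (e ▸ hadj) (e ▸ hlt)⟩, hadj, hlt⟩
  · refine induce_connected_of_descent ⟨⟨hc, huc⟩, hvc⟩ d fun w hw hwc => ?_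
    obtain ⟨w', hw', hadj, hlt⟩ := hstep w hw.1.1 hwc
    exact ⟨w', ⟨⟨hw', fun e => hu' w hw.1.1 hwc (e ▸ hadj) (e ▸ hlt)⟩,
      fun e => hv' w hw.1.1 hwc (e ▸ hadj) (e ▸ hlt)⟩, hadj, hlt⟩

end Connectivity

section Counting

open Classical in
/-- The number of `i ∈ [a, b)` such that `i` and `i + 1` both satisfy `M`. -/
noncomputable def consecutiveCount (M : ℤ → Prop) (a b : ℤ) : ℕ :=
  {i ∈ Finset.Ico a b | M i ∧ M (i + 1)}.card

lemma consecutiveCount_add (M : ℤ → Prop) {a b c : ℤ} (hab : a ≤ b) (hbc : b ≤ c) :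
    consecutiveCount M a c = consecutiveCount M a b + consecutiveCount M b c := by
  classical
  unfold consecutiveCount
  rw [← Finset.card_union_of_disjoint, ← Finset.filter_union, Finset.Ico_union_Ico_eq_Ico hab hbc]
  exact Finset.disjoint_filter_filter (Finset.Ico_disjoint_Ico_consecutive a b c)

/-- If all odd gaps between consecutive marks are one, then the number of such gaps has the parity
of the length of the interval. -/
lemma even_sub_add_consecutiveCount (M : ℤ → Prop) {a b : ℤ} (hab : a ≤ b) (ha : M a) (hb : M b)
    (hgap : ∀ i j, a ≤ i → i < j → j ≤ b → M i → M j → (∀ l, i < l → l < j → ¬ M l) →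
      Odd (j - i) → j = i + 1) :
    Even (b - a + consecutiveCount M a b) := by
  classical
  obtain ⟨n, hn⟩ : ∃ n : ℕ, b = a + n := ⟨(b - a).toNat, by omega⟩
  induction n using Nat.strong_induction_on generalizing a with
  | _ n ih =>
    rcases eq_or_lt_of_le hab with rfl | hlt
    · simp [consecutiveCount]
    have hex : ∃ k : ℕ, M (a + 1 + k) := ⟨(b - a - 1).toNat, by
      rw [show a + 1 + ((b - a - 1).toNat : ℤ) = b by omega]; exact hb⟩
    have hk := Nat.find_spec hex
    have hmin : ∀ m, m < Nat.find hex → ¬ M (a + 1 + m) := fun m hm => Nat.find_min hex hm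
    have hkb : a + 1 + (Nat.find hex : ℤ) ≤ b := by
      by_contra! hcon
      refine hmin (b - a - 1).toNat (by omega) ?_
      rw [show a + 1 + ((b - a - 1).toNat : ℤ) = b by omega]; exact hb
    generalize Nat.find hex = k at *
    have hno : ∀ l, a < l → l < a + 1 + k → ¬ M l := by
      intro l hl hl' hM
      refine hmin (l - a - 1).toNat (by omega) ?_
      rw [show a + 1 + ((l - a - 1).toNat : ℤ) = l by omega]; exact hM
    have ih' := ih (n - 1 - k) (by omega) hkb hk
      (fun i j hi => hgap i j (by omega)) (by omega)
    rw [consecutiveCount_add M (by omega : a ≤ a + 1 + k) hkb]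
    have hg := hgap a (a + 1 + k) le_rfl (by omega) hkb ha hk hno
    rcases Nat.eq_zero_or_pos k with rfl | hpos
    · have hone : consecutiveCount M a (a + 1 + (0 : ℕ)) = 1 := by
        unfold consecutiveCount
        rw [Finset.card_eq_one]
        refine ⟨a, Finset.ext fun i => ?_⟩
        simp only [Finset.mem_filter, Finset.mem_Ico, Finset.mem_singleton]
        constructor
        · rintro ⟨h, -⟩; omega
        · rintro rfl; exact ⟨by omega, ha, by simpa using hk⟩
      rw [hone]
      obtain ⟨r, hr⟩ := ih'
      exact ⟨r + 1, by push_cast at *; omega⟩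
    · have hzero : consecutiveCount M a (a + 1 + k) = 0 := by
        unfold consecutiveCount
        rw [Finset.card_eq_zero, Finset.filter_eq_empty_iff]
        intro i hi hM
        rw [Finset.mem_Ico] at hi
        rcases eq_or_lt_of_le hi.1 with rfl | hlt
        · exact hno _ (by omega) (by omega) hM.2
        · exact hno _ hlt hi.2 hM.1
      rw [hzero]
      obtain ⟨r, hr⟩ := ih'
      rcases Int.even_or_odd (a + 1 + k - a) with ⟨s, hs⟩ | hodd
      · exact ⟨r + s, by push_cast at *; omega⟩
      · have := hg hodd; omega

end Counting

section Exceptional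

variable {V : Type} {G : SimpleGraph V} {T : Set V} {p : ℤ → V} {a b : ℤ}

/-- `T` contains a leap for the path `p a, …, p b`. -/
def HasLeap (G : SimpleGraph V) (T : Set V) (p : ℤ → V) (a b : ℤ) : Prop :=
  ∃ u ∈ T, ∃ v ∈ T, u ≠ v ∧ ¬ G.Adj u v ∧ ∀ i, a ≤ i → i ≤ b →
    (G.Adj u (p i) ↔ i = a ∨ i = a + 1 ∨ i = b) ∧ (G.Adj v (p i) ↔ i = a ∨ i = b - 1 ∨ i = b)

/-- There is an antipath of odd length from `x` to `y` with interior in `T`. -/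
def HasOddAntipath (G : SimpleGraph V) (T : Set V) (x y : V) : Prop :=
  ∃ (q : ℤ → V) (c d : ℤ), IsInducedPath Gᶜ q c d ∧ c ≤ d ∧ Odd (d - c) ∧ q c = x ∧ q d = y ∧
    ∀ i, c < i → i < d → q i ∈ T

/-- The exceptional outcomes of the Roussel–Rubio lemma. -/
def IsExceptional (G : SimpleGraph V) (T : Set V) (p : ℤ → V) (a b : ℤ) : Prop :=
  Odd (b - a) ∧ a + 3 ≤ b ∧
    (HasLeap G T p a b ∨ (b = a + 3 ∧ HasOddAntipath G T (p (a + 1)) (p (a + 2))))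

lemma IsExceptional.mono {S : Set V} (hST : S ⊆ T) (h : IsExceptional G S p a b) :
    IsExceptional G T p a b := by
  obtain ⟨h1, h2, h3⟩ := h
  refine ⟨h1, h2, ?_⟩
  rcases h3 with ⟨u, hu, v, hv, h⟩ | ⟨h4, q, c, d, hq, hcd, hodd, hc, hd, hqT⟩
  · exact Or.inl ⟨u, hST hu, v, hST hv, h⟩
  · exact Or.inr ⟨h4, q, c, d, hq, hcd, hodd, hc, hd, fun i hi hi' => hST (hqT i hi hi')⟩

lemma IsTComplete.anti {S : Set V} (hST : S ⊆ T) {x : V} (h : IsTComplete G T x) :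
    IsTComplete G S x :=
  ⟨fun hx => h.1 (hST hx), fun t ht => h.2 t (hST ht)⟩

/-- A proper segment of a path with `T`-complete ends is not exceptional. -/
lemma not_isExceptional_of_isTComplete (hG : NoOddHole G) (hGc : NoOddHole Gᶜ)
    (hp : IsInducedPath G p a b) (hdisj : ∀ i, a ≤ i → i ≤ b → p i ∉ T) {i j k : ℤ}
    (hai : a ≤ i) (hjb : j ≤ b) (hak : a ≤ k) (hkb : k ≤ b) (hk : k < i ∨ j < k)
    (hc : IsTComplete G T (p k)) : ¬ IsExceptional G T p i j := by
  rintro ⟨hodd, hij, ⟨u, hu, v, hv, huv, hnadj, huv'⟩ | ⟨rfl, q, c, d, hq, hcd, hodd, hqc, hd, hqT⟩⟩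
  · refine (hp.mono (show a ≤ i + 1 by omega) (show j - 1 ≤ b by omega)).not_closed_three hG
      (by omega) ?_ (x := u) (y := v) (z := p k) ?_ ?_ ?_ huv hnadj (hc.2 u hu) (hc.2 v hv)
    · obtain ⟨r, hr⟩ := hodd
      exact ⟨r - 1, by omega⟩
    · intro l hl hl'
      refine ⟨fun e => hdisj l (by omega) (by omega) (e ▸ hu), ?_⟩
      rw [(huv' l (by omega) (by omega)).1]; omega
    · intro l hl hl'
      refine ⟨fun e => hdisj l (by omega) (by omega) (e ▸ hv), ?_⟩
      rw [(huv' l (by omega) (by omega)).2]; omega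
    · intro l hl hl'
      refine ⟨hp.ne hak hkb (by omega) (by omega) (by omega), ?_⟩
      rw [hp.adj_iff hak hkb (by omega) (by omega)]; omega
  · have hcd' : c + 3 ≤ d := by
      by_contra! hlt
      obtain rfl : d = c + 1 := by obtain ⟨r, hr⟩ := hodd; omega
      have h1 := (hq.adj_iff (i := c) (j := c + 1) le_rfl (by omega) (by omega) le_rfl).2
        (Or.inl rfl)
      rw [hd, hqc] at h1
      exact ((compl_adj _ _ _).1 h1).2
        ((hp.adj_iff (by omega) (by omega) (by omega) (by omega)).2 (by omega))
    refine hq.not_closed hGc hcd' hodd (z := p k) fun l hl hl' => ?_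
    have hend : ∀ m, m = i + 1 ∨ m = i + 2 → p k ≠ p m ∧ Gᶜ.Adj (p k) (p m) := by
      intro m hm
      have hne := hp.ne (i := k) (j := m) hak hkb (by omega) (by omega) (by omega)
      refine ⟨hne, (compl_adj _ _ _).2 ⟨hne, ?_⟩⟩
      rw [hp.adj_iff hak hkb (by omega) (by omega)]; omega
    rcases eq_or_lt_of_le hl with rfl | hl
    · rw [hqc]
      have := hend (i + 1) (by omega)
      exact ⟨this.1, iff_of_true this.2 (by omega)⟩
    rcases eq_or_lt_of_le hl' with rfl | hl'
    · rw [hd]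
      have := hend (i + 2) (by omega)
      exact ⟨this.1, iff_of_true this.2 (by omega)⟩
    have hlT := hqT l hl hl'
    exact ⟨fun e => hdisj k hak hkb (e ▸ hlT),
      iff_of_false (fun e => ((compl_adj _ _ _).1 e).2 (hc.2 _ hlT)) (by omega)⟩

/-- The parity statement follows from the statement for segments without interior `T`-complete
vertices. -/
lemma even_or_isExceptional_of_segments (hG : NoOddHole G) (hGc : NoOddHole Gᶜ)
    (hp : IsInducedPath G p a b) (hdisj : ∀ i, a ≤ i → i ≤ b → p i ∉ T) (hab : a ≤ b)
    (ha : IsTComplete G T (p a)) (hb : IsTComplete G T (p b))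
    (hseg : ∀ i j, a ≤ i → j ≤ b → Odd (j - i) → i + 3 ≤ j → IsTComplete G T (p i) →
      IsTComplete G T (p j) → (∀ l, i < l → l < j → ¬ IsTComplete G T (p l)) →
      IsExceptional G T p i j) :
    Even (b - a + consecutiveCount (fun i => IsTComplete G T (p i)) a b) ∨
      IsExceptional G T p a b := by
  by_cases hex : IsExceptional G T p a b
  · exact Or.inr hex
  refine Or.inl (even_sub_add_consecutiveCount _ hab ha hb ?_)
  intro i j hi hij hj hMi hMj hno hodd
  by_contra hne
  have h3 : i + 3 ≤ j := by obtain ⟨r, hr⟩ := hodd; omega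
  have hE := hseg i j hi hj hodd h3 hMi hMj hno
  rcases eq_or_lt_of_le hi with rfl | hi'
  · rcases eq_or_lt_of_le hj with rfl | hj'
    · exact hex hE
    · exact not_isExceptional_of_isTComplete hG hGc hp hdisj le_rfl hj hab le_rfl (Or.inr hj') hb hE
  · exact not_isExceptional_of_isTComplete hG hGc hp hdisj hi hj le_rfl hab (Or.inl hi') ha hE

end Exceptional

section Core

variable {V : Type} {G : SimpleGraph V} {T : Set V} {p : ℤ → V} {a b : ℤ}

lemma HasOddAntipath.symm {x y : V} (h : HasOddAntipath G T x y) : HasOddAntipath G T y x := by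
  obtain ⟨q, c, d, hq, hcd, hodd, hc, hd, hqT⟩ := h
  refine ⟨fun i => q (-i), -d, -c, ?_, by omega, by rwa [show -c - -d = d - c by ring],
    by simpa using hd, by simpa using hc, fun i hi hi' => hqT _ (by omega) (by omega)⟩
  intro i j hi hij hj
  refine ⟨hq.ne (by omega) (by omega) (by omega) (by omega) (by omega), ?_⟩
  rw [hq.adj_iff (by omega) (by omega) (by omega) (by omega)]
  omega

/-- If `T` is stable and has no leap, then odd gaps between consecutive vertices of the path with a
neighbour in `T` have length one, and the ends of such a gap have a common neighbour in `T`. -/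
lemma gap_of_stable (hG : NoOddHole G) (hp : IsInducedPath G p a b)
    (hdisj : ∀ i, a ≤ i → i ≤ b → p i ∉ T) (hab : a ≤ b)
    (ha : IsTComplete G T (p a)) (hb : IsTComplete G T (p b))
    (hstable : ∀ x ∈ T, ∀ y ∈ T, ¬ G.Adj x y) (hleap : ¬ HasLeap G T p a b) {i j : ℤ}
    (hi : a ≤ i) (hij : i < j) (hj : j ≤ b) (hMi : ∃ t ∈ T, G.Adj t (p i))
    (hMj : ∃ t ∈ T, G.Adj t (p j)) (hno : ∀ l, i < l → l < j → ¬ ∃ t ∈ T, G.Adj t (p l))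
    (hodd : Odd (j - i)) : j = i + 1 ∧ ∃ t ∈ T, G.Adj t (p i) ∧ G.Adj t (p j) := by
  have hneT : ∀ t ∈ T, ∀ l, a ≤ l → l ≤ b → t ≠ p l := fun t ht l hl hl' e => hdisj l hl hl' (e ▸ ht)
  by_cases hcom : ∃ t ∈ T, G.Adj t (p i) ∧ G.Adj t (p j)
  · refine ⟨?_, hcom⟩
    by_contra hne
    obtain ⟨t, ht, hti, htj⟩ := hcom
    refine (hp.mono hi hj).not_closed hG (by obtain ⟨r, hr⟩ := hodd; omega) hodd (z := t)
      fun l hl hl' => ⟨hneT t ht l (by omega) (by omega), ?_⟩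
    constructor
    · intro hadj
      by_contra! hcon
      exact hno l (by omega) (by omega) ⟨t, ht, hadj⟩
    · rintro (rfl | rfl)
      exacts [hti, htj]
  · exfalso
    obtain ⟨u, hu, hui⟩ := hMi
    obtain ⟨v, hv, hvj⟩ := hMj
    have huj : ¬ G.Adj u (p j) := fun e => hcom ⟨u, hu, hui, e⟩
    have hvi : ¬ G.Adj v (p i) := fun e => hcom ⟨v, hv, e, hvj⟩
    have huv : u ≠ v := by rintro rfl; exact huj hvj
    have hia : i ≠ a := by rintro rfl; exact hvi (ha.2 v hv).symm
    have hjb : j ≠ b := by rintro rfl; exact huj (hb.2 u hu).symm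
    have hu' : ∀ l, i ≤ l → l ≤ j → (G.Adj u (p l) ↔ l = i) := by
      intro l hl hl'
      refine ⟨fun hadj => ?_, by rintro rfl; exact hui⟩
      by_contra hne
      rcases eq_or_lt_of_le hl' with rfl | hl'
      · exact huj hadj
      · exact hno l (by omega) hl' ⟨u, hu, hadj⟩
    have hv' : ∀ l, i ≤ l → l ≤ j → (G.Adj v (p l) ↔ l = j) := by
      intro l hl hl'
      refine ⟨fun hadj => ?_, by rintro rfl; exact hvj⟩
      by_contra hne
      rcases eq_or_lt_of_le hl with rfl | hl
      · exact hvi hadj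
      · exact hno l hl (by omega) ⟨v, hv, hadj⟩
    by_cases hwhole : i = a + 1 ∧ j = b - 1
    · obtain ⟨rfl, rfl⟩ := hwhole
      refine hleap ⟨u, hu, v, hv, huv, hstable u hu v hv, fun l hl hl' => ?_⟩
      rcases eq_or_lt_of_le hl with rfl | hl
      · exact ⟨iff_of_true (ha.2 u hu).symm (by omega), iff_of_true (ha.2 v hv).symm (by omega)⟩
      rcases eq_or_lt_of_le hl' with rfl | hl'
      · exact ⟨iff_of_true (hb.2 u hu).symm (by omega), iff_of_true (hb.2 v hv).symm (by omega)⟩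
      rw [hu' l (by omega) (by omega), hv' l (by omega) (by omega)]
      omega
    · obtain ⟨k, hk, hkc⟩ : ∃ k, (k = a ∧ a + 1 < i ∨ k = b ∧ j + 1 < b) ∧
          IsTComplete G T (p k) := by
        by_cases h : a + 1 < i
        · exact ⟨a, Or.inl ⟨rfl, h⟩, ha⟩
        · exact ⟨b, Or.inr ⟨rfl, by omega⟩, hb⟩
      refine (hp.mono hi hj).not_closed_three hG hij.le hodd (x := u) (y := v) (z := p k)
        (fun l hl hl' => ⟨hneT u hu l (by omega) (by omega), hu' l hl hl'⟩)
        (fun l hl hl' => ⟨hneT v hv l (by omega) (by omega), hv' l hl hl'⟩)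
        (fun l hl hl' => ?_) huv (hstable u hu v hv) (hkc.2 u hu) (hkc.2 v hv)
      refine ⟨hp.ne (by omega) (by omega) (by omega) (by omega) (by omega), ?_⟩
      rw [hp.adj_iff (by omega) (by omega) (by omega) (by omega)]
      omega

lemma isExceptional_of_stable [Finite V] (hG : NoOddHole G) (hp : IsInducedPath G p a b)
    (hdisj : ∀ i, a ≤ i → i ≤ b → p i ∉ T) (hab : a + 3 ≤ b) (hodd : Odd (b - a))
    (ha : IsTComplete G T (p a)) (hb : IsTComplete G T (p b))
    (hint : ∀ i, a < i → i < b → ¬ IsTComplete G T (p i)) (hTne : T.Nonempty)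
    (hstable : ∀ x ∈ T, ∀ y ∈ T, ¬ G.Adj x y)
    (ih : ∀ S, S ⊂ T → S.Nonempty →
      Even (b - a + consecutiveCount (fun i => IsTComplete G S (p i)) a b) ∨
        IsExceptional G S p a b) : IsExceptional G T p a b := by
  classical
  by_contra hne
  have hleap : ¬ HasLeap G T p a b := fun h => hne ⟨hodd, hab, Or.inl h⟩
  let M : ℤ → Prop := fun i => ∃ t ∈ T, G.Adj t (p i)
  obtain ⟨t₀, ht₀⟩ := hTne
  have hgap := fun i j hi hij hj hMi hMj hno hodd => gap_of_stable (i := i) (j := j) hG hp hdisj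
    (by omega) ha hb hstable hleap hi hij hj hMi hMj hno hodd
  have hM := even_sub_add_consecutiveCount M (by omega) ⟨t₀, ht₀, (ha.2 _ ht₀).symm⟩
    ⟨t₀, ht₀, (hb.2 _ ht₀).symm⟩
    (fun i j hi hij hj hMi hMj hno hodd => (hgap i j hi hij hj hMi hMj hno hodd).1)
  let F : Finset V := T.toFinite.toFinset
  have hF : ∀ x, x ∈ F ↔ x ∈ T := fun x => Set.Finite.mem_toFinset _
  let C : ℤ → Finset V := fun i => {t ∈ F | G.Adj t (p i) ∧ G.Adj t (p (i + 1))}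
  have hcount : ∀ U ∈ F.powerset.erase ∅,
      consecutiveCount (fun i => IsTComplete G (U : Set V) (p i)) a b =
        ∑ i ∈ Finset.Ico a b, if U ⊆ C i then 1 else 0 := by
    intro U hU
    rw [consecutiveCount, Finset.card_filter]
    refine Finset.sum_congr rfl fun i hi => if_congr ?_ rfl rfl
    rw [Finset.mem_Ico] at hi
    have hUF := Finset.mem_powerset.1 (Finset.mem_of_mem_erase hU)
    constructor
    · rintro ⟨h1, h2⟩ t ht
      exact Finset.mem_filter.2 ⟨hUF ht, (h1.2 t ht).symm, (h2.2 t ht).symm⟩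
    · intro h
      refine ⟨⟨fun hm => hdisj i (by omega) (by omega) ((hF _).1 (hUF hm)), fun t ht =>
        (Finset.mem_filter.1 (h ht)).2.1.symm⟩, ⟨fun hm => hdisj (i + 1) (by omega) (by omega)
        ((hF _).1 (hUF hm)), fun t ht => (Finset.mem_filter.1 (h ht)).2.2.symm⟩⟩
  have hCM : ∀ i ∈ Finset.Ico a b, (M i ∧ M (i + 1) ↔ C i ≠ ∅) := by
    intro i hi
    rw [Finset.mem_Ico] at hi
    rw [← Finset.nonempty_iff_ne_empty]
    constructor
    · rintro ⟨h1, h2⟩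
      obtain ⟨-, t, ht, h⟩ := hgap i (i + 1) hi.1 (by omega) (by omega) h1 h2
        (fun l hl hl' => by omega) ⟨0, by omega⟩
      exact ⟨t, Finset.mem_filter.2 ⟨(hF t).2 ht, h⟩⟩
    · rintro ⟨t, ht⟩
      obtain ⟨ht, h1, h2⟩ := Finset.mem_filter.1 ht
      exact ⟨⟨t, (hF t).1 ht, h1⟩, ⟨t, (hF t).1 ht, h2⟩⟩
  have hpow : ∀ D : Finset V, (((D.powerset.erase ∅).card : ℕ) : ZMod 2) =
      if D ≠ ∅ then 1 else 0 := by
    intro D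
    rw [Finset.card_erase_of_mem (Finset.empty_mem_powerset D), Finset.card_powerset,
      Nat.cast_sub Nat.one_le_two_pow]
    by_cases hD : D = ∅
    · simp [hD]
    · have : D.card ≠ 0 := fun h => hD (Finset.card_eq_zero.1 h)
      have h2 : (2 : ZMod 2) = 0 := rfl
      simp [hD, h2, this]
  have hdouble : (∑ U ∈ F.powerset.erase ∅,
      (consecutiveCount (fun i => IsTComplete G (U : Set V) (p i)) a b : ZMod 2)) =
        (consecutiveCount M a b : ZMod 2) := by
    rw [consecutiveCount, Finset.card_filter]
    push_cast
    calc _ = ∑ U ∈ F.powerset.erase ∅, ∑ i ∈ Finset.Ico a b,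
          if U ⊆ C i then (1 : ZMod 2) else 0 := by
          refine Finset.sum_congr rfl fun U hU => ?_
          rw [hcount U hU]; push_cast; rfl
      _ = ∑ i ∈ Finset.Ico a b, ∑ U ∈ F.powerset.erase ∅,
          if U ⊆ C i then (1 : ZMod 2) else 0 := Finset.sum_comm
      _ = _ := by
          refine Finset.sum_congr rfl fun i hi => ?_
          rw [Finset.sum_boole, if_congr (hCM i hi) rfl rfl, ← hpow]
          congr 2
          ext U
          simp only [Finset.mem_filter, Finset.mem_erase, Finset.mem_powerset]
          exact ⟨fun h => ⟨h.1.1, h.2⟩,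
            fun h => ⟨⟨h.1, h.2.trans (Finset.filter_subset _ _)⟩, h.2⟩⟩
  have hone : ∀ U ∈ F.powerset.erase ∅,
      (consecutiveCount (fun i => IsTComplete G (U : Set V) (p i)) a b : ZMod 2) =
        1 - if U = F then 1 else 0 := by
    intro U hU
    obtain ⟨hU0, hUF⟩ := Finset.mem_erase.1 hU
    rw [Finset.mem_powerset] at hUF
    by_cases hUeq : U = F
    · have : consecutiveCount (fun i => IsTComplete G (U : Set V) (p i)) a b = 0 := by
        have hUT : (U : Set V) = T := by rw [hUeq]; exact Set.Finite.coe_toFinset _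
        rw [consecutiveCount, Finset.card_eq_zero, Finset.filter_eq_empty_iff]
        rintro i hi ⟨h1, h2⟩
        rw [hUT] at h1 h2
        rw [Finset.mem_Ico] at hi
        by_cases hia : i = a
        · exact hint (i + 1) (by omega) (by omega) h2
        · exact hint i (by omega) (by omega) h1
      rw [this, if_pos hUeq]
      simp
    · have hss : (U : Set V) ⊂ T := by
        refine ⟨fun x hx => (hF x).1 (hUF hx), fun h => hUeq ?_⟩
        exact hUF.antisymm fun x hx => h ((hF x).1 hx)
      rcases ih U hss (Finset.coe_nonempty.2 (Finset.nonempty_iff_ne_empty.2 hU0)) with h | h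
      · have : Odd (consecutiveCount (fun i => IsTComplete G (U : Set V) (p i)) a b) := by
          obtain ⟨r, hr⟩ := h
          obtain ⟨s, hs⟩ := hodd
          exact ⟨(r - s - 1).toNat, by omega⟩
        simp [hUeq, ZMod.natCast_eq_one_iff_odd.2 this]
      · exact absurd (h.mono hss.subset) hne
  have hF0 : F ≠ ∅ := Finset.nonempty_iff_ne_empty.1 ⟨t₀, (hF t₀).2 ht₀⟩
  rw [Finset.sum_congr rfl hone, Finset.sum_sub_distrib, Finset.sum_const, nsmul_eq_mul, mul_one,
    hpow, if_pos hF0, Finset.sum_ite_eq', if_pos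
    (Finset.mem_erase.2 ⟨hF0, Finset.mem_powerset_self F⟩), sub_self] at hdouble
  have heven := ZMod.natCast_eq_zero_iff_even.1 hdouble.symm
  obtain ⟨r, hr⟩ := hM
  obtain ⟨s, hs⟩ := hodd
  obtain ⟨w, hw⟩ := heven
  omega

lemma isExceptional_of_removable_pair (hGc : NoOddHole Gᶜ) (hp : IsInducedPath G p a b)
    (hdisj : ∀ i, a ≤ i → i ≤ b → p i ∉ T) (hab : a + 3 ≤ b) (hodd : Odd (b - a))
    (ha : IsTComplete G T (p a)) (hb : IsTComplete G T (p b))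
    (hint : ∀ i, a < i → i < b → ¬ IsTComplete G T (p i)) {m : ℕ} {q : ℤ → V}
    (hq : IsInducedPath Gᶜ q 0 m) (hqT : ∀ i, q i ∈ T) (hm : 2 ≤ m)
    (hu : Even (b - a + consecutiveCount (fun i => IsTComplete G (T \ {q 0}) (p i)) a b))
    (hv : Even (b - a + consecutiveCount (fun i => IsTComplete G (T \ {q m}) (p i)) a b))
    (huv : Even m ∨ Even (b - a +
      consecutiveCount (fun i => IsTComplete G ((T \ {q 0}) \ {q m}) (p i)) a b)) :
    IsExceptional G T p a b := by
  classical
  have hqne : ∀ i l, a ≤ i → i ≤ b → p i ≠ q l := fun i l hi hi' e =>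
    hdisj i hi hi' (e ▸ hqT l)
  have hTc : ∀ i, a < i → i < b → ∀ x, IsTComplete G (T \ {x}) (p i) → ¬ G.Adj (p i) x := by
    refine fun i hi hi' x h hadj => hint i hi hi' ⟨hdisj i hi.le hi'.le, fun t ht => ?_⟩
    by_cases htx : t = x
    · exact htx ▸ hadj
    · exact h.2 t ⟨ht, htx⟩
  have hatt : ∀ i, a < i → i < b → ∀ k, 0 ≤ k → k ≤ (m : ℤ) → IsTComplete G (T \ {q k}) (p i) →
      ∀ l, 0 ≤ l → l ≤ (m : ℤ) → p i ≠ q l ∧ (Gᶜ.Adj (p i) (q l) ↔ l = k) := by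
    intro i hi hi' k hk hk' h l hl hl'
    have hne := hqne i l hi.le hi'.le
    refine ⟨hne, ?_⟩
    rw [compl_adj]
    constructor
    · rintro ⟨-, hn⟩
      by_contra hlk
      exact hn (h.2 _ ⟨hqT l, fun e => hq.ne hl hl' hk hk' hlk e⟩)
    · rintro rfl
      exact ⟨hne, hTc i hi hi' _ h⟩
  have hfree : ∀ k, a ≤ k → k ≤ b → IsTComplete G T (p k) → ∀ l, p k ≠ q l ∧
      ¬ Gᶜ.Adj (p k) (q l) := fun k hk hk' h l =>
    ⟨hqne k l hk hk', fun e => ((compl_adj _ _ _).1 e).2 (h.2 _ (hqT l))⟩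
  have hpc : ∀ i j, a ≤ i → i ≤ b → a ≤ j → j ≤ b → i ≠ j →
      (Gᶜ.Adj (p i) (p j) ↔ ¬ (j = i + 1 ∨ i = j + 1)) := by
    intro i j hi hi' hj hj' hij
    rw [compl_adj, hp.adj_iff hi hi' hj hj']
    exact and_iff_right (hp.ne hi hi' hj hj' hij)
  have hAB : ∀ i, a < i → i < b → IsTComplete G (T \ {q 0}) (p i) →
      ¬ IsTComplete G (T \ {q m}) (p i) := by
    intro i hi hi' hA hB
    have h1 := (hatt i hi hi' 0 le_rfl (by omega) hA 0 le_rfl (by omega)).2.2 rfl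
    have h2 := (hatt i hi hi' m (by omega) le_rfl hB 0 le_rfl (by omega)).2.1 h1
    omega
  have hcons : ∀ i, a < i → i < b → IsTComplete G (T \ {q 0}) (p i) →
      IsInducedPath Gᶜ (Function.update q (0 - 1) (p i)) (0 - 1) m := fun i hi hi' hA =>
    hq.cons (hatt i hi hi' 0 le_rfl (by omega) hA)
  have hupd : ∀ i (P : V → ℤ → Prop), P (p i) (-1) → (∀ l, 0 ≤ l → l ≤ (m : ℤ) → P (q l) l) →
      ∀ l, 0 - 1 ≤ l → l ≤ (m : ℤ) → P (Function.update q (0 - 1) (p i) l) l := by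
    intro i P h1 h2 l hl hl'
    rcases eq_or_lt_of_le hl with rfl | hl
    · rw [Function.update_self]; exact h1
    · rw [Function.update_of_ne (by omega)]; exact h2 l (by omega) hl'
  have hadj_of_even : Even m → ∀ i j, a < i → i < b → a < j → j < b →
      IsTComplete G (T \ {q 0}) (p i) → IsTComplete G (T \ {q m}) (p j) →
      j = i + 1 ∨ i = j + 1 := by
    rintro ⟨r, hr⟩ i j hi hi' hj hj' hA hB
    by_contra hnadj
    have hij : j ≠ i := by rintro rfl; exact hAB j hj hj' hA hB
    refine (hcons i hi hi' hA).not_closed hGc (by omega) ⟨r, by omega⟩ (z := p j)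
      (hupd i (fun x l => p j ≠ x ∧ (Gᶜ.Adj (p j) x ↔ l = 0 - 1 ∨ l = (m : ℤ))) ?_ ?_)
    · exact ⟨hp.ne hj.le hj'.le hi.le hi'.le hij,
        iff_of_true ((hpc j i hj.le hj'.le hi.le hi'.le hij).2 (by omega)) (by omega)⟩
    · intro l hl hl'
      have := hatt j hj hj' m (by omega) le_rfl hB l hl hl'
      exact ⟨this.1, this.2.trans (by omega)⟩
  have hnadj_of_odd : Odd m → ∀ i j, a < i → i < b → a < j → j < b →
      IsTComplete G (T \ {q 0}) (p i) → IsTComplete G (T \ {q m}) (p j) →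
      j = i + 1 ∨ i = j + 1 → b = a + 3 := by
    rintro ⟨r, hr⟩ i j hi hi' hj hj' hA hB hadj
    by_contra hne
    obtain ⟨k, hk, hkc⟩ : ∃ k, (k = a ∧ a + 1 < i ∧ a + 1 < j ∨ k = b ∧ i + 1 < b ∧ j + 1 < b) ∧
        IsTComplete G T (p k) := by
      by_cases h : a + 1 < i ∧ a + 1 < j
      · exact ⟨a, Or.inl ⟨rfl, h⟩, ha⟩
      · exact ⟨b, Or.inr ⟨rfl, by omega⟩, hb⟩
    refine hq.not_closed_three hGc (by omega) ⟨r, by omega⟩ (x := p i) (y := p j) (z := p k)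
      (hatt i hi hi' 0 le_rfl (by omega) hA) (hatt j hj hj' m (by omega) le_rfl hB)
      (fun l _ _ => hfree k (by omega) (by omega) hkc l)
      (hp.ne hi.le hi'.le hj.le hj'.le (by omega)) ?_ ?_ ?_
    · rw [hpc i j hi.le hi'.le hj.le hj'.le (by omega)]; omega
    · rw [hpc k i (by omega) (by omega) hi.le hi'.le (by omega)]; omega
    · rw [hpc k j (by omega) (by omega) hj.le hj'.le (by omega)]; omega
  have hexists : ∀ N : ℤ → Prop, Even (b - a + consecutiveCount N a b) →
      ∃ i, a ≤ i ∧ i < b ∧ N i ∧ N (i + 1) := by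
    intro N hN
    have : consecutiveCount N a b ≠ 0 := by
      intro h
      rw [h, Nat.cast_zero, add_zero] at hN
      exact Int.not_even_iff_odd.2 hodd hN
    obtain ⟨i, hi⟩ := Finset.card_pos.1 (Nat.pos_of_ne_zero this)
    rw [Finset.mem_filter, Finset.mem_Ico] at hi
    exact ⟨i, hi.1.1, hi.1.2, hi.2⟩
  obtain ⟨i, hi, hi', hAi, hAi'⟩ := hexists _ hu
  obtain ⟨j, hj, hj', hBj, hBj'⟩ := hexists _ hv
  by_cases hb3 : b = a + 3
  · -- Paths of length three: the two inner vertices extend the antipath.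
    refine ⟨hodd, hab, Or.inr ⟨hb3, ?_⟩⟩
    have hinner : ∀ N : ℤ → Prop, ∀ i, a ≤ i → i < b → N i → N (i + 1) →
        N (a + 1) ∨ N (a + 2) := by
      intro N i hi hi' h1 h2
      obtain rfl | rfl | rfl : i = a ∨ i = a + 1 ∨ i = a + 2 := by omega
      exacts [Or.inl h2, Or.inl h1, Or.inr h1]
    obtain ⟨x, y, hxy, hA, hB⟩ : ∃ x y, (x = a + 1 ∧ y = a + 2 ∨ x = a + 2 ∧ y = a + 1) ∧
        IsTComplete G (T \ {q 0}) (p x) ∧ IsTComplete G (T \ {q m}) (p y) := by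
      rcases hinner (fun i => IsTComplete G (T \ {q 0}) (p i)) i hi hi' hAi hAi' with h1 | h1 <;>
      rcases hinner (fun i => IsTComplete G (T \ {q m}) (p i)) j hj hj' hBj hBj' with h2 | h2
      · exact absurd h2 (hAB _ (by omega) (by omega) h1)
      · exact ⟨_, _, Or.inl ⟨rfl, rfl⟩, h1, h2⟩
      · exact ⟨_, _, Or.inr ⟨rfl, rfl⟩, h1, h2⟩
      · exact absurd h2 (hAB _ (by omega) (by omega) h1)
    have hxyc : ¬ Gᶜ.Adj (p y) (p x) := by
      rw [hpc y x (by omega) (by omega) (by omega) (by omega) (by omega)]; omega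
    have hyatt := hatt y (by omega) (by omega) m (by omega) le_rfl hB
    have hyatt' : ∀ l, 0 - 1 ≤ l → l ≤ (m : ℤ) →
        p y ≠ Function.update q (0 - 1) (p x) l ∧
          (Gᶜ.Adj (p y) (Function.update q (0 - 1) (p x) l) ↔ l = (m : ℤ)) :=
      hupd x (fun w l => p y ≠ w ∧ (Gᶜ.Adj (p y) w ↔ l = (m : ℤ)))
        ⟨hp.ne (by omega) (by omega) (by omega) (by omega) (by omega),
          iff_of_false hxyc (by omega)⟩ hyatt
    have hpath := hcons x (by omega) (by omega) hA
    rcases Nat.even_or_odd m with ⟨r, hr⟩ | ⟨r, hr⟩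
    · exfalso
      obtain ⟨e, f, hef, hec, hfc⟩ : ∃ e f, (x = a + 1 ∧ e = b ∧ f = a ∨ x = a + 2 ∧ e = a ∧ f = b) ∧
          IsTComplete G T (p e) ∧ IsTComplete G T (p f) := by
        rcases hxy with h | h
        · exact ⟨b, a, Or.inl ⟨h.1, rfl, rfl⟩, hb, ha⟩
        · exact ⟨a, b, Or.inr ⟨h.1, rfl, rfl⟩, ha, hb⟩
      refine hpath.not_closed_three hGc (by omega) ⟨r, by omega⟩ (x := p e) (y := p y) (z := p f)
        (hupd x (fun w l => p e ≠ w ∧ (Gᶜ.Adj (p e) w ↔ l = 0 - 1)) ⟨?_, iff_of_true ?_ (by omega)⟩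
          fun l hl hl' => ?_) hyatt'
        (hupd x (fun w _ => p f ≠ w ∧ ¬ Gᶜ.Adj (p f) w) ⟨?_, ?_⟩
          fun l _ _ => hfree f (by omega) (by omega) hfc l) ?_ ?_ ?_ ?_
      · exact hp.ne (by omega) (by omega) (by omega) (by omega) (by omega)
      · rw [hpc e x (by omega) (by omega) (by omega) (by omega) (by omega)]; omega
      · have := hfree e (by omega) (by omega) hec l
        exact ⟨this.1, iff_of_false this.2 (by omega)⟩
      · exact hp.ne (by omega) (by omega) (by omega) (by omega) (by omega)
      · rw [hpc f x (by omega) (by omega) (by omega) (by omega) (by omega)]; omega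
      · exact hp.ne (by omega) (by omega) (by omega) (by omega) (by omega)
      · rw [hpc e y (by omega) (by omega) (by omega) (by omega) (by omega)]; omega
      · rw [hpc f e (by omega) (by omega) (by omega) (by omega) (by omega)]; omega
      · rw [hpc f y (by omega) (by omega) (by omega) (by omega) (by omega)]; omega
    · have hanti : HasOddAntipath G T (p x) (p y) := by
        refine ⟨_, _, _, hpath.snoc hyatt', by omega, ⟨r + 1, by omega⟩, ?_, ?_, ?_⟩
        · rw [Function.update_of_ne (by omega), Function.update_self]
        · rw [Function.update_self]
        · intro l hl hl'
          rw [Function.update_of_ne (by omega), Function.update_of_ne (by omega)]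
          exact hqT l
      rcases hxy with ⟨rfl, rfl⟩ | ⟨rfl, rfl⟩
      exacts [hanti, hanti.symm]
  exfalso
  rcases Nat.even_or_odd m with heven | hmodd
  · have key := hadj_of_even heven
    have hA : ∀ l, a < l → l < b → IsTComplete G (T \ {q 0}) (p l) →
        ∀ k, (k = j ∨ k = j + 1) → a < k → k < b → k = l + 1 ∨ l = k + 1 := by
      rintro l hl hl' h k (rfl | rfl) hk hk'
      exacts [key l _ hl hl' hk hk' h hBj, key l _ hl hl' hk hk' h hBj']
    have h1 := fun h h' => hA i h h' hAi
    have h2 := fun h h' => hA (i + 1) h h' hAi'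
    have h11 := fun h h' => h1 h h' j (Or.inl rfl)
    have h12 := fun h h' => h1 h h' (j + 1) (Or.inr rfl)
    have h21 := fun h h' => h2 h h' j (Or.inl rfl)
    have h22 := fun h h' => h2 h h' (j + 1) (Or.inr rfl)
    obtain ⟨r, hr⟩ := hodd
    omega
  · have huv' := huv.resolve_left (Nat.not_even_iff_odd.2 hmodd)
    have hnadj : ∀ i j, a < i → i < b → a < j → j < b → IsTComplete G (T \ {q 0}) (p i) →
        IsTComplete G (T \ {q m}) (p j) → ¬ (j = i + 1 ∨ i = j + 1) :=
      fun i j hi hi' hj hj' hA hB h => hb3 (hnadj_of_odd hmodd i j hi hi' hj hj' hA hB h)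
    have htype : ∀ l, a ≤ l → l ≤ b → IsTComplete G ((T \ {q 0}) \ {q m}) (p l) →
        IsTComplete G (T \ {q 0}) (p l) ∨ IsTComplete G (T \ {q m}) (p l) := by
      intro l hl hl' h
      by_contra! hcon
      have hn0 : ¬ G.Adj (p l) (q 0) := by
        refine fun hadj => hcon.2 ⟨fun hm => hdisj l hl hl' hm.1, fun t ht => ?_⟩
        by_cases ht0 : t = q 0
        · exact ht0 ▸ hadj
        · exact h.2 t ⟨⟨ht.1, ht0⟩, ht.2⟩
      have hnm : ¬ G.Adj (p l) (q m) := by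
        refine fun hadj => hcon.1 ⟨fun hm => hdisj l hl hl' hm.1, fun t ht => ?_⟩
        by_cases htm : t = q m
        · exact htm ▸ hadj
        · exact h.2 t ⟨ht, htm⟩
      obtain ⟨r, hr⟩ := hmodd
      refine hq.not_closed hGc (by omega) ⟨r, by omega⟩ (z := p l) fun k hk hk' =>
        ⟨hqne l k hl hl', ?_⟩
      rw [compl_adj]
      constructor
      · rintro ⟨-, hn⟩
        by_contra! hk2
        exact hn (h.2 _ ⟨⟨hqT k, fun e => hq.ne hk hk' le_rfl (by omega) hk2.1 e⟩,
          fun e => hq.ne hk hk' (by omega) le_rfl hk2.2 e⟩)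
      · rintro (rfl | rfl)
        exacts [⟨hqne _ _ hl hl', hn0⟩, ⟨hqne _ _ hl hl', hnm⟩]
    have hend : ∀ x, ∀ l, l = a ∨ l = b → IsTComplete G (T \ {x}) (p l) := by
      rintro x l (rfl | rfl)
      exacts [ha.anti Set.sdiff_subset, hb.anti Set.sdiff_subset]
    have hsum : consecutiveCount (fun i => IsTComplete G ((T \ {q 0}) \ {q m}) (p i)) a b =
        consecutiveCount (fun i => IsTComplete G (T \ {q 0}) (p i)) a b +
          consecutiveCount (fun i => IsTComplete G (T \ {q m}) (p i)) a b := by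
      unfold consecutiveCount
      rw [← Finset.card_union_of_disjoint]
      · congr 1
        ext l
        simp only [Finset.mem_union, Finset.mem_filter, Finset.mem_Ico]
        constructor
        · rintro ⟨⟨hl, hl'⟩, h1, h2⟩
          by_cases hla : l = a
          · rcases htype _ (by omega) (by omega) h2 with h | h
            · exact Or.inl ⟨⟨hl, hl'⟩, hend _ l (Or.inl hla), h⟩
            · exact Or.inr ⟨⟨hl, hl'⟩, hend _ l (Or.inl hla), h⟩
          by_cases hlb : l + 1 = b
          · rcases htype _ (by omega) (by omega) h1 with h | h
            · exact Or.inl ⟨⟨hl, hl'⟩, h, hend _ _ (Or.inr hlb)⟩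
            · exact Or.inr ⟨⟨hl, hl'⟩, h, hend _ _ (Or.inr hlb)⟩
          rcases htype _ (by omega) (by omega) h1 with h | h <;>
          rcases htype _ (by omega) (by omega) h2 with h' | h'
          · exact Or.inl ⟨⟨hl, hl'⟩, h, h'⟩
          · exact absurd (Or.inl rfl) (hnadj l (l + 1) (by omega) (by omega) (by omega) (by omega)
              h h')
          · exact absurd (Or.inr rfl) (hnadj (l + 1) l (by omega) (by omega) (by omega) (by omega)
              h' h)
          · exact Or.inr ⟨⟨hl, hl'⟩, h, h'⟩
        · rintro (⟨hl, h1, h2⟩ | ⟨hl, h1, h2⟩)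
          · exact ⟨hl, h1.anti Set.sdiff_subset, h2.anti Set.sdiff_subset⟩
          · have hsub : (T \ {q 0}) \ {q m} ⊆ T \ {q m} := Set.sdiff_subset_sdiff_left Set.sdiff_subset
            exact ⟨hl, h1.anti hsub, h2.anti hsub⟩
      · rw [Finset.disjoint_left]
        intro l h1 h2
        simp only [Finset.mem_filter, Finset.mem_Ico] at h1 h2
        by_cases hla : l = a
        · exact hAB (l + 1) (by omega) (by omega) h1.2.2 h2.2.2
        · exact hAB l (by omega) (by omega) h1.2.1 h2.2.1
    rw [hsum] at huv'
    obtain ⟨r1, h1⟩ := hu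
    obtain ⟨r2, h2⟩ := hv
    obtain ⟨r3, h3⟩ := huv'
    obtain ⟨r, hr⟩ := hodd
    push_cast at h3
    omega

/-- The Roussel–Rubio lemma for paths indexed by integer intervals. -/
theorem even_or_isExceptional [Finite V] (hG : NoOddHole G) (hGc : NoOddHole Gᶜ)
    (hT : (Gᶜ.induce T).Connected) (hp : IsInducedPath G p a b)
    (hdisj : ∀ i, a ≤ i → i ≤ b → p i ∉ T) (hab : a ≤ b)
    (ha : IsTComplete G T (p a)) (hb : IsTComplete G T (p b)) :
    Even (b - a + consecutiveCount (fun i => IsTComplete G T (p i)) a b) ∨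
      IsExceptional G T p a b := by
  obtain ⟨n, hn⟩ : ∃ n, T.ncard = n := ⟨_, rfl⟩
  induction n using Nat.strong_induction_on generalizing T a b with
  | _ n ih =>
    refine even_or_isExceptional_of_segments hG hGc hp hdisj hab ha hb ?_
    intro i j hi hj hodd hij hci hcj hint
    have hp' := hp.mono hi hj
    have hdisj' : ∀ l, i ≤ l → l ≤ j → p l ∉ T := fun l hl hl' => hdisj l (by omega) (by omega)
    have ih' : ∀ S, S ⊂ T → (Gᶜ.induce S).Connected →
        Even (j - i + consecutiveCount (fun i => IsTComplete G S (p i)) i j) ∨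
          IsExceptional G S p i j := fun S hS hconn =>
      ih _ (hn ▸ Set.ncard_lt_ncard hS) hconn hp'
        (fun l hl hl' h => hdisj' l hl hl' (hS.subset h)) (by omega) (hci.anti hS.subset)
        (hcj.anti hS.subset) rfl
    rcases complete_or_exists_removable_pair hT with hcomp | ⟨u, hu, v, hv, huv, hnadj, hcu, hcv, h⟩
    · refine isExceptional_of_stable hG hp' hdisj' hij hodd hci hcj hint
        (Set.nonempty_coe_sort.1 hT.nonempty) ?_ ?_
      · intro x hx y hy hadj
        exact ((compl_adj _ _ _).1 (hcomp x hx y hy hadj.ne)).2 hadj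
      · rintro S hS ⟨c, hc⟩
        refine ih' S hS (induce_connected_of_descent hc
          (fun w => @ite _ (w = c) (Classical.dec _) 0 1) fun w hw hwc => ⟨c, hc, ?_, ?_⟩)
        · exact hcomp w (hS.subset hw) c (hS.subset hc) hwc
        · simp [hwc]
    · by_contra hne
      have hev : ∀ S, S ⊂ T → (Gᶜ.induce S).Connected →
          Even (j - i + consecutiveCount (fun i => IsTComplete G S (p i)) i j) :=
        fun S hS hconn => (ih' S hS hconn).resolve_right fun h => hne (h.mono hS.subset)
      have hsub : ∀ x ∈ T, T \ {x} ⊂ T := fun x hx =>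
        ⟨Set.sdiff_subset, fun h => (h hx).2 rfl⟩
      have h2 : ∀ (m : ℕ) (q : ℤ → V), IsInducedPath Gᶜ q 0 m → q 0 = u → q m = v → 2 ≤ m := by
        intro m q hq h0 hm
        by_contra! hlt
        interval_cases m
        · exact huv (h0.symm.trans hm)
        · exact hnadj (h0 ▸ hm ▸ (hq 0 1 le_rfl (by simp) (by simp)).2.2 (by simp))
      rcases h with ⟨m, q, hq, h0, hm, hqT, hmeven⟩ | hconn
      · refine hne (isExceptional_of_removable_pair hGc hp' hdisj' hij hodd hci hcj hint hq hqT
          (h2 m q hq h0 hm) ?_ ?_ (Or.inl hmeven))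
        · rw [h0]; exact hev _ (hsub u hu) hcu
        · rw [hm]; exact hev _ (hsub v hv) hcv
      · obtain ⟨m, q, hq, h0, hm, hqT⟩ := exists_isInducedPath_of_induce_connected hT hu hv
        refine hne (isExceptional_of_removable_pair hGc hp' hdisj' hij hodd hci hcj hint hq hqT
          (h2 m q hq h0 hm) ?_ ?_ (Or.inr ?_))
        · rw [h0]; exact hev _ (hsub u hu) hcu
        · rw [hm]; exact hev _ (hsub v hv) hcv
        · rw [h0, hm]; exact hev _ (Set.sdiff_subset.trans_ssubset (hsub u hu)) hconn

end Core

/-- The Roussel–Rubio lemma.  `P` is a chordless path on `n` vertices (hence of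
length `n - 1`), given by an embedding `f` of the path graph; `T` is an
anticonnected set, vertex-disjoint from `P`, and both ends of `P` are
`T`-complete.  The number of `T`-edges of `P` is the number of indices
`i < n - 1` such that both `f i` and `f (i+1)` are `T`-complete. -/
theorem roussel_rubio {V : Type} [Fintype V] (G : SimpleGraph V) (hG : IsBerge G)
    (T : Set V) (hT : Anticonnected G T)
    (n : ℕ) (hn : 1 ≤ n) (f : pathGraph n ↪g G)
    (hdisj : ∀ i : Fin n, (f i : V) ∉ T)
    (hx : IsTComplete G T (f ⟨0, by omega⟩))
    (hy : IsTComplete G T (f ⟨n - 1, by omega⟩)) :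
    (Even (n - 1) ∧
      Even {i : Fin (n - 1) |
        IsTComplete G T (f ⟨i.val, by have := i.isLt; omega⟩) ∧
        IsTComplete G T (f ⟨i.val + 1, by have := i.isLt; omega⟩)}.ncard) ∨
    (Odd (n - 1) ∧
      Odd {i : Fin (n - 1) |
        IsTComplete G T (f ⟨i.val, by have := i.isLt; omega⟩) ∧
        IsTComplete G T (f ⟨i.val + 1, by have := i.isLt; omega⟩)}.ncard) ∨
    (Odd (n - 1) ∧ 3 ≤ n - 1 ∧
      ∃ u ∈ T, ∃ v ∈ T, u ≠ v ∧ ¬ G.Adj u v ∧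
        (∀ i : Fin n, G.Adj u (f i) ↔ (i.val = 0 ∨ i.val = 1 ∨ i.val = n - 1)) ∧
        (∀ i : Fin n, G.Adj v (f i) ↔ (i.val = 0 ∨ i.val = n - 2 ∨ i.val = n - 1))) ∨
    (∃ hn4 : n = 4,
      ∃ (m : ℕ) (hm : 2 ≤ m) (g : pathGraph m ↪g Gᶜ),
        Odd (m - 1) ∧
        (g ⟨0, by omega⟩ : V) = f ⟨1, by omega⟩ ∧
        (g ⟨m - 1, by omega⟩ : V) = f ⟨2, by omega⟩ ∧
        ∀ j : Fin m, j.val ≠ 0 → j.val ≠ m - 1 → (g j : V) ∈ T) := by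
  obtain ⟨p, hpf⟩ : ∃ p : ℤ → V, ∀ i : Fin n, p i.val = f i :=
    ⟨fun i => f ⟨min i.toNat (n - 1), by omega⟩, fun i => congrArg f (Fin.ext (by
      have := i.isLt
      simp only [Int.toNat_natCast]
      omega))⟩
  have hpn : ∀ (k : ℕ) (hk : k < n), p k = f ⟨k, hk⟩ := fun k hk => hpf ⟨k, hk⟩
  have hp : IsInducedPath G p 0 (n - 1 : ℕ) := by
    intro i j hi hij hj
    lift i to ℕ using hi
    lift j to ℕ using by omega
    rw [hpn i (by omega), hpn j (by omega), f.map_adj_iff, pathGraph_adj]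
    refine ⟨fun e => ?_, by simp only; omega⟩
    have := congrArg Fin.val (f.injective e)
    simp only at this
    omega
  have hpT : ∀ i, 0 ≤ i → i ≤ ((n - 1 : ℕ) : ℤ) → p i ∉ T := by
    intro i hi hi'
    lift i to ℕ using hi
    rw [hpn i (by omega)]
    exact hdisj _
  have hcount : {i : Fin (n - 1) |
      IsTComplete G T (f ⟨i.val, by have := i.isLt; omega⟩) ∧
      IsTComplete G T (f ⟨i.val + 1, by have := i.isLt; omega⟩)}.ncard =
        consecutiveCount (fun i => IsTComplete G T (p i)) 0 (n - 1 : ℕ) := by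
    classical
    have hinj : Function.Injective (fun i : Fin (n - 1) => (i.val : ℤ)) :=
      fun i j h => Fin.ext (Int.ofNat_inj.1 h)
    rw [← Set.ncard_image_of_injective _ hinj, consecutiveCount, ← Set.ncard_coe_finset]
    congr 1
    ext z
    simp only [Set.mem_image, Set.mem_ofPred_eq, Finset.coe_filter, Finset.mem_Ico]
    constructor
    · rintro ⟨i, ⟨h1, h2⟩, rfl⟩
      have := i.isLt
      refine ⟨by omega, ?_, ?_⟩
      · rwa [hpn i (by omega)]
      · have h := hpn (i + 1) (by omega)
        push_cast at h
        rwa [h]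
    · rintro ⟨⟨h0, hz⟩, h1, h2⟩
      lift z to ℕ using h0
      refine ⟨⟨z, by omega⟩, ⟨?_, ?_⟩, rfl⟩
      · rwa [hpn z (by omega)] at h1
      · have h := hpn (z + 1) (by omega)
        push_cast at h
        rwa [h] at h2
  have hmain := even_or_isExceptional (fun m h h' => (hG m h h').1) (fun m h h' => (hG m h h').2)
    hT hp hpT (by omega) ((hpn 0 (by omega)).symm ▸ hx) (by rwa [hpn (n - 1) (by omega)])
  rw [hcount]
  rcases hmain with heven | ⟨hodd, h3, hleap | ⟨h4, q, c, d, hq, hcd, hqodd, hqc, hqd, hqT⟩⟩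
  · rw [sub_zero, ← Nat.cast_add, Int.even_coe_nat, Nat.even_add] at heven
    rcases Nat.even_or_odd (n - 1) with h | h
    · exact Or.inl ⟨h, heven.1 h⟩
    · exact Or.inr (Or.inl ⟨h, Nat.not_even_iff_odd.1 fun h' =>
        Nat.not_even_iff_odd.2 h (heven.2 h')⟩)
  · rw [sub_zero, Int.odd_coe_nat] at hodd
    obtain ⟨u, hu, v, hv, huv, hnadj, h⟩ := hleap
    refine Or.inr (Or.inr (Or.inl ⟨hodd, by omega, u, hu, v, hv, huv, hnadj, ?_, ?_⟩))
    · intro i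
      have := i.isLt
      rw [← hpf i, (h i (by omega) (by omega)).1]
      omega
    · intro i
      have := i.isLt
      rw [← hpf i, (h i (by omega) (by omega)).2]
      omega
  · obtain rfl : n = 4 := by omega
    obtain ⟨r, hr⟩ := hqodd
    refine Or.inr (Or.inr (Or.inr ⟨rfl, (d - c + 1).toNat, by omega,
      ⟨⟨fun j => q (c + j.val), fun i j hij => ?_⟩, ?_⟩, ⟨r.toNat, by omega⟩, ?_, ?_, ?_⟩))
    · have := i.isLt
      have := j.isLt
      by_contra hne
      exact hq.ne (by omega) (by omega) (by omega) (by omega)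
        (fun e => hne (Fin.ext (by omega))) hij
    · intro i j
      have := i.isLt
      have := j.isLt
      change Gᶜ.Adj (q (c + i.val)) (q (c + j.val)) ↔ _
      rw [hq.adj_iff (by omega) (by omega) (by omega) (by omega), pathGraph_adj]
      omega
    · change q (c + (0 : ℕ)) = _
      rw [← hpf ⟨1, by omega⟩]
      simpa using hqc
    · change q (c + ((d - c + 1).toNat - 1 : ℕ)) = _
      rw [← hpf ⟨2, by omega⟩, show c + (((d - c + 1).toNat - 1 : ℕ) : ℤ) = d by omega, hqd]
      rfl
    · intro j hj hj'
      have := j.isLt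
      exact hqT _ (by omega) (by omega)
end

section
/- Let T be an anticonnected set of vertices in a Berge graph G, and let P be a chordless path of odd length at least 3, vertex-disjoint from T, whose two ends are T-complete and none of whose internal vertices is T-complete. Then every T-complete vertex of G has a neighbour among the internal vertices of P. -/
open SimpleGraph

/-- The vertices `q 0, …, q m` form an induced path of length `m` in `K`. -/
structure IsInducedPath_s8 {V : Type} (K : SimpleGraph V) (q : ℕ → V) (m : ℕ) : Prop where
  inj : ∀ i ≤ m, ∀ j ≤ m, q i = q j → i = j
  adj : ∀ i ≤ m, ∀ j ≤ m, (K.Adj (q i) (q j) ↔ i + 1 = j ∨ j + 1 = i)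

/-- `K` contains no odd hole. -/
def HasNoOddHole {V : Type} (K : SimpleGraph V) : Prop :=
  ∀ n : ℕ, 5 ≤ n → Odd n → ¬ HasHoleOfLength K n

/-- The sequence `w, q 0, q 1, …`. -/
def consSeq {V : Type} (w : V) (q : ℕ → V) : ℕ → V
  | 0 => w
  | i + 1 => q i

/-- `S` is nonempty and induces a connected subgraph of `K`, expressed through cuts. -/
def CutConnected {V : Type} (K : SimpleGraph V) (S : Finset V) : Prop :=
  S.Nonempty ∧ ∀ W ⊆ S, W.Nonempty → W ≠ S → ∃ w ∈ W, ∃ y ∈ S, y ∉ W ∧ K.Adj w y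

section InducedPath

variable {V : Type} {K : SimpleGraph V} {q : ℕ → V} {m : ℕ}

theorem IsInducedPath_s8.segment (h : IsInducedPath_s8 K q m) {a l : ℕ} (hal : a + l ≤ m) :
    IsInducedPath_s8 K (fun i => q (a + i)) l where
  inj i hi j hj hij := by
    have := h.inj (a + i) (by omega) (a + j) (by omega) hij
    omega
  adj i hi j hj := by
    have := h.adj (a + i) (by omega) (a + j) (by omega)
    rw [this]
    omega

theorem IsInducedPath_s8.cons (h : IsInducedPath_s8 K q m) {w : V} (hne : ∀ i ≤ m, w ≠ q i)
    (hadj : ∀ i ≤ m, (K.Adj w (q i) ↔ i = 0)) : IsInducedPath_s8 K (consSeq w q) (m + 1) where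
  inj i hi j hj hij := by
    rcases i with _ | i <;> rcases j with _ | j
    · rfl
    · exact absurd hij (hne j (by omega))
    · exact absurd hij.symm (hne i (by omega))
    · rw [h.inj i (by omega) j (by omega) hij]
  adj i hi j hj := by
    rcases i with _ | i <;> rcases j with _ | j
    · simp [consSeq]
    · refine (hadj j (by omega)).trans ?_
      omega
    · refine (K.adj_comm _ _).trans ((hadj i (by omega)).trans ?_)
      omega
    · have := h.adj i (by omega) j (by omega)
      simp only [consSeq, this]
      omega

/-- In a graph without odd holes, an induced path of odd length at least `3` cannot be closed to a
hole by a single vertex. -/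
theorem IsInducedPath_s8.false_of_close (hK : HasNoOddHole K) (h : IsInducedPath_s8 K q m) (hm : 3 ≤ m)
    (hodd : Odd m) {w : V} (hw : ∀ i ≤ m, (K.Adj w (q i) ↔ i = 0 ∨ i = m)) : False := by
  have hne : ∀ i ≤ m, w ≠ q i := by
    intro i hi hwi
    have h0 := (hw 0 (by omega)).2 (Or.inl rfl)
    have h1 := (hw m le_rfl).2 (Or.inr rfl)
    rw [hwi, h.adj i hi _ (by omega)] at h0 h1
    omega
  refine hK (m + 2) (by omega) (by rcases hodd with ⟨k, hk⟩; exact ⟨k + 1, by omega⟩) ⟨?_⟩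
  refine ⟨⟨fun i => consSeq w q i.val, ?_⟩, ?_⟩
  · rintro ⟨i, hi⟩ ⟨j, hj⟩ hij
    simp only [Fin.mk.injEq]
    rcases i with _ | i <;> rcases j with _ | j
    · rfl
    · exact absurd hij (hne j (by omega))
    · exact absurd hij.symm (hne i (by omega))
    · rw [h.inj i (by omega) j (by omega) hij]
  · rintro ⟨i, hi⟩ ⟨j, hj⟩
    have hcyc : (cycleGraph (m + 2)).Adj ⟨i, hi⟩ ⟨j, hj⟩ ↔
        i + 1 = j ∨ j + 1 = i ∨ (i = 0 ∧ j = m + 1) ∨ (j = 0 ∧ i = m + 1) := by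
      have hval : ∀ a b : Fin (m + 2), (a - b).val = if b.val ≤ a.val then a.val - b.val
          else m + 2 + a.val - b.val := by
        intro a b
        split_ifs with hab
        · exact Fin.coe_sub_iff_le.2 hab
        · exact Fin.coe_sub_iff_lt.2 (not_le.1 hab)
      rw [cycleGraph_adj', hval, hval]
      dsimp only
      split_ifs <;> omega
    rw [hcyc]
    change K.Adj (consSeq w q i) (consSeq w q j) ↔ _
    rcases i with _ | i <;> rcases j with _ | j
    · simp [consSeq]
    · refine (hw j (by omega)).trans ?_
      omega
    · refine (K.adj_comm _ _).trans ((hw i (by omega)).trans ?_)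
      omega
    · have := h.adj i (by omega) j (by omega)
      simp only [consSeq, this]
      omega

end InducedPath

section Connected

open scoped Classical

variable {V : Type} {K : SimpleGraph V} {S T : Finset V}

theorem cutConnected_of_connected_induce (h : (K.induce (S : Set V)).Connected) :
    CutConnected K S := by
  obtain ⟨s, hs⟩ := h.nonempty
  refine ⟨⟨s, hs⟩, fun W hWS ⟨w, hw⟩ hne => ?_⟩
  obtain ⟨y, hy, hyW⟩ := Finset.exists_of_ssubset (hWS.ssubset_of_ne hne)
  obtain ⟨p⟩ := h.preconnected ⟨w, hWS hw⟩ ⟨y, hy⟩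
  obtain ⟨d, -, hd1, hd2⟩ := p.exists_boundary_dart {z | z.val ∈ W} hw hyW
  exact ⟨d.fst, hd1, d.snd, d.snd.2, hd2, d.adj⟩

theorem cutConnected_singleton (r : V) : CutConnected K {r} := by
  refine ⟨⟨r, by simp⟩, fun W hW hne h => ?_⟩
  rcases Finset.subset_singleton_iff.1 hW with rfl | rfl
  · simp at hne
  · exact absurd rfl h

theorem CutConnected.insert_of_adj (h : CutConnected K S) {w s : V} (hs : s ∈ S) (hws : K.Adj w s) :
    CutConnected K (insert w S) := by
  refine ⟨⟨w, by simp⟩, fun W hW hne hWne => ?_⟩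
  by_cases hw : w ∈ S
  · rw [Finset.insert_eq_self.2 hw] at *
    exact h.2 W hW hne hWne
  by_cases hsub : W ∩ S = S
  · have hSW : S ⊆ W := Finset.inter_eq_right.1 hsub
    have hwW : w ∉ W := fun hwW => hWne (hW.antisymm (Finset.insert_subset hwW hSW))
    exact ⟨s, hSW hs, w, by simp, hwW, hws.symm⟩
  by_cases hemp : (W ∩ S).Nonempty
  · obtain ⟨a, ha, b, hb, hbW, hab⟩ := h.2 (W ∩ S) Finset.inter_subset_right hemp hsub
    simp only [Finset.mem_inter] at ha hbW
    exact ⟨a, ha.1, b, by simp [hb], fun hh => hbW ⟨hh, hb⟩, hab⟩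
  · have hWw : ∀ z ∈ W, z = w := by
      intro z hz
      rcases Finset.mem_insert.1 (hW hz) with rfl | hzS
      · rfl
      · exact absurd ⟨z, Finset.mem_inter.2 ⟨hz, hzS⟩⟩ hemp
    obtain ⟨z, hz⟩ := hne
    have hzw := hWw z hz
    subst hzw
    exact ⟨z, hz, s, by simp [hs], fun hsW => hw (hWw s hsW ▸ hs), hws⟩

theorem cutConnected_of_universal {r : V} (hr : r ∈ S) (h : ∀ s ∈ S, s ≠ r → K.Adj r s) :
    CutConnected K S := by
  refine ⟨⟨r, hr⟩, fun W hW ⟨w, hw⟩ hne => ?_⟩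
  obtain ⟨y, hy, hyW⟩ := Finset.exists_of_ssubset (hW.ssubset_of_ne hne)
  by_cases hrW : r ∈ W
  · exact ⟨r, hrW, y, hy, hyW, h y hy (fun e => hyW (e ▸ hrW))⟩
  · exact ⟨w, hw, r, hr, hrW, (h w (hW hw) (fun e => hrW (e ▸ hw))).symm⟩

/-- A connected proper subset of a connected set avoids some non-cut vertex of the larger set. -/
theorem CutConnected.exists_erase {W : Finset V} (hS : CutConnected K S) (hW : CutConnected K W)
    (hWS : W ⊆ S) (hne : W ≠ S) : ∃ y ∈ S, y ∉ W ∧ CutConnected K (S.erase y) := by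
  induction hc : (S \ W).card using Nat.strong_induction_on generalizing W with
  | _ c ih =>
    obtain ⟨w, hw, y, hy, hyW, hwy⟩ := hS.2 W hWS hW.1 hne
    by_cases heq : insert y W = S
    · exact ⟨y, hy, hyW, by rwa [← heq, Finset.erase_insert hyW]⟩
    · have hlt : (S \ insert y W).card < c := by
        rw [← hc]
        refine Finset.card_lt_card ⟨?_, fun hh => ?_⟩
        · exact Finset.sdiff_subset_sdiff le_rfl (Finset.subset_insert _ _)
        · have := hh (Finset.mem_sdiff.2 ⟨hy, hyW⟩)
          simp at this
      obtain ⟨z, hz, hzW, hz'⟩ := ih _ hlt (hW.insert_of_adj hw hwy.symm)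
        (Finset.insert_subset hy hWS) heq rfl
      exact ⟨z, hz, fun h => hzW (Finset.mem_insert_of_mem h), hz'⟩

theorem CutConnected.exists_erase_not_adj (hS : CutConnected K S) {r u : V} (hr : r ∈ S)
    (hu : u ∈ S) (hur : u ≠ r) (hadj : ¬ K.Adj r u) :
    ∃ y ∈ S, y ≠ r ∧ ¬ K.Adj r y ∧ CutConnected K (S.erase y) := by
  obtain ⟨y, hy, hyW, hy'⟩ := hS.exists_erase (W := S.filter fun s => s = r ∨ K.Adj r s)
    (cutConnected_of_universal (r := r) (by simp [hr])
      (fun s hs hsr => (Finset.mem_filter.1 hs).2.resolve_left hsr))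
    (Finset.filter_subset _ _)
    (fun h => by
      rw [← h] at hu
      exact (Finset.mem_filter.1 hu).2.elim hur hadj)
  have : ¬ (y = r ∨ K.Adj r y) := fun h => hyW (Finset.mem_filter.2 ⟨hy, h⟩)
  exact ⟨y, hy, fun h => this (Or.inl h), fun h => this (Or.inr h), hy'⟩

theorem CutConnected.exists_adj (hS : CutConnected K S) {r u : V} (hr : r ∈ S)
    (hu : u ∈ S) (hur : u ≠ r) : ∃ s ∈ S, K.Adj r s := by
  obtain ⟨w, hw, y, hy, -, hwy⟩ := hS.2 {r} (by simpa using hr) ⟨r, by simp⟩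
    (fun h => by rw [← h] at hu; exact hur (by simpa using hu))
  rw [Finset.mem_singleton.1 hw] at hwy
  exact ⟨y, hy, hwy⟩

/-- A connected non-complete graph has two non-adjacent non-cut vertices which have a common
neighbour or can be removed simultaneously. -/
theorem CutConnected.exists_pair (hT : CutConnected K T) {u w : V} (hu : u ∈ T) (hw : w ∈ T)
    (huw : w ≠ u) (hadj : ¬ K.Adj u w) :
    ∃ x ∈ T, ∃ y ∈ T, x ≠ y ∧ ¬ K.Adj x y ∧ CutConnected K (T.erase x) ∧
      CutConnected K (T.erase y) ∧
      (CutConnected K ((T.erase x).erase y) ∨ ∃ z ∈ T, K.Adj x z ∧ K.Adj z y) := by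
  obtain ⟨x, hx, hxu, hux, hTx⟩ := hT.exists_erase_not_adj hu hw huw hadj
  have huT' : u ∈ T.erase x := Finset.mem_erase.2 ⟨hxu.symm, hu⟩
  have hback : ∀ y, CutConnected K ((T.erase x).erase y) → ∀ s ∈ T, K.Adj x s → s ≠ y →
      x ≠ y → CutConnected K (T.erase y) := by
    intro y hy s hs hxs hsy hxy
    have := hy.insert_of_adj (w := x) (s := s)
      (Finset.mem_erase.2 ⟨hsy, Finset.mem_erase.2 ⟨hxs.ne', hs⟩⟩) hxs
    rwa [Finset.erase_right_comm, Finset.insert_erase (Finset.mem_erase.2 ⟨hxy, hx⟩)] at this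
  obtain ⟨s, hs, hxs⟩ := hT.exists_adj hx hu hxu.symm
  have hsT' : s ∈ T.erase x := Finset.mem_erase.2 ⟨hxs.ne', hs⟩
  have hsu : s ≠ u := fun h => hux (h ▸ hxs).symm
  obtain ⟨y, hyT', hyu, hy⟩ := hTx.exists_erase (cutConnected_singleton u)
    (by simpa using huT') (fun h => by rw [← h] at hsT'; exact hsu (by simpa using hsT'))
  obtain ⟨hyx, hyT⟩ := Finset.mem_erase.1 hyT'
  by_cases hxy : K.Adj x y
  swap
  · exact ⟨x, hx, y, hyT, hyx.symm, hxy, hTx,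
      hback y hy s hs hxs (fun h => hxy (h ▸ hxs)) hyx.symm, Or.inl hy⟩
  by_cases huniv : ∀ z ∈ T.erase x, z ≠ y → K.Adj y z
  · have hyu' : u ≠ y := fun h => hux (h ▸ hxy).symm
    refine ⟨x, hx, u, hu, hxu, fun h => hux h.symm, hTx, ?_, Or.inr ⟨y, hyT, hxy, ?_⟩⟩
    · refine cutConnected_of_universal (r := y) (Finset.mem_erase.2 ⟨hyu'.symm, hyT⟩) ?_
      intro z hz hzy
      by_cases hzx : z = x
      · rw [hzx]; exact hxy.symm
      · exact huniv z (Finset.mem_erase.2 ⟨hzx, Finset.mem_of_mem_erase hz⟩) hzy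
    · exact huniv u huT' hyu'
  · push Not at huniv
    obtain ⟨z₀, hz₀, hz₀y, hyz₀⟩ := huniv
    obtain ⟨z, hzT', hzy, hyz, hz⟩ := hTx.exists_erase_not_adj hyT' hz₀ hz₀y hyz₀
    obtain ⟨hzx, hzT⟩ := Finset.mem_erase.1 hzT'
    by_cases hxz : K.Adj x z
    · exact ⟨y, hyT, z, hzT, hzy.symm, hyz, hback y hy z hzT hxz hzy hyx.symm,
        hback z hz y hyT hxy hzy.symm hzx.symm, Or.inr ⟨x, hx, hxy.symm, hxz⟩⟩
    · exact ⟨x, hx, z, hzT, hzx.symm, hxz, hTx,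
        hback z hz y hyT hxy hzy.symm hzx.symm, Or.inl hz⟩

theorem CutConnected.exists_inducedPath (hS : CutConnected K S) {x y : V} (hx : x ∈ S)
    (hy : y ∈ S) : ∃ (q : ℕ → V) (k : ℕ), IsInducedPath_s8 K q k ∧ q 0 = x ∧ q k = y ∧
      ∀ i ≤ k, q i ∈ S := by
  let W := S.filter fun z => ∃ (q : ℕ → V) (k : ℕ), IsInducedPath_s8 K q k ∧ q 0 = z ∧ q k = y ∧
      ∀ i ≤ k, q i ∈ S
  have hWS : W ⊆ S := Finset.filter_subset _ _
  have hyW : y ∈ W := Finset.mem_filter.2 ⟨hy, fun _ => y, 0,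
    ⟨fun i hi j hj _ => by omega, fun i hi j hj => by simp; omega⟩, rfl, rfl, fun _ _ => hy⟩
  suffices hW : W = S by
    rw [← hW] at hx
    exact (Finset.mem_filter.1 hx).2
  by_contra hne
  obtain ⟨w, hw, z, hz, hzW, hwz⟩ := hS.2 W hWS ⟨y, hyW⟩ hne
  obtain ⟨q, k, hq, hq0, hqk, hqS⟩ := (Finset.mem_filter.1 hw).2
  refine hzW (Finset.mem_filter.2 ⟨hz, ?_⟩)
  by_cases hmem : ∃ i ≤ k, z = q i
  · obtain ⟨i, hi, rfl⟩ := hmem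
    refine ⟨fun j => q (i + j), k - i, hq.segment (by omega), rfl, ?_, fun j hj => hqS _ (by omega)⟩
    simp only [Nat.add_sub_cancel' hi, hqk]
  push Not at hmem
  let i := Nat.findGreatest (fun i => K.Adj z (q i)) k
  have hik : i ≤ k := Nat.findGreatest_le k
  have hi : K.Adj z (q i) := Nat.findGreatest_spec (P := fun i => K.Adj z (q i)) (Nat.zero_le k)
    (by rw [hq0]; exact hwz.symm)
  have hlast : ∀ j, i < j → j ≤ k → ¬ K.Adj z (q j) := fun j hj hjk =>
    Nat.findGreatest_is_greatest hj hjk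
  refine ⟨consSeq z fun j => q (i + j), k - i + 1,
    (hq.segment (by omega)).cons (fun j hj => hmem _ (by omega)) (fun j hj => ?_), rfl, ?_, ?_⟩
  · constructor
    · intro h
      by_contra hj0
      exact hlast (i + j) (by omega) (by omega) h
    · rintro rfl
      exact hi
  · simp only [consSeq, Nat.add_sub_cancel' hik, hqk]
  · rintro (_ | j) hj
    · exact hz
    · exact hqS _ (by omega)

end Connected

section Parity

/-- If an odd gap between consecutive marked positions only occurs as a single step, and this step
then lies in `E`, the steps in `E` have the same parity as the length of the interval. -/
theorem card_filter_Ico_mod_two {M E : ℕ → Prop} [DecidablePred E] {m : ℕ}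
    (hE : ∀ k, E k → M k ∧ M (k + 1))
    (h : ∀ i j, i < j → j ≤ m → M i → M j → (∀ k, i < k → k < j → ¬ M k) → Odd (j - i) →
      j = i + 1 ∧ E i)
    {i j : ℕ} (hij : i ≤ j) (hj : j ≤ m) (hMi : M i) (hMj : M j) :
    ((Finset.Ico i j).filter E).card % 2 = (j - i) % 2 := by
  induction hc : j - i using Nat.strong_induction_on generalizing i j with
  | _ c ih =>
    subst hc
    rcases hij.eq_or_lt with rfl | hlt
    · simp
    by_cases hk : ∃ k, i < k ∧ k < j ∧ M k
    · obtain ⟨k, hik, hkj, hMk⟩ := hk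
      have h1 := ih (k - i) (by omega) hik.le (by omega) hMi hMk rfl
      have h2 := ih (j - k) (by omega) hkj.le hj hMk hMj rfl
      rw [Finset.card_filter] at h1 h2 ⊢
      rw [← Finset.sum_Ico_consecutive _ hik.le hkj.le]
      omega
    · push Not at hk
      rcases Nat.even_or_odd (j - i) with hev | hodd
      · have : (Finset.Ico i j).filter E = ∅ := by
          refine Finset.filter_eq_empty_iff.2 fun k hk' hEk => ?_
          obtain ⟨hik, hkj⟩ := Finset.mem_Ico.1 hk'
          rcases hik.eq_or_lt with rfl | hik
          · have : i + 1 < j := by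
              rcases hev with ⟨a, ha⟩
              omega
            exact hk (i + 1) (by omega) this (hE _ hEk).2
          · exact hk k hik hkj (hE _ hEk).1
        rw [this, Finset.card_empty, Nat.even_iff.1 hev]
      · obtain ⟨rfl, hEi⟩ := h i j hlt hj hMi hMj hk hodd
        simp [Finset.filter_singleton, hEi]

end Parity

section RousselRubio

open scoped Classical

variable {V : Type} {G : SimpleGraph V} {p : ℕ → V} {m : ℕ} {v : V} {S T : Finset V}

/-- `w` is adjacent to all vertices of `S`. -/
def IsCompleteTo (G : SimpleGraph V) (S : Finset V) (w : V) : Prop := ∀ t ∈ S, G.Adj w t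

/-- The number of edges of the path `p 0, …, p m` both of whose ends are complete to `S`. -/
noncomputable def numCompleteEdges (G : SimpleGraph V) (S : Finset V) (p : ℕ → V) (m : ℕ) : ℕ :=
  ((Finset.range m).filter fun k => IsCompleteTo G S (p k) ∧ IsCompleteTo G S (p (k + 1))).card

theorem exists_completeEdge (h : Odd (numCompleteEdges G S p m)) :
    ∃ k < m, IsCompleteTo G S (p k) ∧ IsCompleteTo G S (p (k + 1)) := by
  obtain ⟨k, hk⟩ := Finset.card_pos.1 h.pos
  obtain ⟨hk, hk'⟩ := Finset.mem_filter.1 hk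
  exact ⟨k, Finset.mem_range.1 hk, hk'⟩

theorem IsCompleteTo.not_compl_adj {w t : V} (h : IsCompleteTo G S w) (ht : t ∈ S) :
    ¬ Gᶜ.Adj w t := fun hh => hh.2 (h t ht)

theorem isCompleteTo_of_erase {x w : V} (h : IsCompleteTo G (T.erase x) w)
    (hx : G.Adj w x) : IsCompleteTo G T w := by
  intro t ht
  by_cases htx : t = x
  · rwa [htx]
  · exact h t (Finset.mem_erase.2 ⟨htx, ht⟩)

/-- A counterexample to the corollary of the Roussel–Rubio lemma: the path `p 0, …, p m`, the
anticonnected set `T`, and the `T`-complete vertex `v` without neighbours inside the path. -/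
structure IsCounterexample (G : SimpleGraph V) (p : ℕ → V) (m : ℕ) (v : V) (T : Finset V) :
    Prop where
  noOddHole : HasNoOddHole G
  noOddAntihole : HasNoOddHole Gᶜ
  path : IsInducedPath_s8 G p m
  three_le : 3 ≤ m
  odd : Odd m
  notMem : ∀ i ≤ m, p i ∉ T
  not_adj : ∀ i, 0 < i → i < m → ¬ G.Adj v (p i)
  complete : IsCompleteTo G T v
  left : IsCompleteTo G T (p 0)
  right : IsCompleteTo G T (p m)
  interior : ∀ i, 0 < i → i < m → ¬ IsCompleteTo G T (p i)
  anticonnected : CutConnected Gᶜ T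

namespace IsCounterexample

theorem compl_adj (h : IsCounterexample G p m v T) {i : ℕ} (hi : 0 < i) (him : i < m) :
    Gᶜ.Adj v (p i) := by
  refine ⟨fun hvi => ?_, h.not_adj i hi him⟩
  have h3 := h.three_le
  by_cases hi1 : i = 1
  · refine h.not_adj 2 (by omega) (by omega) ?_
    rw [hvi, h.path.adj _ (by omega) _ (by omega)]
    omega
  · refine h.not_adj (i - 1) (by omega) (by omega) ?_
    rw [hvi, h.path.adj _ (by omega) _ (by omega)]
    omega

theorem path_compl_adj (h : IsCounterexample G p m v T) {i j : ℕ} (hi : i ≤ m) (hj : j ≤ m) :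
    Gᶜ.Adj (p i) (p j) ↔ i ≠ j ∧ i + 1 ≠ j ∧ j + 1 ≠ i := by
  rw [SimpleGraph.compl_adj, h.path.adj i hi j hj]
  have : p i ≠ p j ↔ i ≠ j := not_congr ⟨h.path.inj i hi j hj, fun e => e ▸ rfl⟩
  rw [this]
  omega

theorem numCompleteEdges_eq_zero (h : IsCounterexample G p m v T) :
    numCompleteEdges G T p m = 0 := by
  have h3 := h.three_le
  refine Finset.card_eq_zero.2 (Finset.filter_eq_empty_iff.2 fun k hk ⟨h1, h2⟩ => ?_)
  have hkm := Finset.mem_range.1 hk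
  by_cases hk0 : k = 0
  · exact h.interior (k + 1) (by omega) (by omega) h2
  · exact h.interior k (by omega) hkm h1

theorem interior_of_not_complete (h : IsCounterexample G p m v T) {i : ℕ} (him : i ≤ m)
    (hi : ¬ IsCompleteTo G T (p i)) : 0 < i ∧ i < m := by
  constructor
  · refine Nat.pos_of_ne_zero ?_
    rintro rfl
    exact hi h.left
  · refine lt_of_le_of_ne him ?_
    rintro rfl
    exact hi h.right

theorem exists_compl_adj (h : IsCounterexample G p m v T) {i : ℕ} (hi : 0 < i) (him : i < m) :
    ∃ t ∈ T, Gᶜ.Adj (p i) t := by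
  have := h.interior i hi him
  unfold IsCompleteTo at this
  push Not at this
  obtain ⟨t, ht, hadj⟩ := this
  exact ⟨t, ht, fun e => h.notMem i him.le (e ▸ ht), hadj⟩

theorem ne_three (h : IsCounterexample G p m v T) : m ≠ 3 := by
  rintro rfl
  obtain ⟨t₁, ht₁, hadj₁⟩ := h.exists_compl_adj (i := 1) (by omega) (by omega)
  obtain ⟨t₂, ht₂, hadj₂⟩ := h.exists_compl_adj (i := 2) (by omega) (by omega)
  have hS : CutConnected Gᶜ (insert (p 1) (insert (p 2) T)) :=
    (h.anticonnected.insert_of_adj ht₂ hadj₂).insert_of_adj (Finset.mem_insert_of_mem ht₁) hadj₁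
  obtain ⟨q, k, hq, hq0, hqk, hqS⟩ := hS.exists_inducedPath (x := p 1) (y := p 2) (by simp)
    (by simp)
  have hk0 : k ≠ 0 := by
    rintro rfl
    have := h.path.inj 1 (by omega) 2 (by omega) (hq0.symm.trans hqk)
    omega
  have hk1 : k ≠ 1 := by
    rintro rfl
    have := (hq.adj 0 (by omega) 1 (by omega)).2 (by omega)
    rw [hq0, hqk, h.path_compl_adj (by omega) (by omega)] at this
    omega
  have hqT : ∀ i, 0 < i → i < k → q i ∈ T := by
    intro i hi hik
    rcases Finset.mem_insert.1 (hqS i hik.le) with he | he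
    · have := hq.inj i hik.le 0 (by omega) (he.trans hq0.symm)
      omega
    rcases Finset.mem_insert.1 he with he | he
    · have := hq.inj i hik.le k le_rfl (he.trans hqk.symm)
      omega
    · exact he
  rcases Nat.even_or_odd k with hev | hodd
  · have hcons : IsInducedPath_s8 Gᶜ (consSeq (p 3) q) (k + 1) := by
      have hadj : ∀ i ≤ k, (Gᶜ.Adj (p 3) (q i) ↔ i = 0) := by
        intro i hi
        by_cases hi0 : i = 0
        · rw [hi0, hq0, h.path_compl_adj (by omega) (by omega)]
          omega
        by_cases hik : i = k
        · rw [hik, hqk, h.path_compl_adj (by omega) (by omega)]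
          omega
        · exact iff_of_false (h.right.not_compl_adj (hqT i (by omega) (by omega))) hi0
      refine hq.cons (fun i hi he => ?_) hadj
      by_cases hi0 : i = 0
      · rw [hi0, hq0] at he
        have := h.path.inj 3 (by omega) 1 (by omega) he
        omega
      by_cases hik : i = k
      · rw [hik, hqk] at he
        have := h.path.inj 3 (by omega) 2 (by omega) he
        omega
      · exact h.notMem 3 (by omega) (he ▸ hqT i (by omega) (by omega))
    refine hcons.false_of_close h.noOddAntihole (by omega) hev.add_one (w := p 0) ?_
    rintro (_ | i) hi
    · change Gᶜ.Adj (p 0) (p 3) ↔ _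
      rw [h.path_compl_adj (by omega) (by omega)]
      omega
    · change Gᶜ.Adj (p 0) (q i) ↔ _
      by_cases hi0 : i = 0
      · rw [hi0, hq0, h.path_compl_adj (by omega) (by omega)]
        omega
      by_cases hik : i = k
      · rw [hik, hqk, h.path_compl_adj (by omega) (by omega)]
        omega
      · exact iff_of_false (h.left.not_compl_adj (hqT i (by omega) (by omega))) (by omega)
  · have hk3 : 3 ≤ k := by
      rcases hodd with ⟨a, ha⟩
      omega
    refine hq.false_of_close h.noOddAntihole hk3 hodd (w := v) fun i hi => ?_
    by_cases hi0 : i = 0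
    · rw [hi0, hq0]
      exact iff_of_true (h.compl_adj (by omega) (by omega)) (by omega)
    by_cases hik : i = k
    · rw [hik, hqk]
      exact iff_of_true (h.compl_adj (by omega) (by omega)) (by omega)
    · exact iff_of_false (h.complete.not_compl_adj (hqT i (by omega) (by omega))) (by omega)

/-- If `T` is stable, a segment of odd length between consecutive vertices of the path with a
neighbour in `T` is an edge whose ends have a common neighbour in `T`. -/
theorem segment_of_stable (h : IsCounterexample G p m v T)
    (hT : ∀ x ∈ T, ∀ y ∈ T, x ≠ y → ¬ G.Adj x y) {i j : ℕ} (hij : i < j) (hj : j ≤ m)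
    (hi' : ∃ t ∈ T, G.Adj (p i) t) (hj' : ∃ t ∈ T, G.Adj (p j) t)
    (hint : ∀ k, i < k → k < j → ¬ ∃ t ∈ T, G.Adj (p k) t) (hodd : Odd (j - i)) :
    j = i + 1 ∧ ∃ t ∈ T, G.Adj (p i) t ∧ G.Adj (p (i + 1)) t := by
  obtain ⟨a, ha⟩ := hodd
  have hseg : IsInducedPath_s8 G (fun k => p (i + k)) (j - i) := h.path.segment (by omega)
  by_cases hcom : ∃ t ∈ T, G.Adj (p i) t ∧ G.Adj (p j) t
  · obtain ⟨t, ht, hti, htj⟩ := hcom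
    by_cases hji : j = i + 1
    · exact ⟨hji, t, ht, hti, hji ▸ htj⟩
    refine (hseg.false_of_close h.noOddHole (by omega) ⟨a, ha⟩ (w := t) fun k hk => ?_).elim
    by_cases hk0 : k = 0
    · rw [hk0]
      exact iff_of_true hti.symm (by omega)
    by_cases hkj : k = j - i
    · refine iff_of_true ?_ (by omega)
      rw [hkj, Nat.add_sub_cancel' hij.le]
      exact htj.symm
    · refine iff_of_false (fun hadj => ?_) (by omega)
      exact hint (i + k) (by omega) (by omega) ⟨t, ht, hadj.symm⟩
  · push Not at hcom
    obtain ⟨y, hy, hyi⟩ := hi'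
    obtain ⟨x, hx, hxj⟩ := hj'
    have hyj := hcom y hy hyi
    have hxi : ¬ G.Adj (p i) x := fun hh => hcom x hx hh hxj
    have hi0 : 0 < i := Nat.pos_of_ne_zero fun hi0 => hxi (by rw [hi0]; exact h.left x hx)
    have hjm : j < m := lt_of_le_of_ne hj fun hjm => hyj (by rw [hjm]; exact h.right y hy)
    have hxy : x ≠ y := fun e => hxi (e ▸ hyi)
    have hcons : IsInducedPath_s8 G (consSeq y fun k => p (i + k)) (j - i + 1) := by
      refine hseg.cons (fun k hk he => h.notMem (i + k) (by omega) (he ▸ hy)) fun k hk => ?_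
      by_cases hk0 : k = 0
      · rw [hk0]
        exact iff_of_true hyi.symm rfl
      refine iff_of_false (fun hadj => ?_) hk0
      by_cases hkj : k = j - i
      · rw [hkj, Nat.add_sub_cancel' hij.le] at hadj
        exact hyj hadj.symm
      · exact hint (i + k) (by omega) (by omega) ⟨y, hy, hadj.symm⟩
    have hcons' : IsInducedPath_s8 G (consSeq v (consSeq y fun k => p (i + k))) (j - i + 1 + 1) := by
      refine hcons.cons ?_ ?_
      · rintro (_ | k) hk
        · exact (h.complete y hy).ne
        · exact (h.compl_adj (i := i + k) (by omega) (by omega)).ne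
      · rintro (_ | k) hk
        · exact iff_of_true (h.complete y hy) rfl
        · exact iff_of_false (h.not_adj (i + k) (by omega) (by omega)) (by omega)
    refine (hcons'.false_of_close h.noOddHole (by omega) ⟨a + 1, by omega⟩ (w := x) ?_).elim
    rintro (_ | _ | k) hk
    · exact iff_of_true (h.complete x hx).symm (by omega)
    · exact iff_of_false (hT x hx y hy hxy) (by omega)
    · change G.Adj x (p (i + k)) ↔ _
      by_cases hkj : k = j - i
      · rw [hkj, Nat.add_sub_cancel' hij.le]
        exact iff_of_true hxj.symm (by omega)
      refine iff_of_false (fun hadj => ?_) (by omega)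
      by_cases hk0 : k = 0
      · rw [hk0] at hadj
        exact hxi hadj.symm
      · exact hint (i + k) (by omega) (by omega) ⟨x, hx, hadj.symm⟩

theorem exists_adj (h : IsCounterexample G p m v T)
    (ih : ∀ S ⊂ T, CutConnected Gᶜ S → Odd (numCompleteEdges G S p m)) :
    ∃ x ∈ T, ∃ y ∈ T, x ≠ y ∧ G.Adj x y := by
  by_contra hcon
  push Not at hcon
  let τ : ℕ → Finset V := fun k => T.filter fun t => G.Adj (p k) t ∧ G.Adj (p (k + 1)) t
  have hcov := card_filter_Ico_mod_two (M := fun k => ∃ t ∈ T, G.Adj (p k) t)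
    (E := fun k => ∃ t ∈ T, G.Adj (p k) t ∧ G.Adj (p (k + 1)) t) (m := m)
    (fun k ⟨t, ht, h1, h2⟩ => ⟨⟨t, ht, h1⟩, ⟨t, ht, h2⟩⟩)
    (fun i j hij hj hi' hj' hint hodd => h.segment_of_stable hcon hij hj hi' hj' hint hodd)
    (Nat.zero_le m) le_rfl
    (h.anticonnected.1.imp fun t ht => ⟨ht, h.left t ht⟩)
    (h.anticonnected.1.imp fun t ht => ⟨ht, h.right t ht⟩)
  have hnum : ∀ S ∈ T.powerset, numCompleteEdges G S p m =
      ∑ k ∈ Finset.range m, if S ⊆ τ k then 1 else 0 := by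
    intro S hS
    rw [Finset.mem_powerset] at hS
    rw [numCompleteEdges, Finset.card_filter]
    refine Finset.sum_congr rfl fun k _ => if_congr ?_ rfl rfl
    constructor
    · exact fun hh t ht => Finset.mem_filter.2 ⟨hS ht, hh.1 t ht, hh.2 t ht⟩
    · exact fun hh => ⟨fun t ht => (Finset.mem_filter.1 (hh ht)).2.1,
        fun t ht => (Finset.mem_filter.1 (hh ht)).2.2⟩
  have hmod : ∀ S ∈ T.powerset,
      (numCompleteEdges G S p m : ZMod 2) = if S = T then 0 else 1 := by
    intro S hS
    rw [Finset.mem_powerset] at hS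
    split_ifs with hST
    · rw [hST, h.numCompleteEdges_eq_zero, Nat.cast_zero]
    · rw [ZMod.natCast_eq_one_iff_odd]
      rcases S.eq_empty_or_nonempty with rfl | ⟨r, hr⟩
      · simpa [numCompleteEdges, IsCompleteTo] using h.odd
      · refine ih S (hS.ssubset_of_ne hST) (cutConnected_of_universal hr fun s hs hsr => ?_)
        exact ⟨hsr.symm, hcon r (hS hr) s (hS hs) hsr.symm⟩
  have hpow : ∀ k, ∑ S ∈ T.powerset, (if S ⊆ τ k then 1 else 0) = 2 ^ (τ k).card := by
    intro k
    rw [← Finset.card_filter, ← Finset.card_powerset]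
    congr 1
    ext S
    simp only [Finset.mem_filter, Finset.mem_powerset]
    exact ⟨fun hh => hh.2, fun hh => ⟨hh.trans (Finset.filter_subset _ _), hh⟩⟩
  have hsum : (∑ S ∈ T.powerset, numCompleteEdges G S p m) =
      ∑ k ∈ Finset.range m, 2 ^ (τ k).card := by
    rw [Finset.sum_congr rfl hnum, Finset.sum_comm]
    exact Finset.sum_congr rfl fun k _ => hpow k
  have hsum' := congrArg (Nat.cast : ℕ → ZMod 2) hsum
  have htwo : (2 : ZMod 2) = 0 := rfl
  have hleft : ∑ S ∈ T.powerset, (if S = T then (0 : ZMod 2) else 1) = 1 := by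
    have : ∀ S : Finset V, (if S = T then (0 : ZMod 2) else 1) = 1 + if S = T then 1 else 0 := by
      intro S
      split_ifs <;> decide
    rw [Finset.sum_congr rfl fun S _ => this S, Finset.sum_add_distrib, Finset.sum_ite_eq']
    simp [htwo, zero_pow h.anticonnected.1.card_pos.ne']
  have hright : ∀ k, ((2 : ZMod 2) ^ (τ k).card) =
      1 + if ∃ t ∈ T, G.Adj (p k) t ∧ G.Adj (p (k + 1)) t then 1 else 0 := by
    intro k
    rw [htwo]
    split_ifs with hk
    · obtain ⟨t, ht, hk⟩ := hk
      rw [zero_pow (Finset.card_pos.2 ⟨t, Finset.mem_filter.2 ⟨ht, hk⟩⟩).ne']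
      rfl
    · have : τ k = ∅ := Finset.filter_eq_empty_iff.2 fun t ht hh => hk ⟨t, ht, hh⟩
      rw [this]
      simp
  rw [Nat.cast_sum, Nat.cast_sum, Finset.sum_congr rfl hmod, hleft] at hsum'
  simp only [Nat.cast_pow, Nat.cast_ofNat, hright, Finset.sum_add_distrib, Finset.sum_boole,
    Finset.sum_const, Finset.card_range, nsmul_eq_mul, mul_one] at hsum'
  rw [← Finset.range_eq_Ico, Nat.sub_zero] at hcov
  rw [← Nat.cast_add, eq_comm, ZMod.natCast_eq_one_iff_odd, Nat.odd_iff] at hsum'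
  omega

theorem not_adj_of_complete_erase (h : IsCounterexample G p m v T) {a : ℕ} {x : V} (ha : 0 < a)
    (ham : a < m) (hax : IsCompleteTo G (T.erase x) (p a)) : ¬ G.Adj (p a) x :=
  fun hadj => h.interior a ha ham (isCompleteTo_of_erase hax hadj)

section Antipath

variable {q : ℕ → V} {k : ℕ}

theorem antipath_compl_adj_iff (h : IsCounterexample G p m v T) (hq : IsInducedPath_s8 Gᶜ q k)
    (hqT : ∀ i ≤ k, q i ∈ T) {a j : ℕ} (hj : j ≤ k) (ha : 0 < a) (ham : a < m)
    (hax : IsCompleteTo G (T.erase (q j)) (p a)) {i : ℕ} (hi : i ≤ k) :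
    Gᶜ.Adj (p a) (q i) ↔ i = j := by
  constructor
  · intro hadj
    by_contra hij
    exact hadj.2 (hax _ (Finset.mem_erase.2
      ⟨fun e => hij (hq.inj i hi j hj e), hqT i hi⟩))
  · rintro rfl
    exact ⟨fun e => h.notMem a ham.le (e ▸ hqT i hi), h.not_adj_of_complete_erase ha ham hax⟩

theorem antipath_cons (h : IsCounterexample G p m v T) (hq : IsInducedPath_s8 Gᶜ q k)
    (hqT : ∀ i ≤ k, q i ∈ T) {a : ℕ} (ha : 0 < a) (ham : a < m)
    (hax : IsCompleteTo G (T.erase (q 0)) (p a)) :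
    IsInducedPath_s8 Gᶜ (consSeq (p a) q) (k + 1) :=
  hq.cons (fun i hi e => h.notMem a ham.le (e ▸ hqT i hi))
    fun _ hi => h.antipath_compl_adj_iff hq hqT (Nat.zero_le k) ha ham hax hi

/-- Two vertices inside the path, one complete to all of `T` but the first vertex and
the other to all of `T` but the last vertex of an antipath in `T` of
even length, are adjacent. -/
theorem adj_of_even (h : IsCounterexample G p m v T) (hq : IsInducedPath_s8 Gᶜ q k)
    (hqT : ∀ i ≤ k, q i ∈ T) (hk : 2 ≤ k) (hev : Even k) {a b : ℕ} (ha : 0 < a) (ham : a < m)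
    (hb : 0 < b) (hbm : b < m) (hax : IsCompleteTo G (T.erase (q 0)) (p a))
    (hby : IsCompleteTo G (T.erase (q k)) (p b)) : a + 1 = b ∨ b + 1 = a := by
  by_contra hab
  have hne : a ≠ b := by
    rintro rfl
    have := (h.antipath_compl_adj_iff hq hqT (Nat.zero_le k) ha ham hax (Nat.zero_le k)).2 rfl
    rw [h.antipath_compl_adj_iff hq hqT le_rfl ha ham hby (Nat.zero_le k)] at this
    omega
  refine (h.antipath_cons hq hqT ha ham hax).false_of_close h.noOddAntihole (by omega)
    hev.add_one (w := p b) ?_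
  rintro (_ | i) hi
  · refine iff_of_true ((h.path_compl_adj hbm.le ham.le).2 ?_) (by omega)
    omega
  · refine (h.antipath_compl_adj_iff hq hqT le_rfl hb hbm hby (by omega)).trans ?_
    omega

/-- Two vertices inside the path, one complete to all of `T` but the first vertex and
the other to all of `T` but the last vertex of an antipath in `T` of
odd length, are not adjacent. -/
theorem not_adj_of_odd (h : IsCounterexample G p m v T) (hq : IsInducedPath_s8 Gᶜ q k)
    (hqT : ∀ i ≤ k, q i ∈ T) (hk : 2 ≤ k) (hodd : Odd k) {a b : ℕ} (ha : 0 < a) (ham : a < m)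
    (hb : 0 < b) (hbm : b < m) (hax : IsCompleteTo G (T.erase (q 0)) (p a))
    (hby : IsCompleteTo G (T.erase (q k)) (p b)) : ¬ (a + 1 = b ∨ b + 1 = a) := by
  intro hab
  have hcons : IsInducedPath_s8 Gᶜ (consSeq v (consSeq (p a) q)) (k + 1 + 1) := by
    refine (h.antipath_cons hq hqT ha ham hax).cons ?_ ?_
    · rintro (_ | i) hi
      · exact (h.compl_adj ha ham).ne
      · exact (h.complete _ (hqT i (by omega))).ne
    · rintro (_ | i) hi
      · exact iff_of_true (h.compl_adj ha ham) rfl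
      · exact iff_of_false (h.complete.not_compl_adj (hqT i (by omega))) (by omega)
  refine hcons.false_of_close h.noOddAntihole (by omega) (hodd.add_one.add_one) (w := p b) ?_
  rintro (_ | _ | i) hi
  · exact iff_of_true (h.compl_adj hb hbm).symm (by omega)
  · refine iff_of_false (fun hadj => ?_) (by omega)
    have := (h.path_compl_adj hbm.le ham.le).1 hadj
    omega
  · refine (h.antipath_compl_adj_iff hq hqT le_rfl hb hbm hby (by omega)).trans ?_
    omega

theorem not_even_antipath (h : IsCounterexample G p m v T) (hq : IsInducedPath_s8 Gᶜ q k)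
    (hqT : ∀ i ≤ k, q i ∈ T) (hk : 2 ≤ k)
    (hA : Odd (numCompleteEdges G (T.erase (q 0)) p m))
    (hB : Odd (numCompleteEdges G (T.erase (q k)) p m)) : ¬ Even k := by
  intro hev
  obtain ⟨i, hi, hi1, hi2⟩ := exists_completeEdge hA
  obtain ⟨j, hj, hj1, hj2⟩ := exists_completeEdge hB
  have key := fun (a b : ℕ) (ha : 0 < a) (ham : a < m) (hb : 0 < b) (hbm : b < m) hax hby =>
    h.adj_of_even hq hqT hk hev (a := a) (b := b) ha ham hb hbm hax hby
  have h3 := h.three_le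
  have hm3 := h.ne_three
  have k1 := fun h1 h2 h3 h4 => key i j h1 h2 h3 h4 hi1 hj1
  have k2 := fun h1 h2 h3 h4 => key i (j + 1) h1 h2 h3 h4 hi1 hj2
  have k3 := fun h1 h2 h3 h4 => key (i + 1) j h1 h2 h3 h4 hi2 hj1
  have k4 := fun h1 h2 h3 h4 => key (i + 1) (j + 1) h1 h2 h3 h4 hi2 hj2
  omega

theorem not_odd_antipath (h : IsCounterexample G p m v T) (hq : IsInducedPath_s8 Gᶜ q k)
    (hqT : ∀ i ≤ k, q i ∈ T) (hk : 2 ≤ k)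
    (hA : Odd (numCompleteEdges G (T.erase (q 0)) p m))
    (hB : Odd (numCompleteEdges G (T.erase (q k)) p m))
    (hS : Odd (numCompleteEdges G ((T.erase (q 0)).erase (q k)) p m)) : ¬ Odd k := by
  intro hodd
  have hmiss : ∀ c ≤ m, IsCompleteTo G ((T.erase (q 0)).erase (q k)) (p c) →
      G.Adj (p c) (q 0) ∨ G.Adj (p c) (q k) := by
    intro c hc hcS
    by_contra! hcon
    have hne : ∀ i ≤ k, p c ≠ q i := fun i hi e => h.notMem c hc (e ▸ hqT i hi)
    refine hq.false_of_close h.noOddAntihole (by rcases hodd with ⟨a, ha⟩; omega) hodd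
      (w := p c) fun i hi => ?_
    constructor
    · intro hadj
      by_contra! hi'
      exact hadj.2 (hcS _ (Finset.mem_erase.2 ⟨fun e => hi'.2 (hq.inj i hi k le_rfl e),
        Finset.mem_erase.2 ⟨fun e => hi'.1 (hq.inj i hi 0 (by omega) e), hqT i hi⟩⟩))
    · rintro (rfl | rfl)
      · exact ⟨hne _ hi, hcon.1⟩
      · exact ⟨hne _ hi, hcon.2⟩
  have hcross : ∀ a b, a ≤ m → b ≤ m → a + 1 = b ∨ b + 1 = a →
      IsCompleteTo G ((T.erase (q 0)).erase (q k)) (p a) →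
      IsCompleteTo G ((T.erase (q 0)).erase (q k)) (p b) →
      G.Adj (p a) (q 0) ∨ G.Adj (p b) (q k) := by
    intro a b ha hb hab haS hbS
    by_contra! hcon
    have hak := (hmiss a ha haS).resolve_left hcon.1
    have hb0 := (hmiss b hb hbS).resolve_right hcon.2
    have ha' := h.interior_of_not_complete ha fun hh => hcon.1 (hh _ (hqT 0 (by omega)))
    have hb' := h.interior_of_not_complete hb fun hh => hcon.2 (hh _ (hqT k le_rfl))
    rw [Finset.erase_right_comm] at hbS
    exact h.not_adj_of_odd hq hqT hk hodd ha'.1 ha'.2 hb'.1 hb'.2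
      (isCompleteTo_of_erase haS hak) (isCompleteTo_of_erase hbS hb0) hab
  have hsplit : numCompleteEdges G ((T.erase (q 0)).erase (q k)) p m =
      numCompleteEdges G (T.erase (q 0)) p m + numCompleteEdges G (T.erase (q k)) p m := by
    unfold numCompleteEdges
    rw [← Finset.card_union_of_disjoint]
    · congr 1
      ext c
      simp only [Finset.mem_union, Finset.mem_filter, ← and_or_left]
      refine and_congr_right fun hc => ⟨fun ⟨h1, h2⟩ => ?_, ?_⟩
      · have hcm := Finset.mem_range.1 hc
        have m1 := hmiss c hcm.le h1
        have m2 := hmiss (c + 1) hcm h2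
        have c1 := hcross c (c + 1) hcm.le hcm (Or.inl rfl) h1 h2
        have c2 := hcross (c + 1) c hcm hcm.le (Or.inr rfl) h2 h1
        have h1' := h1
        have h2' := h2
        rw [Finset.erase_right_comm] at h1' h2'
        by_cases hk' : G.Adj (p c) (q k) ∧ G.Adj (p (c + 1)) (q k)
        · exact Or.inl ⟨isCompleteTo_of_erase h1 hk'.1, isCompleteTo_of_erase h2 hk'.2⟩
        · have h0 : G.Adj (p c) (q 0) ∧ G.Adj (p (c + 1)) (q 0) := by tauto
          exact Or.inr ⟨isCompleteTo_of_erase h1' h0.1, isCompleteTo_of_erase h2' h0.2⟩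
      · rintro (⟨h1, h2⟩ | ⟨h1, h2⟩)
        · exact ⟨fun t ht => h1 t (Finset.mem_of_mem_erase ht),
            fun t ht => h2 t (Finset.mem_of_mem_erase ht)⟩
        · rw [Finset.erase_right_comm]
          exact ⟨fun t ht => h1 t (Finset.mem_of_mem_erase ht),
            fun t ht => h2 t (Finset.mem_of_mem_erase ht)⟩
    · rw [Finset.disjoint_filter]
      rintro c hc ⟨h1, h2⟩ ⟨h3, h4⟩
      have hcm := Finset.mem_range.1 hc
      have hboth : ∀ w, IsCompleteTo G (T.erase (q 0)) w → IsCompleteTo G (T.erase (q k)) w →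
          IsCompleteTo G T w := fun w hw0 hwk => isCompleteTo_of_erase hw0 <|
        hwk _ (Finset.mem_erase.2 ⟨fun e => by
          have := hq.inj 0 (by omega) k le_rfl e
          omega, hqT 0 (by omega)⟩)
      have hm := h.three_le
      by_cases hc0 : c = 0
      · exact h.interior (c + 1) (by omega) (by omega) (hboth _ h2 h4)
      · exact h.interior c (by omega) hcm (hboth _ h1 h3)
  rw [hsplit] at hS
  exact Nat.not_even_iff_odd.2 hS (hA.add_odd hB)

end Antipath

theorem false_of_forall_ssubset (h : IsCounterexample G p m v T)
    (ih : ∀ S ⊂ T, CutConnected Gᶜ S → Odd (numCompleteEdges G S p m)) : False := by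
  obtain ⟨u, hu, w, hw, huw, hadj⟩ := h.exists_adj ih
  obtain ⟨x, hx, y, hy, hxy, hxy', hTx, hTy, hor⟩ :=
    h.anticonnected.exists_pair hu hw huw.symm fun hh => hh.2 hadj
  have hA := ih _ (Finset.erase_ssubset hx) hTx
  have hB := ih _ (Finset.erase_ssubset hy) hTy
  rcases hor with hS | ⟨z, hz, hxz, hzy⟩
  · obtain ⟨q, k, hq, rfl, rfl, hqT⟩ := h.anticonnected.exists_inducedPath hx hy
    have hk : 2 ≤ k := by
      by_contra hk
      rcases (by omega : k = 0 ∨ k = 1) with rfl | rfl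
      · exact hxy rfl
      · exact hxy' ((hq.adj 0 (by omega) 1 (by omega)).2 (by omega))
    refine h.not_odd_antipath hq hqT hk hA hB (ih _ ?_ hS)
      (Nat.not_even_iff_odd.1 (h.not_even_antipath hq hqT hk hA hB))
    exact (Finset.erase_subset _ _).trans_ssubset (Finset.erase_ssubset hx)
  · have hy0 : IsInducedPath_s8 Gᶜ (fun _ => y) 0 :=
      ⟨fun i hi j hj _ => by omega, fun i hi j hj => by simp; omega⟩
    have hzy' : IsInducedPath_s8 Gᶜ (consSeq z fun _ => y) 1 :=
      hy0.cons (fun _ _ => hzy.ne) fun i hi => iff_of_true hzy (by omega)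
    have hxzy : IsInducedPath_s8 Gᶜ (consSeq x (consSeq z fun _ => y)) 2 := by
      refine hzy'.cons ?_ ?_
      · rintro (_ | i) hi
        · exact hxz.ne
        · exact hxy
      · rintro (_ | i) hi
        · exact iff_of_true hxz rfl
        · exact iff_of_false hxy' (by omega)
    refine h.not_even_antipath hxzy ?_ le_rfl hA hB even_two
    rintro (_ | _ | i) hi
    · exact hx
    · exact hz
    · exact hy

/-- A segment of odd length of the path of a counterexample whose ends, but no internal vertices,
are complete to an anticonnected subset of `T` is an edge or yields a smaller counterexample. -/
theorem segment (h : IsCounterexample G p m v T) (hST : S ⊆ T) (hS : CutConnected Gᶜ S) {i j : ℕ}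
    (hij : i + 3 ≤ j) (hj : j ≤ m) (hodd : Odd (j - i)) (hi' : IsCompleteTo G S (p i))
    (hj' : IsCompleteTo G S (p j)) (hint : ∀ k, i < k → k < j → ¬ IsCompleteTo G S (p k)) :
    IsCounterexample G (fun k => p (i + k)) (j - i) v S where
  noOddHole := h.noOddHole
  noOddAntihole := h.noOddAntihole
  path := h.path.segment (by omega)
  three_le := by omega
  odd := hodd
  notMem k hk hkS := h.notMem (i + k) (by omega) (hST hkS)
  not_adj k hk hkj := h.not_adj (i + k) (by omega) (by omega)
  complete t ht := h.complete t (hST ht)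
  left := hi'
  right := by rwa [Nat.add_sub_cancel' (by omega)]
  interior k hk hkj := hint (i + k) (by omega) (by omega)
  anticonnected := hS

theorem elim (h : IsCounterexample G p m v T) : False := by
  induction hc : T.card using Nat.strong_induction_on generalizing T p m with
  | _ c ih =>
    refine h.false_of_forall_ssubset fun S hST hS => ?_
    have hpar := card_filter_Ico_mod_two (M := fun k => IsCompleteTo G S (p k))
      (E := fun k => IsCompleteTo G S (p k) ∧ IsCompleteTo G S (p (k + 1))) (m := m)
      (fun _ hk => hk)
      (fun i j hij hj hi' hj' hint hodd => by
        by_cases hji : j = i + 1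
        · subst hji
          exact ⟨rfl, hi', hj'⟩
        · have h3 : i + 3 ≤ j := by
            rcases hodd with ⟨a, ha⟩
            omega
          exact (ih _ (hc ▸ Finset.card_lt_card hST)
            (h.segment hST.subset hS h3 hj hodd hi' hj' hint) rfl).elim)
      (Nat.zero_le m) le_rfl (fun t ht => h.left t (hST.subset ht))
      (fun t ht => h.right t (hST.subset ht))
    rw [← Finset.range_eq_Ico, Nat.sub_zero, Nat.odd_iff.1 h.odd] at hpar
    exact Nat.odd_iff.2 hpar

end IsCounterexample

end RousselRubio

/-- Corollary of the Roussel–Rubio lemma: if `P` is a chordless path of odd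
length at least 3 (on `n ≥ 4` vertices), vertex-disjoint from the anticonnected
set `T`, with both ends `T`-complete and no internal vertex `T`-complete, then
every `T`-complete vertex has a neighbour among the internal vertices of `P`. -/
theorem roussel_rubio_corollary {V : Type} [Fintype V] (G : SimpleGraph V)
    (hG : IsBerge G) (T : Set V) (hT : Anticonnected G T)
    (n : ℕ) (hn : 4 ≤ n) (hodd : Odd (n - 1)) (f : pathGraph n ↪g G)
    (hdisj : ∀ i : Fin n, (f i : V) ∉ T)
    (hx : IsTComplete G T (f ⟨0, by omega⟩))
    (hy : IsTComplete G T (f ⟨n - 1, by omega⟩))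
    (hint : ∀ i : Fin n, i.val ≠ 0 → i.val ≠ n - 1 → ¬ IsTComplete G T (f i))
    (v : V) (hv : IsTComplete G T v) :
    ∃ i : Fin n, i.val ≠ 0 ∧ i.val ≠ n - 1 ∧ G.Adj v (f i) := by
  classical
  by_contra! hcon
  have hlt : ∀ i, min i (n - 1) < n := fun i => by omega
  have hval : ∀ i ≤ n - 1, min i (n - 1) = i := fun i hi => min_eq_left hi
  refine IsCounterexample.elim (G := G) (p := fun i => f ⟨min i (n - 1), hlt i⟩) (m := n - 1)
    (v := v) (T := T.toFinset)
    { noOddHole := fun k hk hk' => (hG k hk hk').1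
      noOddAntihole := fun k hk hk' => (hG k hk hk').2
      path := ⟨fun i hi j hj hij => ?_, fun i hi j hj => ?_⟩
      three_le := by omega
      odd := hodd
      notMem := fun i _ hi => hdisj _ (Set.mem_toFinset.1 hi)
      not_adj := fun i hi him => hcon _ (by simp only; omega) (by simp only; omega)
      complete := fun t ht => hv.2 t (Set.mem_toFinset.1 ht)
      left := fun t ht => ?_
      right := fun t ht => ?_
      interior := fun i hi him hcomp => ?_
      anticonnected := cutConnected_of_connected_induce (by rwa [Set.coe_toFinset]) }
  · have := congrArg Fin.val (f.injective hij)
    simpa only [hval i hi, hval j hj] using this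
  · rw [f.map_adj_iff, pathGraph_adj]
    simp only [hval i hi, hval j hj]
  · simpa using hx.2 t (Set.mem_toFinset.1 ht)
  · simpa using hy.2 t (Set.mem_toFinset.1 ht)
  · exact hint ⟨min i (n - 1), hlt i⟩ (by simp only; omega) (by simp only; omega)
      ⟨hdisj _, fun t ht => hcomp t (Set.mem_toFinset.2 ht)⟩
end
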